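/- arXiv:1203.2429 — 2 statements merged into one kernel-verified Lean document; each statement's English description precedes it below -/
import Mathlib

section
/- Let S be a pseudo-nilpotent finite semigroup with largest nilpotent ideal K, and let C_1, ..., C_n be the connected components of the upper non-nilpotent graph N_S with more than one element. Then each C_k is a union of stems, each C_k ∪ K is a subsemigroup of S, and S/K = C_1^θ ∪ ... ∪ C_n^θ is a 0-disjoint union (the Rees quotient S/K is the union of the components with a common zero adjoined, any two distinct components intersecting only in the zero and multiplying to the zero). -/
/-- One multiplication step `a · w · b` where `w` ranges over `S¹`
(`none` playing the role of the adjoined identity). -/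
def mulW {S : Type*} [Semigroup S] (a : S) (w : Option S) (b : S) : S :=
  match w with
  | none => a * b
  | some c => a * c * b

/-- The Mal'cev sequences: `(malcev x y w n).1 = λ_n` and `(malcev x y w n).2 = ρ_n`,
with `λ_0 = x`, `ρ_0 = y`, `λ_{n+1} = λ_n w_{n+1} ρ_n`, `ρ_{n+1} = ρ_n w_{n+1} λ_n`. -/
def malcev {S : Type*} [Semigroup S] (x y : S) (w : ℕ → Option S) : ℕ → S × S
  | 0 => (x, y)
  | n + 1 =>
      let p := malcev x y w n
      (mulW p.1 (w n) p.2, mulW p.2 (w n) p.1)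

/-- Mal'cev nilpotency of a (multiplicatively closed) subset `A` of `S`,
computed with parameters from `A¹`. -/
def SetMN {S : Type*} [Semigroup S] (A : Set S) : Prop :=
  ∃ n : ℕ, 0 < n ∧ ∀ x ∈ A, ∀ y ∈ A, ∀ w : ℕ → Option S,
    (∀ k c, w k = some c → c ∈ A) →
    (malcev x y w n).1 = (malcev x y w n).2

/-- A semigroup is Mal'cev nilpotent. -/
def IsMN (S : Type*) [Semigroup S] : Prop := SetMN (Set.univ : Set S)

/-- Equality in the Rees quotient by (the possibly empty ideal) `I`. -/
def ReesEq {S : Type*} [Semigroup S] (I : Set S) (a b : S) : Prop :=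
  a = b ∨ (a ∈ I ∧ b ∈ I)

/-- Mal'cev nilpotency of the Rees quotient `A / I` (computed by lifting to `A`). -/
def SetMNMod {S : Type*} [Semigroup S] (I A : Set S) : Prop :=
  ∃ n : ℕ, 0 < n ∧ ∀ x ∈ A, ∀ y ∈ A, ∀ w : ℕ → Option S,
    (∀ k c, w k = some c → c ∈ A) →
    ReesEq I (malcev x y w n).1 (malcev x y w n).2

/-- `I` is an ideal of (the mul-closed subset) `T`; the empty set counts as an ideal. -/
def IsIdealIn {S : Type*} [Semigroup S] (T I : Set S) : Prop :=
  I ⊆ T ∧ ∀ a ∈ I, ∀ t ∈ T, t * a ∈ I ∧ a * t ∈ I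

/-- Edge of the upper non-nilpotent graph `N_S`: `⟨a,b⟩` is not Mal'cev nilpotent. -/
def NEdge {S : Type*} [Semigroup S] (a b : S) : Prop :=
  a ≠ b ∧ ¬ SetMN (Subsemigroup.closure ({a, b} : Set S) : Set S)

/-- The generating set of the subsemigroup `⟨x, y, w_1, …, w_m⟩`. -/
def genSet {S : Type*} [Semigroup S] (x y : S) (w : ℕ → Option S) (m : ℕ) : Set S :=
  {x, y} ∪ {c | ∃ k, k < m ∧ w k = some c}

/-- A pseudo-nilpotent semigroup. -/
def IsPN (S : Type*) [Semigroup S] : Prop :=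
  ∀ (x y : S) (w : ℕ → Option S) (m : ℕ) (I : Set S),
    IsIdealIn (Subsemigroup.closure (genSet x y w m) : Set S) I →
    (malcev x y w m).1 ∉ I → (malcev x y w m).2 ∉ I →
    (∃ t, t < m ∧ (malcev x y w t).1 ≠ (malcev x y w t).2 ∧
      malcev x y w t = malcev x y w m) →
    ∀ i ≤ m, ¬ SetMNMod I
      (Subsemigroup.closure ({(malcev x y w i).1, (malcev x y w i).2} : Set S) : Set S)

/-- A principal series `S = S_1 ⊃ S_2 ⊃ ⋯ ⊃ S_m ⊃ S_{m+1} = ∅` of a semigroup: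
a strictly decreasing chain of ideals with no ideal strictly between consecutive
terms (the empty set counts as an ideal). -/
structure PrincipalSeries (S : Type*) [Semigroup S] where
  m : ℕ
  C : ℕ → Set S
  first : C 1 = Set.univ
  last : C (m + 1) = ∅
  ideal : ∀ i, 1 ≤ i → i ≤ m → IsIdealIn Set.univ (C i)
  ssub : ∀ i, 1 ≤ i → i ≤ m → C (i + 1) ⊂ C i
  maximal : ∀ i, 1 ≤ i → i ≤ m → ∀ I : Set S, IsIdealIn Set.univ I →
    C (i + 1) ⊆ I → I ⊆ C i → I = C (i + 1) ∨ I = C i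

variable {S : Type*} [Semigroup S]

/-- `F_{S_j/S_{j+1}}(S/S_{j+1})`, computed in `S`:  the elements `s ∉ S_j` with
`s·a ≠ θ` or `a·s ≠ θ` in `S/S_{j+1}` for some `a` in the ideal `S_j/S_{j+1}`. -/
def FsetQ (ps : PrincipalSeries S) (j : ℕ) : Set S :=
  {s | s ∉ ps.C j ∧ ∃ a ∈ ps.C j, s * a ∉ ps.C (j + 1) ∨ a * s ∉ ps.C (j + 1)}

/-- `S_i \ S_{i+1}` is a root: the principal factor `S_i/S_{i+1}` is not Mal'cev
nilpotent and there is no `N_S`-edge between `S_i \ S_{i+1}` and `S_{i+1}`. -/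
def Root (ps : PrincipalSeries S) (i : ℕ) : Prop :=
  ¬ SetMNMod (ps.C (i + 1)) (ps.C i) ∧
  ∀ a ∈ ps.C i \ ps.C (i + 1), ∀ b ∈ ps.C (i + 1), ¬ NEdge a b

/-- `S_i \ S_{i+1}` is an isolated subset: it is not a root, and whenever
`S_i \ S_{i+1} ⊆ F_{S_j/S_{j+1}}(S/S_{j+1})` the factor `S_j/S_{j+1}` is nilpotent. -/
def Isolated (ps : PrincipalSeries S) (i : ℕ) : Prop :=
  ¬ Root ps i ∧
  ∀ j, 1 ≤ j → j ≤ ps.m → ps.C i \ ps.C (i + 1) ⊆ FsetQ ps j →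
    SetMNMod (ps.C (j + 1)) (ps.C j)

/-- `K`, the union of all isolated subsets `S_i \ S_{i+1}`. -/
def Kset (ps : PrincipalSeries S) : Set S :=
  {a | ∃ i, 1 ≤ i ∧ i ≤ ps.m ∧ Isolated ps i ∧ a ∈ ps.C i \ ps.C (i + 1)}

/-- The stem `S^{(i)} = F_{S_i/S_{i+1}}(S/S_{i+1}) ∪ (S_i \ S_{i+1})` of a root. -/
def Stem (ps : PrincipalSeries S) (i : ℕ) : Set S :=
  FsetQ ps i ∪ (ps.C i \ ps.C (i + 1))

/-- Reachability in the upper non-nilpotent graph `N_S` (connected components). -/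
def NReach {S : Type*} [Semigroup S] (a b : S) : Prop :=
  Relation.ReflTransGen (fun x y : S => NEdge x y) a b

section FiniteMonoid

variable {M : Type*} [Monoid M]

theorem exists_pow_mul_self_eq [Finite M] (a : M) : ∃ n : ℕ, 0 < n ∧ a ^ n * a ^ n = a ^ n := by
  obtain ⟨i, j, hij, h⟩ := Finite.exists_ne_map_eq_of_infinite (fun n : ℕ => a ^ n)
  wlog hlt : i < j generalizing i j
  · exact this j i hij.symm h.symm (by omega)
  obtain ⟨d, rfl⟩ := Nat.exists_eq_add_of_lt hlt
  set p := d + 1 with hp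
  have h1 : ∀ k, i ≤ k → a ^ (k + p) = a ^ k := by
    intro k hk
    obtain ⟨l, rfl⟩ := Nat.exists_eq_add_of_le hk
    have : a ^ i = a ^ (i + p) := h
    rw [show i + l + p = (i + p) + l by ring, pow_add, ← this, ← pow_add]
  have h2 : ∀ q k, i ≤ k → a ^ (k + q * p) = a ^ k := by
    intro q
    induction q with
    | zero => simp
    | succ q ih =>
      intro k hk
      rw [show k + (q + 1) * p = (k + q * p) + p by ring, h1 _ (by omega), ih k hk]
  refine ⟨(i + 1) * p, by positivity, ?_⟩
  rw [← pow_add, h2]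
  nlinarith

/-- Green's relation `𝓡`. -/
def GreenR (a b : M) : Prop := ∃ u v, a = b * u ∧ b = a * v

/-- Green's relation `𝓛`. -/
def GreenL (a b : M) : Prop := ∃ u v, a = u * b ∧ b = v * a

theorem GreenR.refl (a : M) : GreenR a a := ⟨1, 1, by simp, by simp⟩

theorem GreenR.symm {a b : M} : GreenR a b → GreenR b a := fun ⟨u, v, h, h'⟩ => ⟨v, u, h', h⟩

theorem GreenR.trans {a b c : M} : GreenR a b → GreenR b c → GreenR a c := by
  rintro ⟨u, v, rfl, h⟩ ⟨u', v', rfl, h'⟩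
  exact ⟨u' * u, v * v', by simp [mul_assoc], by rw [← mul_assoc, ← h, ← h']⟩

theorem GreenL.refl (a : M) : GreenL a a := ⟨1, 1, by simp, by simp⟩

theorem GreenL.symm {a b : M} : GreenL a b → GreenL b a := fun ⟨u, v, h, h'⟩ => ⟨v, u, h', h⟩

theorem GreenL.trans {a b c : M} : GreenL a b → GreenL b c → GreenL a c := by
  rintro ⟨u, v, rfl, h⟩ ⟨u', v', rfl, h'⟩
  exact ⟨u * u', v' * v, by simp [mul_assoc], by rw [mul_assoc, ← h, ← h']⟩

open MulOpposite in
theorem greenR_op {a b : M} : GreenR (op a) (op b) ↔ GreenL a b := by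
  constructor
  · rintro ⟨u, v, h, h'⟩
    exact ⟨unop u, unop v, congrArg unop h, congrArg unop h'⟩
  · rintro ⟨u, v, h, h'⟩
    exact ⟨op u, op v, congrArg op h, congrArg op h'⟩

open MulOpposite in
theorem greenL_op {a b : M} : GreenL (op a) (op b) ↔ GreenR a b := by
  constructor
  · rintro ⟨u, v, h, h'⟩
    exact ⟨unop u, unop v, congrArg unop h, congrArg unop h'⟩
  · rintro ⟨u, v, h, h'⟩
    exact ⟨op u, op v, congrArg op h, congrArg op h'⟩

/-- `J` is a `𝓙`-class lying immediately above the ideal `I`, and `1 ∉ J`. -/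
structure ClassOver (I J : Set M) : Prop where
  mul_left : ∀ a ∈ I, ∀ t, t * a ∈ I
  mul_right : ∀ a ∈ I, ∀ t, a * t ∈ I
  left_or : ∀ a ∈ J, ∀ t, t * a ∈ J ∨ t * a ∈ I
  right_or : ∀ a ∈ J, ∀ t, a * t ∈ J ∨ a * t ∈ I
  notMem : ∀ a ∈ J, a ∉ I
  one_notMem : (1 : M) ∉ J
  exists_eq : ∀ a ∈ J, ∀ b ∈ J, ∃ s t, b = s * a * t

/-- A symmetric set `D` of pairs of distinct elements of `N \ I` in which the Mal'cev step
`(x, y) ↦ (x w y, y w x)` can be repeated forever with parameters `w` in `N`. -/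
def MalcevStable (I : Set M) (N : Submonoid M) (D : M → M → Prop) : Prop :=
  ∀ x y, D x y → D y x ∧ x ∈ N ∧ x ≠ 1 ∧ x ∉ I ∧ x ≠ y ∧ ∃ w ∈ N, D (x * w * y) (y * w * x)

/-- The form of pseudo-nilpotency used below: a pair starting an endless Mal'cev sequence modulo
`I` generates a submonoid that itself contains such a sequence. -/
def PseudoNilpotentOver (I : Set M) : Prop :=
  ∀ D, MalcevStable I ⊤ D → ∀ x y, D x y → ∀ N : Submonoid M, x ∈ N → y ∈ N →
    ∃ D', (∃ x' y', D' x' y') ∧ MalcevStable I N D'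

/-- The pair `(x, y)` starts an endless Mal'cev sequence modulo `I`. -/
def MalcevPair (I : Set M) (x y : M) : Prop := ∃ D, MalcevStable I ⊤ D ∧ D x y

section Opposite

open MulOpposite

theorem finite_mulOpposite {α : Type*} [Finite α] : Finite αᵐᵒᵖ := Finite.of_equiv α opEquiv

theorem ClassOver.op {I J : Set M} (h : ClassOver I J) :
    ClassOver (unop ⁻¹' I : Set Mᵐᵒᵖ) (unop ⁻¹' J) where
  mul_left a ha t := h.mul_right (unop a) ha (unop t)
  mul_right a ha t := h.mul_left (unop a) ha (unop t)
  left_or a ha t := h.right_or (unop a) ha (unop t)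
  right_or a ha t := h.left_or (unop a) ha (unop t)
  notMem a ha := h.notMem (unop a) ha
  one_notMem := h.one_notMem
  exists_eq a ha b hb := by
    obtain ⟨s, t, e⟩ := h.exists_eq (unop a) ha (unop b) hb
    exact ⟨MulOpposite.op t, MulOpposite.op s, unop_injective (by simp [e, mul_assoc])⟩

theorem MalcevStable.unop {I : Set M} {N : Submonoid Mᵐᵒᵖ} {D : Mᵐᵒᵖ → Mᵐᵒᵖ → Prop}
    (h : MalcevStable (unop ⁻¹' I) N D) :
    MalcevStable I N.unop (fun x y => D (MulOpposite.op x) (MulOpposite.op y)) := by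
  intro x y hxy
  obtain ⟨h1, h2, h3, h4, h5, w, hw, h6⟩ := h _ _ hxy
  refine ⟨h1, h2, fun e => h3 (by simp [e]), h4, fun e => h5 (by simp [e]), MulOpposite.unop w,
    hw, ?_⟩
  have := (h _ _ h6).1
  simpa [mul_assoc] using this

theorem MalcevStable.op {I : Set M} {N : Submonoid M} {D : M → M → Prop}
    (h : MalcevStable I N D) :
    MalcevStable (MulOpposite.unop ⁻¹' I) N.op
      (fun x y => D (MulOpposite.unop x) (MulOpposite.unop y)) := by
  intro x y hxy
  obtain ⟨h1, h2, h3, h4, h5, w, hw, h6⟩ := h _ _ hxy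
  refine ⟨h1, h2, fun e => h3 (by simp [e]), h4, fun e => h5 (by simp [e]), MulOpposite.op w,
    hw, ?_⟩
  have := (h _ _ h6).1
  simpa [mul_assoc] using this

theorem PseudoNilpotentOver.op {I : Set M} (h : PseudoNilpotentOver I) :
    PseudoNilpotentOver (unop ⁻¹' I : Set Mᵐᵒᵖ) := by
  intro D hD x y hxy N hx hy
  obtain ⟨D', ⟨x', y', h1⟩, h2⟩ := h _ hD.unop (MulOpposite.unop x) (MulOpposite.unop y) hxy
    N.unop hx hy
  exact ⟨_, ⟨MulOpposite.op x', MulOpposite.op y', h1⟩, h2.op⟩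

end Opposite

namespace ClassOver

variable {I J : Set M}

theorem left_mem (h : ClassOver I J) {a t : M} (ha : a ∈ J) (hta : t * a ∉ I) : t * a ∈ J :=
  (h.left_or a ha t).resolve_right hta

theorem right_mem (h : ClassOver I J) {a t : M} (ha : a ∈ J) (hat : a * t ∉ I) : a * t ∈ J :=
  (h.right_or a ha t).resolve_right hat

theorem of_left (h : ClassOver I J) {a s t : M} (ha : a ∈ J) (hs : s * (a * t) ∈ J) :
    a * t ∈ J :=
  h.right_mem ha fun hI => h.notMem _ hs (h.mul_left _ hI s)

theorem of_right (h : ClassOver I J) {a s t : M} (ha : a ∈ J) (hs : s * a * t ∈ J) :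
    s * a ∈ J :=
  h.left_mem ha fun hI => h.notMem _ hs (h.mul_right _ hI t)

variable [Finite M]

local instance : Finite Mᵐᵒᵖ := finite_mulOpposite

theorem greenR (h : ClassOver I J) {a b : M} (ha : a ∈ J) (hab : a * b ∈ J) :
    GreenR a (a * b) := by
  obtain ⟨p, q, e⟩ := h.exists_eq _ hab _ ha
  have hn : ∀ n : ℕ, a = p ^ n * a * (b * q) ^ n := by
    intro n
    induction n with
    | zero => simp
    | succ n ih =>
      calc a = p ^ n * (p * (a * b) * q) * (b * q) ^ n := by rw [← e]; exact ih
        _ = _ := by rw [pow_succ p, pow_succ' (b * q)]; simp only [mul_assoc]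
  obtain ⟨n, hn0, hid⟩ := exists_pow_mul_self_eq (b * q)
  obtain ⟨k, rfl⟩ := Nat.exists_eq_succ_of_ne_zero hn0.ne'
  refine ⟨q * (b * q) ^ k, b, ?_, rfl⟩
  have : a = a * (b * q) ^ (k + 1) := by
    conv_lhs => rw [hn (k + 1), ← hid, ← mul_assoc, ← hn (k + 1)]
  rw [pow_succ'] at this
  simpa [mul_assoc] using this

theorem greenL (h : ClassOver I J) {a b : M} (hb : b ∈ J) (hab : a * b ∈ J) :
    GreenL b (a * b) :=
  greenR_op.1 (h.op.greenR (a := MulOpposite.op b) (b := MulOpposite.op a) hb hab)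

theorem mul_mul_mem (h : ClassOver I J) {a b c : M} (hb : b ∈ J) (hab : a * b ∈ J)
    (hbc : b * c ∈ J) : a * b * c ∈ J := by
  obtain ⟨u, v, e, -⟩ := h.greenL hb hab
  refine h.right_mem hab fun hI => h.notMem _ hbc ?_
  rw [e, mul_assoc]
  exact h.mul_left _ hI u

theorem exists_stable (h : ClassOver I J) (hP : PseudoNilpotentOver I) {a b c : M} (ha : a ∈ J)
    (hb : b ∈ J) (hc : c ∈ J) (hL : GreenL a b) (hR : ¬ GreenR a b) (hca : c * a ∈ J)
    (hcb : c * b ∈ J) (N : Submonoid M) (haN : a ∈ N) (hbN : b ∈ N) :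
    ∃ D', (∃ x' y', D' x' y') ∧ MalcevStable I N D' := by
  refine hP (fun x y => x ∈ J ∧ y ∈ J ∧ GreenL x y ∧ ¬ GreenR x y ∧ c * x ∈ J ∧ c * y ∈ J)
    ?_ a b ⟨ha, hb, hL, hR, hca, hcb⟩ N haN hbN
  rintro x y ⟨hx, hy, hxy, hn, hcx, hcy⟩
  refine ⟨⟨hy, hx, hxy.symm, fun k => hn k.symm, hcy, hcx⟩, trivial,
    fun e => h.one_notMem (e ▸ hx), h.notMem _ hx, fun e => hn (e ▸ GreenR.refl _), ?_⟩
  obtain ⟨s, t, e⟩ := h.exists_eq x hx c hc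
  refine ⟨t, trivial, ?_⟩
  have hxt : x * t ∈ J := h.of_left (s := s) hx (by rwa [← mul_assoc, ← e])
  obtain ⟨u, v, e1, e2⟩ := hxy
  have hyt : y * t ∈ J := h.of_left (s := u) hy (by rwa [← mul_assoc, ← e1])
  have key : ∀ z ∈ J, c * z ∈ J → x * t * z ∈ J ∧ y * t * z ∈ J := by
    intro z hz hcz
    have h1 : x * t * z ∈ J := h.of_left (s := s) hxt (by rwa [← mul_assoc, ← mul_assoc, ← e])
    refine ⟨h1, h.of_left (s := u) hyt ?_⟩
    rwa [← mul_assoc, ← mul_assoc, ← e1]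
  have hxty := (key y hy hcy).1
  have hytx := (key x hx hcx).2
  have r1 : GreenR x (x * t * y) := by
    rw [mul_assoc] at hxty ⊢
    exact h.greenR hx hxty
  have r2 : GreenR y (y * t * x) := by
    rw [mul_assoc] at hytx ⊢
    exact h.greenR hy hytx
  refine ⟨hxty, hytx, ?_, fun k => hn ((r1.trans k).trans r2.symm), ?_, ?_⟩
  · exact ((h.greenL hy hxty).symm.trans ⟨v, u, e2, e1⟩).trans (h.greenL hx hytx)
  · rw [mul_assoc] at hxty ⊢
    rw [← mul_assoc]
    exact h.mul_mul_mem hx hcx hxty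
  · rw [mul_assoc] at hytx ⊢
    rw [← mul_assoc]
    exact h.mul_mul_mem hy hcy hytx

theorem mul_self_mem (h : ClassOver I J) (hP : PseudoNilpotentOver I) {a b c : M} (ha : a ∈ J)
    (hb : b ∈ J) (hc : c ∈ J) (hL : GreenL a b) (hR : ¬ GreenR a b) (hca : c * a ∈ J)
    (hcb : c * b ∈ J) : a * a ∈ J := by
  by_contra hcon
  have haa : a * a ∈ I := (h.left_or a ha a).resolve_left hcon
  have hba : b * a ∈ I := by
    obtain ⟨u, v, -, e⟩ := hL
    rw [e, mul_assoc]
    exact h.mul_left _ haa v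
  have hpow : ∀ n : ℕ, 0 < n → b ^ n * a ∈ I := by
    intro n hn
    obtain ⟨k, rfl⟩ := Nat.exists_eq_succ_of_ne_zero hn.ne'
    rw [pow_succ, mul_assoc]
    exact h.mul_left _ hba _
  let N : Submonoid M :=
    { carrier := {z | z ∈ I ∨ (∃ n : ℕ, z = b ^ n) ∨ ∃ n : ℕ, z = a * b ^ n}
      one_mem' := Or.inr (Or.inl ⟨0, by simp⟩)
      mul_mem' := by
        rintro x y (hx | hx) hy
        · exact Or.inl (h.mul_right _ hx _)
        rcases hy with hy | hy
        · exact Or.inl (h.mul_left _ hy _)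
        rcases hx with ⟨n, rfl⟩ | ⟨n, rfl⟩ <;> rcases hy with ⟨m, rfl⟩ | ⟨m, rfl⟩
        · exact Or.inr (Or.inl ⟨n + m, by rw [pow_add]⟩)
        · rcases Nat.eq_zero_or_pos n with rfl | hn
          · exact Or.inr (Or.inr ⟨m, by simp⟩)
          · left
            rw [← mul_assoc]
            exact h.mul_right _ (hpow n hn) _
        · exact Or.inr (Or.inr ⟨n + m, by rw [pow_add, mul_assoc]⟩)
        · left
          rcases Nat.eq_zero_or_pos n with rfl | hn
          · simp only [pow_zero, mul_one, ← mul_assoc]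
            exact h.mul_right _ haa _
          · rw [mul_assoc, ← mul_assoc (b ^ n)]
            exact h.mul_left _ (h.mul_right _ (hpow n hn) _) _ }
  obtain ⟨D, ⟨x, y, hxy⟩, hD⟩ := h.exists_stable hP ha hb hc hL hR hca hcb N
    (Or.inr (Or.inr ⟨0, by simp⟩)) (Or.inr (Or.inl ⟨1, by simp⟩))
  have memJI : ∀ z ∈ N, z ≠ 1 → z ∈ J ∨ z ∈ I := by
    rintro z (hz | ⟨n, rfl⟩ | ⟨n, rfl⟩) hz1
    · exact Or.inr hz
    · obtain ⟨k, rfl⟩ := Nat.exists_eq_succ_of_ne_zero (n := n) (by rintro rfl; simp at hz1)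
      rw [pow_succ]
      exact h.left_or b hb _
    · exact h.right_or a ha _
  have step : ∀ x y, D x y → ∃ n : ℕ, 0 < n ∧ x = b ^ n := by
    intro x y hxy
    obtain ⟨hs, hxN, hx1, hxI, -, w, hwN, hw⟩ := hD x y hxy
    obtain ⟨-, hyN, hy1, hyI, -⟩ := hD y x hs
    obtain ⟨hw', -⟩ := hD _ _ hw
    obtain ⟨-, -, -, hI, -⟩ := hD _ _ hw'
    rcases hxN with hx | ⟨n, rfl⟩ | ⟨n, rfl⟩
    · exact absurd hx hxI
    · exact ⟨n, Nat.pos_of_ne_zero (by rintro rfl; simp at hx1), rfl⟩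
    · exfalso
      have hone : y * w ≠ 1 := by
        intro e
        have : y * w ∈ J ∨ y * w ∈ I := by
          rcases memJI y hyN hy1 with hy | hy
          · exact h.right_or y hy w
          · exact Or.inr (h.mul_right _ hy _)
        rw [e] at this
        rcases this with k | k
        · exact h.one_notMem k
        · exact hxI (by simpa using h.mul_left _ k (a * b ^ n))
      rcases N.mul_mem hyN hwN with hz | ⟨m, hz⟩ | ⟨m, hz⟩
      · exact hI (h.mul_right _ hz _)
      · apply hI
        rw [hz, ← mul_assoc]
        refine h.mul_right _ (hpow m (Nat.pos_of_ne_zero ?_)) _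
        rintro rfl
        exact hone (by simpa using hz)
      · apply hI
        rw [hz]
        rcases Nat.eq_zero_or_pos m with rfl | hm
        · simp only [pow_zero, mul_one, ← mul_assoc]
          exact h.mul_right _ haa _
        · rw [mul_assoc, ← mul_assoc (b ^ m)]
          exact h.mul_left _ (h.mul_right _ (hpow m hm) _) _
  obtain ⟨hs, -, -, -, -, w, hwN, hw⟩ := hD x y hxy
  obtain ⟨n, hn, rfl⟩ := step _ _ hxy
  obtain ⟨m, hm, rfl⟩ := step _ _ hs
  obtain ⟨-, -, -, hI, hne, -⟩ := hD _ _ hw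
  rcases hwN with hz | ⟨k, rfl⟩ | ⟨k, rfl⟩
  · exact hI (h.mul_right _ (h.mul_left _ hz _) _)
  · exact hne (by simp only [← pow_add]; congr 1; ring)
  · apply hI
    rw [← mul_assoc]
    exact h.mul_right _ (h.mul_right _ (hpow n hn) _) _

theorem mul_mem_of_greenL (h : ClassOver I J) (hP : PseudoNilpotentOver I) {a b c : M}
    (ha : a ∈ J) (hb : b ∈ J) (hc : c ∈ J) (hL : GreenL a b) (hR : ¬ GreenR a b)
    (hca : c * a ∈ J) (hcb : c * b ∈ J) {d : M} (hd : d ∈ J) : d * a ∈ J := by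
  obtain ⟨s, t, e⟩ := h.exists_eq a ha d hd
  have hat : a * t ∈ J := h.of_left (s := s) ha (by rwa [← mul_assoc, ← e])
  obtain ⟨u, v, e1, e2⟩ := hL
  have hbt : b * t ∈ J := h.of_left (s := u) hb (by rwa [← mul_assoc, ← e1])
  have key : a * t * (a * t) ∈ J := by
    refine h.mul_self_mem hP hat hbt hc ⟨u, v, ?_, ?_⟩ (fun k => hR ?_) ?_ ?_
    · rw [← mul_assoc, ← e1]
    · rw [← mul_assoc, ← e2]
    · exact ((h.greenR ha hat).trans k).trans (h.greenR hb hbt).symm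
    · rw [← mul_assoc]; exact h.mul_mul_mem ha hca hat
    · rw [← mul_assoc]; exact h.mul_mul_mem hb hcb hbt
  have e3 : d = s * (a * t) := by rw [e, mul_assoc]
  obtain ⟨p, q, e4, -⟩ := h.greenL hat (a := s) (e3 ▸ hd)
  rw [← e3] at e4
  have : p * (d * a) * t ∈ J := by
    rw [e4] at key
    rw [← e4] at key
    have : a * t * (a * t) = p * (d * a) * t := by
      nth_rw 1 [e4]; simp only [mul_assoc]
    rwa [← this]
  refine h.left_mem ha fun hI => h.notMem _ this ?_
  exact h.mul_right _ (h.mul_left _ hI _) _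

theorem mul_mem_of_greenR (h : ClassOver I J) (hP : PseudoNilpotentOver I) {a b c : M}
    (ha : a ∈ J) (hb : b ∈ J) (hc : c ∈ J) (hR : GreenR a b) (hL : ¬ GreenL a b)
    (hac : a * c ∈ J) (hbc : b * c ∈ J) {d : M} (hd : d ∈ J) : a * d ∈ J :=
  h.op.mul_mem_of_greenL hP.op (a := .op a) (b := .op b) (c := .op c) (d := .op d) ha hb hc
    (greenL_op.2 hR) (fun k => hL (greenR_op.1 k)) hac hbc hd

theorem mul_mem_of_exists (h : ClassOver I J) (hP : PseudoNilpotentOver I) {a b c : M}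
    (ha : a ∈ J) (hb : b ∈ J) (hc : c ∈ J) (hL : GreenL a b) (hR : ¬ GreenR a b)
    (hca : c * a ∈ J) (hcb : c * b ∈ J) {d e : M} (hd : d ∈ J) (he : e ∈ J) : d * e ∈ J := by
  have hJa : ∀ d ∈ J, d * a ∈ J := fun d hd =>
    h.mul_mem_of_greenL hP ha hb hc hL hR hca hcb hd
  obtain ⟨s, t, e1⟩ := h.exists_eq a ha e he
  have e2 : e = s * (a * t) := by rw [e1, mul_assoc]
  have hat : a * t ∈ J := h.of_left (s := s) ha (by rwa [← e2])
  obtain ⟨v, -, e3, -⟩ := h.greenL ha (hJa a ha)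
  obtain ⟨s', -, e4, -⟩ := h.greenL hat (a := s) (e2 ▸ he)
  rw [← e2] at e4
  have hke : s * v * (a * s') * e = e := by
    calc s * v * (a * s') * e = s * (v * (a * (s' * e))) := by simp only [mul_assoc]
      _ = s * (v * (a * a) * t) := by rw [← e4]; simp only [mul_assoc]
      _ = e := by rw [← e3, ← e2]
  set k := s * v * (a * s') with hk
  have hkI : k ∉ I := fun hI => h.notMem e he (hke ▸ h.mul_right _ hI e)
  have has : a * s' ∈ J := h.right_mem ha fun hI => hkI (h.mul_left _ hI _)
  have hkJ : k ∈ J := h.left_mem has hkI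
  have fin : ∀ z, z * e ∈ J → (∃ u, z = u * d) → d * e ∈ J := by
    rintro z hz ⟨u, rfl⟩
    exact h.left_mem he fun hI => h.notMem _ hz (by rw [mul_assoc]; exact h.mul_left _ hI _)
  by_cases hkd : GreenL k d
  · obtain ⟨u, -, e5, -⟩ := hkd
    exact fin k (hke.symm ▸ he) ⟨u, e5⟩
  · obtain ⟨s2, t2, e5⟩ := h.exists_eq k hkJ d hd
    have hkt : k * t2 ∈ J := h.of_left (s := s2) hkJ (by rwa [← mul_assoc, ← e5])
    rw [mul_assoc] at e5
    have l1 := h.greenL hkt (a := s2) (e5 ▸ hd)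
    rw [← e5] at l1
    refine fin (k * t2) ?_ ⟨_, l1.choose_spec.choose_spec.1⟩
    refine h.mul_mem_of_greenR hP hkt hkJ ha (h.greenR hkJ hkt).symm (fun l => hkd ?_)
      (hJa _ hkt) (hJa _ hkJ) he
    exact l.symm.trans l1

theorem not_greenH (h : ClassOver I J) (hP : PseudoNilpotentOver I) {D : M → M → Prop}
    (hD : MalcevStable I ⊤ D) (hDJ : ∀ x y, D x y → x ∈ J) {x y : M} (hxy : D x y)
    (hR : GreenR x y) (hL : GreenL x y) : False := by
  obtain ⟨hs, -, -, -, hne, w, -, hw⟩ := hD x y hxy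
  have hx := hDJ _ _ hxy
  have hy := hDJ _ _ hs
  have hxwy := hDJ _ _ hw
  have hywx := hDJ _ _ (hD _ _ hw).1
  obtain ⟨k, k', e1, e2⟩ := hL
  have hxwx : x * w * x ∈ J := by
    rw [mul_assoc]
    refine h.of_left (s := k') hx ?_
    rwa [← mul_assoc, ← mul_assoc, ← e2]
  obtain ⟨n, hn, hid⟩ := exists_pow_mul_self_eq (x * w)
  have hpx : ∀ m : ℕ, (x * w) ^ m * x ∈ J := by
    intro m
    induction m with
    | zero => simpa
    | succ m ih =>
      rw [pow_succ]
      have := h.mul_mul_mem hx ih (c := w * x) (by rwa [← mul_assoc])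
      simpa only [mul_assoc] using this
  obtain ⟨m, rfl⟩ := Nat.exists_eq_succ_of_ne_zero hn.ne'
  set v := w * (x * w) ^ m with hv
  have hev : (x * w) ^ (m + 1) = x * v := by rw [pow_succ', mul_assoc]
  have heJ : x * v ∈ J := by
    refine h.right_mem hx fun hI => h.notMem _ (hpx (m + 1)) ?_
    rw [hev]
    exact h.mul_right _ hI _
  have hee : x * v * (x * v) = x * v := by rw [← hev]; exact hid
  obtain ⟨v', -, e3, -⟩ := h.greenR hx heJ
  have hLv : ∀ z, GreenL z x → z = z * v * v' := by
    rintro z ⟨u, -, rfl, -⟩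
    conv_lhs => rw [e3]
    simp only [mul_assoc]
  have hstab : MalcevStable I ⊤
      (fun a b => ∃ p q, D p q ∧ GreenL p x ∧ GreenL q x ∧ a = p * v ∧ b = q * v) := by
    rintro a b ⟨p, q, hpq, hp, hq, rfl, rfl⟩
    obtain ⟨hqp, -, -, hpI, hpq', w', -, hw'⟩ := hD p q hpq
    have hpJ := hDJ _ _ hpq
    have hqJ := hDJ _ _ hqp
    have hpv : p * v ∉ I := fun hI => hpI (by rw [hLv p hp]; exact h.mul_right _ hI _)
    have hpvJ := h.right_mem hpJ hpv
    refine ⟨⟨q, p, hqp, hq, hp, rfl, rfl⟩, trivial, fun e => h.one_notMem (e ▸ hpvJ), hpv,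
      fun e => hpq' ?_, v' * w', trivial, _, _, hw', ?_, ?_, ?_, ?_⟩
    · rw [hLv p hp, hLv q hq, e]
    · exact (h.greenL hqJ (hDJ _ _ hw')).symm.trans hq
    · exact (h.greenL hpJ (hDJ _ _ (hD _ _ hw').1)).symm.trans hp
    · conv_rhs => rw [hLv p hp]
      simp only [mul_assoc]
    · conv_rhs => rw [hLv q hq]
      simp only [mul_assoc]
  have hex : x * v * x = x := by
    obtain ⟨u, -, e, -⟩ := h.greenR hx heJ
    calc x * v * x = x * v * (x * v * u) := congrArg (x * v * ·) e
      _ = x := by rw [← mul_assoc, hee, ← e]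
  set e := x * v with he
  set f := y * v with hf
  have hef : e * f = f := by
    obtain ⟨-, u, -, e4⟩ := hR
    rw [hf, e4]
    simp only [← mul_assoc, hex]
  have hfe : f * e = f := by
    rw [hf, e2, mul_assoc k' x v, ← he, mul_assoc, hee]
  have hep : ∀ n : ℕ, 0 < n → e * f ^ n = f ^ n ∧ f ^ n * e = f ^ n := by
    intro n hn
    obtain ⟨l, rfl⟩ := Nat.exists_eq_succ_of_ne_zero hn.ne'
    constructor
    · rw [pow_succ', ← mul_assoc, hef]
    · rw [pow_succ, mul_assoc, hfe]
  have hcomm : ∀ n : ℕ, e * f ^ n = f ^ n * e := by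
    intro n
    rcases Nat.eq_zero_or_pos n with rfl | hn
    · simp
    · rw [(hep n hn).1, (hep n hn).2]
  let N : Submonoid M :=
    { carrier := {z | z = e ∨ ∃ n : ℕ, z = f ^ n}
      one_mem' := Or.inr ⟨0, by simp⟩
      mul_mem' := by
        have key : ∀ n : ℕ, e * f ^ n = e ∨ ∃ m : ℕ, e * f ^ n = f ^ m := by
          intro n
          rcases Nat.eq_zero_or_pos n with rfl | hn
          · left; simp
          · exact Or.inr ⟨n, (hep n hn).1⟩
        rintro p q (rfl | ⟨n, rfl⟩) (rfl | ⟨m, rfl⟩)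
        · exact Or.inl hee
        · exact key m
        · change _ ∨ _; rw [← hcomm]; exact key n
        · exact Or.inr ⟨n + m, by rw [pow_add]⟩ }
  have hNc : ∀ p ∈ N, ∀ q ∈ N, p * q = q * p := by
    rintro p (rfl | ⟨n, rfl⟩) q (rfl | ⟨m, rfl⟩)
    · rfl
    · exact hcomm m
    · exact (hcomm n).symm
    · rw [← pow_add, ← pow_add, add_comm]
  obtain ⟨D', ⟨p, q, hpq⟩, hD'⟩ := hP _ hstab e f
    ⟨x, y, hxy, GreenL.refl x, ⟨k', k, e2, e1⟩, rfl, rfl⟩ N (Or.inl rfl)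
    (Or.inr ⟨1, by simp⟩)
  obtain ⟨hqp, hp, -, -, -, w', hw', hn'⟩ := hD' p q hpq
  obtain ⟨-, hq, -⟩ := hD' q p hqp
  refine (hD' _ _ hn').2.2.2.2.1 ?_
  rw [hNc _ (N.mul_mem hp hw') _ hq, hNc _ hp _ hw', mul_assoc]

theorem mul_mem_of_not_greenR (h : ClassOver I J) (hP : PseudoNilpotentOver I)
    {D : M → M → Prop} (hD : MalcevStable I ⊤ D) (hDJ : ∀ x y, D x y → x ∈ J)
    (hDw : ∀ x y, D x y → ∃ w, (w = 1 ∨ w ∈ J) ∧ D (x * w * y) (y * w * x)) {x y : M}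
    (hxy : D x y) (hR : ¬ GreenR x y) {d e : M} (hd : d ∈ J) (he : e ∈ J) : d * e ∈ J := by
  have some_case : ∀ x y, D x y → ¬ GreenR x y → ∀ w ∈ J, D (x * w * y) (y * w * x) →
      d * e ∈ J := by
    intro x y hxy hR w hw hD1
    have hx := hDJ _ _ hxy
    have hy := hDJ _ _ (hD _ _ hxy).1
    have h1 := hDJ _ _ hD1
    have h2 := hDJ _ _ (hD _ _ hD1).1
    have hxw : x * w ∈ J := h.of_right (t := y) hw h1
    have hyw : y * w ∈ J := h.of_right (t := x) hw h2
    have hwy : w * y ∈ J := h.of_left (s := x) hw (by rwa [← mul_assoc])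
    have hwx : w * x ∈ J := h.of_left (s := y) hw (by rwa [← mul_assoc])
    refine h.mul_mem_of_exists hP hxw hyw hw ((h.greenL hw hxw).symm.trans (h.greenL hw hyw))
      (fun k => hR ?_) ?_ ?_ hd he
    · exact ((h.greenR hx hxw).trans k).trans (h.greenR hy hyw).symm
    · rw [← mul_assoc]; exact h.mul_mul_mem hx hwx hxw
    · rw [← mul_assoc]; exact h.mul_mul_mem hy hwy hyw
  obtain ⟨w, hw | hw, hD1⟩ := hDw x y hxy
  swap
  · exact some_case x y hxy hR w hw hD1
  subst hw
  rw [mul_one, mul_one] at hD1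
  have hx := hDJ _ _ hxy
  have hy := hDJ _ _ (hD _ _ hxy).1
  have hxyJ := hDJ _ _ hD1
  have hyxJ := hDJ _ _ (hD _ _ hD1).1
  have hR1 : ¬ GreenR (x * y) (y * x) := fun k =>
    hR (((h.greenR hx hxyJ).trans k).trans (h.greenR hy hyxJ).symm)
  obtain ⟨w, hw | hw, hD2⟩ := hDw _ _ hD1
  swap
  · exact some_case _ _ hD1 hR1 w hw hD2
  subst hw
  rw [mul_one, mul_one] at hD2
  have h3 := hDJ _ _ (hD _ _ hD2).1
  have hxx : x * x ∈ J := by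
    have : x * (x * y) ∈ J := h.of_left (s := y) (t := x * y) hx
      (by simpa only [mul_assoc] using h3)
    exact h.of_right (t := y) hx (by rwa [mul_assoc])
  refine h.mul_mem_of_exists hP hxx hyxJ hx ((h.greenL hx hxx).symm.trans (h.greenL hx hyxJ))
    (fun k => hR ?_) ?_ ?_ hd he
  · exact ((h.greenR hx hxx).trans k).trans (h.greenR hy hyxJ).symm
  · rw [← mul_assoc]; exact h.mul_mul_mem hx hxx hxx
  · rw [← mul_assoc]; exact h.mul_mul_mem hy hxyJ hyxJ

theorem mul_mem_of_stable (h : ClassOver I J) (hP : PseudoNilpotentOver I)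
    {D : M → M → Prop} (hD : MalcevStable I ⊤ D) (hDJ : ∀ x y, D x y → x ∈ J)
    (hDw : ∀ x y, D x y → ∃ w, (w = 1 ∨ w ∈ J) ∧ D (x * w * y) (y * w * x)) {x y : M}
    (hxy : D x y) :
    (∀ d ∈ J, ∀ e ∈ J, d * e ∈ J) ∧ (¬ GreenR x y ∨ ¬ GreenL x y) := by
  by_cases hR : GreenR x y
  · have hL : ¬ GreenL x y := fun hL => h.not_greenH hP hD hDJ hxy hR hL
    refine ⟨fun d hd e he => ?_, Or.inr hL⟩
    refine h.op.mul_mem_of_not_greenR hP.op hD.op (fun a b k => hDJ _ _ k) ?_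
      (x := .op x) (y := .op y) hxy (fun k => hL (greenR_op.1 k)) (d := .op e) (e := .op d) he hd
    intro a b hab
    obtain ⟨w, hw, hD1⟩ := hDw _ _ hab
    refine ⟨.op w, hw.imp (fun k => by simp [k]) id, ?_⟩
    simpa [mul_assoc] using (hD _ _ hD1).1
  · exact ⟨fun d hd e he => h.mul_mem_of_not_greenR hP hD hDJ hDw hxy hR hd he, Or.inl hR⟩

theorem malcevPair (h : ClassOver I J) (hJ : ∀ d ∈ J, ∀ e ∈ J, d * e ∈ J) {s t j : M}
    (hs1 : s ≠ 1) (ht1 : t ≠ 1) (hj : j ∈ J) (hs : s * j ∈ J) (ht : t * j ∈ J)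
    (hs' : j * s ∈ J) (ht' : j * t ∈ J) (hR : ¬ GreenR (s * j) (t * j)) : MalcevPair I s t := by
  refine ⟨fun x y => (x ∈ J ∧ y ∈ J ∧ ¬ GreenR x y) ∨ (x = s ∧ y = t) ∨ (x = t ∧ y = s),
    ?_, Or.inr (Or.inl ⟨rfl, rfl⟩)⟩
  have base : ∀ s t, s * j ∈ J → t * j ∈ J → j * s ∈ J → j * t ∈ J →
      ¬ GreenR (s * j) (t * j) → s * j * t ∈ J ∧ t * j * s ∈ J ∧
        ¬ GreenR (s * j * t) (t * j * s) := by
    intro s t hs ht hs' ht' hR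
    have h1 := h.mul_mul_mem hj hs ht'
    have h2 := h.mul_mul_mem hj ht hs'
    exact ⟨h1, h2, fun k => hR (((h.greenR hs h1).trans k).trans (h.greenR ht h2).symm)⟩
  have hsI : s ∉ I := fun k => h.notMem _ hs (h.mul_right _ k _)
  have htI : t ∉ I := fun k => h.notMem _ ht (h.mul_right _ k _)
  have hst : s ≠ t := fun k => hR (k ▸ GreenR.refl _)
  rintro x y (⟨hx, hy, hxy⟩ | ⟨rfl, rfl⟩ | ⟨rfl, rfl⟩)
  · refine ⟨Or.inl ⟨hy, hx, fun k => hxy k.symm⟩, trivial, fun e => h.one_notMem (e ▸ hx),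
      h.notMem _ hx, fun e => hxy (e ▸ GreenR.refl _), 1, trivial, Or.inl ?_⟩
    rw [mul_one, mul_one]
    refine ⟨hJ _ hx _ hy, hJ _ hy _ hx, fun k => hxy ?_⟩
    exact ((h.greenR hx (hJ _ hx _ hy)).trans k).trans (h.greenR hy (hJ _ hy _ hx)).symm
  · exact ⟨Or.inr (Or.inr ⟨rfl, rfl⟩), trivial, hs1, hsI, hst, j, trivial,
      Or.inl (base _ _ hs ht hs' ht' hR)⟩
  · exact ⟨Or.inr (Or.inl ⟨rfl, rfl⟩), trivial, ht1, htI, hst.symm, j, trivial,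
      Or.inl (base _ _ ht hs ht' hs' fun k => hR k.symm)⟩

/-- The elements different from `1` that multiply `J` into `J`. -/
def stab (J : Set M) : Set M := {s | s ≠ 1 ∧ ∀ a ∈ J, s * a ∈ J ∧ a * s ∈ J}

theorem reach_of_not_greenR (h : ClassOver I J) (hJ : ∀ d ∈ J, ∀ e ∈ J, d * e ∈ J) {x y : M}
    (hx : x ∈ J) (hy : y ∈ J) (hR : ¬ GreenR x y) {s j : M} (hs : s ∈ stab J) (hj : j ∈ J) :
    ∃ t ∈ J, MalcevPair I s t ∧ (t = j ∨ MalcevPair I t j) := by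
  have hsx := (hs.2 x hx).1
  have ne_one : ∀ z ∈ J, z ≠ 1 := fun z hz e => h.one_notMem (e ▸ hz)
  have pair : ∀ t ∈ J, ¬ GreenR (s * x) t → MalcevPair I s t := by
    intro t ht hn
    refine h.malcevPair hJ hs.1 (ne_one t ht) hx hsx (hJ _ ht _ hx) (hs.2 x hx).2 (hJ _ hx _ ht)
      fun k => hn (k.trans (h.greenR ht (hJ _ ht _ hx)).symm)
  by_cases hsj : GreenR (s * x) j
  · obtain ⟨t, ht, hn⟩ : ∃ t ∈ J, ¬ GreenR (s * x) t := by
      by_contra! hc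
      exact hR ((hc x hx).symm.trans (hc y hy))
    refine ⟨t, ht, pair t ht hn, Or.inr ?_⟩
    refine h.malcevPair hJ (ne_one t ht) (ne_one j hj) hj (hJ _ ht _ hj) (hJ _ hj _ hj)
      (hJ _ hj _ ht) (hJ _ hj _ hj) fun k => hn (hsj.trans ?_)
    exact ((h.greenR hj (hJ _ hj _ hj)).trans k.symm).trans (h.greenR ht (hJ _ ht _ hj)).symm
  · exact ⟨j, hj, pair j hj hsj, Or.inl rfl⟩

omit [Finite M] in
theorem _root_.MalcevPair.unop {x y : Mᵐᵒᵖ} (h : MalcevPair (MulOpposite.unop ⁻¹' I) x y) :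
    MalcevPair I (MulOpposite.unop x) (MulOpposite.unop y) := by
  obtain ⟨D, hD, hxy⟩ := h
  exact ⟨_, hD.unop, hxy⟩

theorem reach (h : ClassOver I J) (hJ : ∀ d ∈ J, ∀ e ∈ J, d * e ∈ J) {x y : M}
    (hx : x ∈ J) (hy : y ∈ J) (hxy : ¬ GreenR x y ∨ ¬ GreenL x y) {s j : M} (hs : s ∈ stab J)
    (hj : j ∈ J) : ∃ t ∈ J, MalcevPair I s t ∧ (t = j ∨ MalcevPair I t j) := by
  rcases hxy with hR | hL
  · exact h.reach_of_not_greenR hJ hx hy hR hs hj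
  · obtain ⟨t, ht, h1, h2⟩ := h.op.reach_of_not_greenR (fun d hd e he => hJ _ he _ hd)
      (x := .op x) (y := .op y) hx hy (fun k => hL (greenR_op.1 k)) (s := .op s) (j := .op j)
      ⟨fun e => hs.1 (by simpa using e), fun a ha => (hs.2 _ ha).symm⟩ hj
    exact ⟨_, ht, h1.unop, h2.imp (fun e => by simp [e]) fun k => k.unop⟩

end ClassOver

end FiniteMonoid

section MalcevSequences

theorem malcev_mem {A : Subsemigroup S} {x y : S} {w : ℕ → Option S} (hx : x ∈ A) (hy : y ∈ A)
    (hw : ∀ k c, w k = some c → c ∈ A) (n : ℕ) :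
    (malcev x y w n).1 ∈ A ∧ (malcev x y w n).2 ∈ A := by
  induction n with
  | zero => exact ⟨hx, hy⟩
  | succ n ih =>
    simp only [malcev, mulW]
    cases h : w n with
    | none => exact ⟨A.mul_mem ih.1 ih.2, A.mul_mem ih.2 ih.1⟩
    | some c =>
      have hc := hw n c h
      exact ⟨A.mul_mem (A.mul_mem ih.1 hc) ih.2, A.mul_mem (A.mul_mem ih.2 hc) ih.1⟩

theorem malcev_succ (x y : S) (w : ℕ → Option S) (n : ℕ) :
    malcev x y w (n + 1) =
      malcev (mulW x (w 0) y) (mulW y (w 0) x) (fun k => w (k + 1)) n := by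
  induction n with
  | zero => rfl
  | succ n ih => rw [malcev, ih]; rfl

theorem malcev_swap (x y : S) (w : ℕ → Option S) (n : ℕ) :
    malcev y x w n = (malcev x y w n).swap := by
  induction n with
  | zero => rfl
  | succ n ih => simp only [malcev, ih]; rfl

theorem coe_mulW (a b : S) (w : Option S) :
    ((mulW a w b : S) : WithOne S) = (a : WithOne S) * (show WithOne S from w) * (b : WithOne S) := by
  cases w with
  | none =>
    change ((a * b : S) : WithOne S) = (a : WithOne S) * 1 * b
    rw [mul_one, WithOne.coe_mul]
  | some c =>
    change ((a * c * b : S) : WithOne S) = (a : WithOne S) * (c : WithOne S) * b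
    rw [WithOne.coe_mul, WithOne.coe_mul]

theorem mulW_mem_left {I : Set S} (hI : IsIdealIn Set.univ I) {a : S} (ha : a ∈ I)
    (w : Option S) (b : S) : mulW a w b ∈ I := by
  cases w with
  | none => exact (hI.2 a ha b trivial).2
  | some c => exact (hI.2 _ (hI.2 a ha c trivial).2 b trivial).2

theorem mulW_mem_right {I : Set S} (hI : IsIdealIn Set.univ I) {b : S} (hb : b ∈ I)
    (w : Option S) (a : S) : mulW a w b ∈ I := by
  cases w with
  | none => exact (hI.2 b hb a trivial).1
  | some c => exact (hI.2 b hb (a * c) trivial).1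

theorem exists_forall_of_antitone {α : Type*} [Finite α] {P : α → ℕ → Prop}
    (hP : ∀ a n, P a (n + 1) → P a n) (h : ∀ n, ∃ a, P a n) : ∃ a, ∀ n, P a n := by
  by_contra! hc
  choose f hf using hc
  have hle : ∀ a n k, P a (n + k) → P a n := by
    intro a n k
    induction k with
    | zero => exact id
    | succ k ih => exact fun hk => ih (hP _ _ hk)
  have := Fintype.ofFinite α
  obtain ⟨a, ha⟩ := h (∑ a, f a)
  obtain ⟨k, hk⟩ := Nat.exists_eq_add_of_le
    (Finset.single_le_sum (fun i _ => Nat.zero_le (f i)) (Finset.mem_univ a))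
  exact hf a (hle a _ k (hk ▸ ha))

/-- A Mal'cev non-nilpotent subsemigroup of a finite semigroup contains pairs starting endless
Mal'cev sequences. -/
theorem exists_stable_of_not_setMNMod [Finite S] {I : Set S} (hI : IsIdealIn Set.univ I)
    {A : Subsemigroup S} (hA : ¬ SetMNMod I (A : Set S)) :
    ∃ D : S → S → Prop, (∃ x y, D x y) ∧ ∀ x y, D x y → D y x ∧ x ∈ A ∧ x ∉ I ∧ x ≠ y ∧
      ∃ w : Option S, (∀ c, w = some c → c ∈ A) ∧ D (mulW x w y) (mulW y w x) := by
  let B : S × S → ℕ → Prop := fun p n => p.1 ∈ A ∧ p.2 ∈ A ∧ ∃ w : ℕ → Option S,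
    (∀ k c, w k = some c → c ∈ A) ∧ ¬ ReesEq I (malcev p.1 p.2 w n).1 (malcev p.1 p.2 w n).2
  have hB : ∀ p n, B p (n + 1) → B p n := by
    rintro p n ⟨h1, h2, w, hw, hn⟩
    refine ⟨h1, h2, w, hw, fun hr => hn ?_⟩
    simp only [malcev]
    rcases hr with hr | ⟨hr, -⟩
    · left; rw [hr]
    · exact Or.inr ⟨mulW_mem_left hI hr _ _, mulW_mem_right hI hr _ _⟩
  have hne : ∃ p, ∀ n, B p n := by
    refine exists_forall_of_antitone hB fun n => ?_
    by_contra! hc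
    refine hA ⟨n + 1, Nat.succ_pos n, fun x hx y hy w hw => ?_⟩
    by_contra hr
    exact hc (x, y) (hB _ _ ⟨hx, hy, w, hw, hr⟩)
  obtain ⟨p, hp⟩ := hne
  refine ⟨fun x y => ∀ n, B (x, y) n, ⟨p.1, p.2, hp⟩, fun x y hxy => ?_⟩
  have hsymm : ∀ n, B (y, x) n := by
    intro n
    obtain ⟨h1, h2, w, hw, hn⟩ := hxy n
    refine ⟨h2, h1, w, hw, fun hr => hn ?_⟩
    simp only [malcev_swap x y, Prod.fst_swap, Prod.snd_swap] at hr
    exact hr.imp Eq.symm And.symm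
  have hx := (hxy 0).1
  have hy := (hxy 0).2.1
  refine ⟨hsymm, hx, ?_, ?_, ?_⟩
  · intro hxI
    obtain ⟨-, -, w, hw, hn⟩ := hxy 1
    exact hn (Or.inr ⟨mulW_mem_left hI hxI _ _, mulW_mem_right hI hxI _ _⟩)
  · rintro rfl
    obtain ⟨-, -, w, hw, hn⟩ := hxy 0
    exact hn (Or.inl rfl)
  · have := exists_forall_of_antitone
      (P := fun (w : Option S) n => (∀ c, w = some c → c ∈ A) ∧ B (mulW x w y, mulW y w x) n)
      (fun w n k => ⟨k.1, hB _ _ k.2⟩) (fun n => by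
        obtain ⟨-, -, w, hw, hn⟩ := hxy (n + 1)
        have := malcev_mem hx hy hw 1
        refine ⟨w 0, hw 0, this.1, this.2, fun k => w (k + 1), fun k => hw (k + 1), ?_⟩
        rwa [malcev_succ] at hn)
    obtain ⟨w, hw⟩ := this
    exact ⟨w, (hw 0).1, fun n => (hw n).2⟩

theorem not_setMNMod_of_stable [Finite S] (hPN : IsPN S) {I : Set S}
    (hI : IsIdealIn Set.univ I) {x y : S}
    (hxy : MalcevPair ((↑) '' I : Set (WithOne S)) (x : WithOne S) (y : WithOne S)) :
    ¬ SetMNMod I (Subsemigroup.closure ({x, y} : Set S) : Set S) := by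
  obtain ⟨D, hD, hxy⟩ := hxy
  have hnext : ∀ p : {p : WithOne S × WithOne S // D p.1 p.2}, ∃ w : WithOne S,
      D (p.1.1 * w * p.1.2) (p.1.2 * w * p.1.1) := fun p => by
    obtain ⟨-, -, -, -, -, w, -, hw⟩ := hD _ _ p.2
    exact ⟨w, hw⟩
  choose f hf using hnext
  let q : ℕ → {p : WithOne S × WithOne S // D p.1 p.2} := fun n =>
    Nat.rec ⟨(x, y), hxy⟩ (fun _ p => ⟨(p.1.1 * f p * p.1.2, p.1.2 * f p * p.1.1), hf p⟩) n
  let w : ℕ → Option S := fun n => f (q n)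
  have hq : ∀ n, (((malcev x y w n).1 : WithOne S), ((malcev x y w n).2 : WithOne S)) =
      (q n).1 := by
    intro n
    induction n with
    | zero => rfl
    | succ n ih =>
      simp only [malcev, coe_mulW]
      change _ = ((q n).1.1 * f (q n) * (q n).1.2, (q n).1.2 * f (q n) * (q n).1.1)
      rw [← ih]
  have hDn : ∀ n, D (malcev x y w n).1 (malcev x y w n).2 := fun n => by
    have := (q n).2
    rwa [← hq n] at this
  have hne : ∀ n, (malcev x y w n).1 ≠ (malcev x y w n).2 := fun n e =>
    (hD _ _ (hDn n)).2.2.2.2.1 (by rw [e])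
  have h1 : ∀ n, (malcev x y w n).1 ∉ I := fun n hn =>
    (hD _ _ (hDn n)).2.2.2.1 ⟨_, hn, rfl⟩
  have h2 : ∀ n, (malcev x y w n).2 ∉ I := fun n hn =>
    (hD _ _ (hD _ _ (hDn n)).1).2.2.2.1 ⟨_, hn, rfl⟩
  obtain ⟨i, j, hij, e⟩ := Finite.exists_ne_map_eq_of_infinite (malcev x y w)
  wlog hlt : i < j generalizing i j
  · exact this j i hij.symm e.symm (by omega)
  set T := Subsemigroup.closure (genSet x y w j) with hT
  have hxT : x ∈ T := Subsemigroup.subset_closure (Or.inl (Or.inl rfl))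
  have hyT : y ∈ T := Subsemigroup.subset_closure (Or.inl (Or.inr rfl))
  have hsub : Subsemigroup.closure ({x, y} : Set S) ≤ T := by
    rw [Subsemigroup.closure_le]
    rintro z (rfl | rfl)
    exacts [hxT, hyT]
  have := hPN x y w j (I ∩ T) ⟨Set.inter_subset_right, fun a ha t ht =>
      ⟨⟨(hI.2 a ha.1 t trivial).1, T.mul_mem ht ha.2⟩,
        ⟨(hI.2 a ha.1 t trivial).2, T.mul_mem ha.2 ht⟩⟩⟩
    (fun k => h1 j k.1) (fun k => h2 j k.1) ⟨i, hlt, hne i, e⟩ 0 (Nat.zero_le _)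
  refine fun ⟨n, hn, hmn⟩ => this ⟨n, hn, fun a ha b hb v hv => ?_⟩
  have hm := malcev_mem ha hb hv n
  exact (hmn a ha b hb v hv).imp id fun k => ⟨⟨k.1, hsub hm.1⟩, ⟨k.2, hsub hm.2⟩⟩

/-- The relation on `WithOne S` induced by a relation on `S`. -/
def liftRel (D : S → S → Prop) (x y : WithOne S) : Prop :=
  ∃ a b : S, x = a ∧ y = b ∧ D a b

theorem malcevStable_liftRel {I : Set S} {D : S → S → Prop} {N : Submonoid (WithOne S)}
    (hD : ∀ x y, D x y → D y x ∧ (x : WithOne S) ∈ N ∧ x ∉ I ∧ x ≠ y ∧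
      ∃ w : Option S, (∀ c, w = some c → (c : WithOne S) ∈ N) ∧ D (mulW x w y) (mulW y w x)) :
    MalcevStable ((↑) '' I : Set (WithOne S)) N (liftRel D) := by
  rintro _ _ ⟨a, b, rfl, rfl, hab⟩
  obtain ⟨h1, h2, h3, h4, w, hw, h5⟩ := hD a b hab
  refine ⟨⟨b, a, rfl, rfl, h1⟩, h2, WithOne.coe_ne_one, ?_, fun e => h4 (WithOne.coe_inj.1 e),
    w, ?_, _, _, (coe_mulW a b w).symm, (coe_mulW b a w).symm, h5⟩
  · rintro ⟨c, hc, e⟩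
    exact h3 (WithOne.coe_inj.1 e ▸ hc)
  · cases w with
    | none => exact N.one_mem
    | some c => exact hw c rfl

theorem pseudoNilpotentOver [Finite S] (hPN : IsPN S) {I : Set S} (hI : IsIdealIn Set.univ I) :
    PseudoNilpotentOver ((↑) '' I : Set (WithOne S)) := by
  intro D hD x y hxy N hx hy
  obtain ⟨hyx, -, hx1, -⟩ := hD x y hxy
  obtain ⟨-, -, hy1, -⟩ := hD y x hyx
  obtain ⟨a, rfl⟩ := WithOne.ne_one_iff_exists.1 hx1
  obtain ⟨b, rfl⟩ := WithOne.ne_one_iff_exists.1 hy1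
  obtain ⟨D', ⟨p, q, hpq⟩, hD'⟩ :=
    exists_stable_of_not_setMNMod hI (not_setMNMod_of_stable hPN hI ⟨D, hD, hxy⟩)
  refine ⟨liftRel D', ⟨p, q, p, q, rfl, rfl, hpq⟩, malcevStable_liftRel fun u v huv => ?_⟩
  have hN : ∀ z ∈ Subsemigroup.closure ({a, b} : Set S), (z : WithOne S) ∈ N := by
    intro z hz
    induction hz using Subsemigroup.closure_induction with
    | mem z hz =>
      rcases hz with rfl | rfl
      exacts [hx, hy]
    | mul s t _ _ hs ht => rw [WithOne.coe_mul]; exact N.mul_mem hs ht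
  obtain ⟨h1, h2, h3, h4, w, hw, h5⟩ := hD' u v huv
  exact ⟨h1, hN u h2, h3, h4, w, fun c hc => hN c (hw c hc), h5⟩

theorem setMNMod_of_setMN {A : Set S} (h : SetMN A) (I : Set S) : SetMNMod I A := by
  obtain ⟨n, hn, h⟩ := h
  exact ⟨n, hn, fun x hx y hy w hw => Or.inl (h x hx y hy w hw)⟩

theorem nEdge_of_malcevPair [Finite S] (hPN : IsPN S) {I : Set S}
    (hI : IsIdealIn Set.univ I) {x y : S}
    (h : MalcevPair ((↑) '' I : Set (WithOne S)) (x : WithOne S) (y : WithOne S)) : NEdge x y := by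
  refine ⟨?_, fun k => not_setMNMod_of_stable hPN hI h (setMNMod_of_setMN k I)⟩
  obtain ⟨D, hD, hxy⟩ := h
  exact fun e => (hD _ _ hxy).2.2.2.2.1 (by rw [e])

theorem NEdge.symm {a b : S} (h : NEdge a b) : NEdge b a := by
  refine ⟨h.1.symm, ?_⟩
  rw [Set.pair_comm]
  exact h.2

theorem NReach.symm {a b : S} (h : NReach a b) : NReach b a :=
  have : Std.Symm (fun x y : S => NEdge x y) := ⟨fun _ _ => NEdge.symm⟩
  Relation.ReflTransGen.stdSymm.symm _ _ h

theorem exists_nEdge_of_nReach {a b c : S} (h : NReach a c) (hab : NEdge a b) :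
    ∃ d, NEdge c d := by
  cases h with
  | refl => exact ⟨b, hab⟩
  | tail _ h => exact ⟨_, h.symm⟩

end MalcevSequences

theorem finite_withOne (α : Type*) [Finite α] : Finite (WithOne α) :=
  inferInstanceAs (Finite (Option α))

namespace PrincipalSeries

theorem isIdealIn (ps : PrincipalSeries S) {i : ℕ} (h1 : 1 ≤ i) (h2 : i ≤ ps.m + 1) :
    IsIdealIn Set.univ (ps.C i) := by
  rcases Nat.lt_or_ge ps.m i with h | h
  · obtain rfl : i = ps.m + 1 := by omega
    rw [ps.last]
    exact ⟨Set.empty_subset _, fun a ha => absurd ha (Set.notMem_empty a)⟩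
  · exact ps.ideal i h1 h

theorem mul_left_mem (ps : PrincipalSeries S) {i : ℕ} (h1 : 1 ≤ i) (h2 : i ≤ ps.m + 1) {a : S}
    (ha : a ∈ ps.C i) (t : S) : t * a ∈ ps.C i :=
  ((ps.isIdealIn h1 h2).2 a ha t trivial).1

theorem mul_right_mem (ps : PrincipalSeries S) {i : ℕ} (h1 : 1 ≤ i) (h2 : i ≤ ps.m + 1) {a : S}
    (ha : a ∈ ps.C i) (t : S) : a * t ∈ ps.C i :=
  ((ps.isIdealIn h1 h2).2 a ha t trivial).2

theorem antitone (ps : PrincipalSeries S) {i j : ℕ} (h1 : 1 ≤ i) (hij : i ≤ j)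
    (h2 : j ≤ ps.m + 1) : ps.C j ⊆ ps.C i := by
  induction j, hij using Nat.le_induction with
  | base => exact subset_rfl
  | succ j hj ih => exact (ps.ssub j (by omega) (by omega)).subset.trans (ih (by omega))

theorem exists_index (ps : PrincipalSeries S) (s : S) :
    ∃ i, 1 ≤ i ∧ i ≤ ps.m ∧ s ∈ ps.C i \ ps.C (i + 1) := by
  by_contra! hc
  have : ∀ k, k ≤ ps.m → s ∈ ps.C (k + 1) := by
    intro k
    induction k with
    | zero => intro _; rw [ps.first]; trivial
    | succ k ih =>
      intro hk
      by_contra hn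
      exact hc (k + 1) (by omega) hk ⟨ih (by omega), hn⟩
  have := this ps.m le_rfl
  rw [ps.last] at this
  exact this

theorem le_index (ps : PrincipalSeries S) {s : S} {i j : ℕ} (hi : i ≤ ps.m + 1)
    (hs : s ∈ ps.C i) (hsj : s ∉ ps.C (j + 1)) : i ≤ j := by
  by_contra! h
  exact hsj (ps.antitone (by omega) h hi hs)

theorem exists_coe_eq (ps : PrincipalSeries S) {i : ℕ} (h1 : 1 ≤ i) (h2 : i ≤ ps.m) {a b : S}
    (ha : a ∈ ps.C i \ ps.C (i + 1)) (hb : b ∈ ps.C i) (hb' : b ∉ ps.C (i + 1)) :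
    ∃ s t : WithOne S, (b : WithOne S) = s * a * t := by
  have hI := ps.maximal i h1 h2
    (ps.C (i + 1) ∪ {z | ∃ s t : WithOne S, (z : WithOne S) = s * a * t}) ?_
    Set.subset_union_left ?_
  · rcases hI with h | h
    · exact absurd (h ▸ Or.inr ⟨1, 1, by simp⟩ : a ∈ ps.C (i + 1)) ha.2
    · rw [← h] at hb
      exact hb.resolve_left hb'
  · refine ⟨Set.subset_univ _, ?_⟩
    rintro z (hz | ⟨s, t, hz⟩) u -
    · exact ⟨Or.inl (ps.mul_left_mem (by omega) (by omega) hz u),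
        Or.inl (ps.mul_right_mem (by omega) (by omega) hz u)⟩
    · refine ⟨Or.inr ⟨u * s, t, ?_⟩, Or.inr ⟨s, t * u, ?_⟩⟩ <;>
        simp only [WithOne.coe_mul, hz, mul_assoc]
  · rintro z (hz | ⟨s, t, hz⟩)
    · exact (ps.ssub i h1 h2).subset hz
    · have hl := fun u => ps.mul_left_mem h1 (by omega) ha.1 u
      cases s <;> cases t
      · simp only [one_mul, mul_one, WithOne.coe_inj] at hz
        exact hz ▸ ha.1
      · simp only [one_mul, ← WithOne.coe_mul, WithOne.coe_inj] at hz
        exact hz ▸ ps.mul_right_mem h1 (by omega) ha.1 _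
      · simp only [mul_one, ← WithOne.coe_mul, WithOne.coe_inj] at hz
        exact hz ▸ hl _
      · simp only [← WithOne.coe_mul, WithOne.coe_inj] at hz
        exact hz ▸ ps.mul_right_mem h1 (by omega) (hl _) _

theorem classOver (ps : PrincipalSeries S) {i : ℕ} (h1 : 1 ≤ i) (h2 : i ≤ ps.m) :
    ClassOver ((↑) '' ps.C (i + 1) : Set (WithOne S)) ((↑) '' (ps.C i \ ps.C (i + 1))) where
  mul_left := by
    rintro _ ⟨a, ha, rfl⟩ t
    cases t with
    | one => exact ⟨a, ha, by simp⟩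
    | coe t => exact ⟨t * a, ps.mul_left_mem (by omega) (by omega) ha t, WithOne.coe_mul _ _⟩
  mul_right := by
    rintro _ ⟨a, ha, rfl⟩ t
    cases t with
    | one => exact ⟨a, ha, by simp⟩
    | coe t => exact ⟨a * t, ps.mul_right_mem (by omega) (by omega) ha t, WithOne.coe_mul _ _⟩
  left_or := by
    rintro _ ⟨a, ha, rfl⟩ t
    cases t with
    | one => exact Or.inl ⟨a, ha, by simp⟩
    | coe t =>
      have := ps.mul_left_mem h1 (by omega) ha.1 t
      by_cases h : t * a ∈ ps.C (i + 1)
      · exact Or.inr ⟨_, h, WithOne.coe_mul _ _⟩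
      · exact Or.inl ⟨_, ⟨this, h⟩, WithOne.coe_mul _ _⟩
  right_or := by
    rintro _ ⟨a, ha, rfl⟩ t
    cases t with
    | one => exact Or.inl ⟨a, ha, by simp⟩
    | coe t =>
      have := ps.mul_right_mem h1 (by omega) ha.1 t
      by_cases h : a * t ∈ ps.C (i + 1)
      · exact Or.inr ⟨_, h, WithOne.coe_mul _ _⟩
      · exact Or.inl ⟨_, ⟨this, h⟩, WithOne.coe_mul _ _⟩
  notMem := by
    rintro _ ⟨a, ha, rfl⟩ ⟨b, hb, e⟩
    exact ha.2 (WithOne.coe_inj.1 e ▸ hb)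
  one_notMem := by
    rintro ⟨a, -, e⟩
    exact WithOne.coe_ne_one e
  exists_eq := by
    rintro _ ⟨a, ha, rfl⟩ _ ⟨b, hb, rfl⟩
    exact ps.exists_coe_eq h1 h2 ha hb.1 hb.2

end PrincipalSeries

section Stems

variable {ps : PrincipalSeries S} {i : ℕ}

/-- A principal factor that is not Mal'cev nilpotent. -/
def NonNilpotentFactor (ps : PrincipalSeries S) (i : ℕ) : Prop :=
  1 ≤ i ∧ i ≤ ps.m ∧ ¬ SetMNMod (ps.C (i + 1)) (ps.C i)

theorem mem_stem_of_mul (h1 : 1 ≤ i) (h2 : i ≤ ps.m) {a s : S} (ha : a ∈ ps.C i)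
    (h : s * a ∉ ps.C (i + 1) ∨ a * s ∉ ps.C (i + 1)) : s ∈ Stem ps i := by
  by_cases hs : s ∈ ps.C i
  · refine Or.inr ⟨hs, fun hs' => ?_⟩
    rcases h with h | h
    · exact h (ps.mul_right_mem (by omega) (by omega) hs' a)
    · exact h (ps.mul_left_mem (by omega) (by omega) hs' a)
  · exact Or.inl ⟨hs, a, ha, h⟩

theorem NonNilpotentFactor.mul_mem_and_exists [Finite S] (hPN : IsPN S)
    (h : NonNilpotentFactor ps i) :
    (∀ d ∈ ((↑) '' (ps.C i \ ps.C (i + 1)) : Set (WithOne S)),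
      ∀ e ∈ ((↑) '' (ps.C i \ ps.C (i + 1)) : Set (WithOne S)),
        d * e ∈ ((↑) '' (ps.C i \ ps.C (i + 1)) : Set (WithOne S))) ∧
    ∃ x ∈ ((↑) '' (ps.C i \ ps.C (i + 1)) : Set (WithOne S)),
      ∃ y ∈ ((↑) '' (ps.C i \ ps.C (i + 1)) : Set (WithOne S)),
        ¬ GreenR x y ∨ ¬ GreenL x y := by
  obtain ⟨h1, h2, h3⟩ := h
  have hI := ps.isIdealIn (i := i + 1) (by omega) (by omega)
  have := finite_withOne S
  let A : Subsemigroup S :=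
    { carrier := ps.C i
      mul_mem' := fun ha _ => ps.mul_right_mem h1 (by omega) ha _ }
  obtain ⟨D, ⟨x, y, hxy⟩, hD⟩ := exists_stable_of_not_setMNMod hI (A := A) h3
  have hst : MalcevStable ((↑) '' ps.C (i + 1) : Set (WithOne S)) ⊤ (liftRel D) :=
    malcevStable_liftRel fun x y hxy => by
      obtain ⟨k1, k2, k3, k4, w, hw, k5⟩ := hD x y hxy
      exact ⟨k1, trivial, k3, k4, w, fun _ _ => trivial, k5⟩
  have hJ : ∀ x y, liftRel D x y → x ∈ ((↑) '' (ps.C i \ ps.C (i + 1)) : Set (WithOne S)) := by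
    rintro _ _ ⟨a, b, rfl, rfl, hab⟩
    exact ⟨a, ⟨(hD a b hab).2.1, (hD a b hab).2.2.1⟩, rfl⟩
  have := (ps.classOver h1 h2).mul_mem_of_stable (pseudoNilpotentOver hPN hI) hst hJ ?_
    (x := x) (y := y) ⟨x, y, rfl, rfl, hxy⟩
  · exact ⟨this.1, x, hJ _ _ ⟨x, y, rfl, rfl, hxy⟩, y,
      hJ _ _ ⟨y, x, rfl, rfl, (hD _ _ hxy).1⟩, this.2⟩
  · rintro _ _ ⟨a, b, rfl, rfl, hab⟩
    obtain ⟨-, -, -, -, w, hw, k⟩ := hD a b hab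
    refine ⟨w, ?_, _, _, (coe_mulW a b w).symm, (coe_mulW b a w).symm, k⟩
    cases w with
    | none => exact Or.inl rfl
    | some c =>
      refine Or.inr ⟨c, ⟨hw c rfl, fun hc => (hD _ _ k).2.2.1 ?_⟩, rfl⟩
      exact (hI.2 _ (hI.2 c hc a trivial).1 b trivial).2

theorem NonNilpotentFactor.mul_mem [Finite S] (hPN : IsPN S) (h : NonNilpotentFactor ps i)
    {d e : S} (hd : d ∈ ps.C i \ ps.C (i + 1)) (he : e ∈ ps.C i \ ps.C (i + 1)) :
    d * e ∈ ps.C i \ ps.C (i + 1) := by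
  obtain ⟨z, hz, e⟩ := (h.mul_mem_and_exists hPN).1 d ⟨d, hd, rfl⟩ e ⟨e, he, rfl⟩
  rw [← WithOne.coe_mul] at e
  exact WithOne.coe_inj.1 e ▸ hz

theorem NonNilpotentFactor.mul_notMem [Finite S] (hPN : IsPN S) (h : NonNilpotentFactor ps i)
    {s c : S} (hs : s ∈ Stem ps i) (hc : c ∈ ps.C i \ ps.C (i + 1)) :
    s * c ∉ ps.C (i + 1) ∧ c * s ∉ ps.C (i + 1) := by
  have hl := fun {a : S} (ha : a ∈ ps.C (i + 1)) t =>
    ps.mul_left_mem (by omega) (Nat.succ_le_succ h.2.1) ha t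
  have hr := fun {a : S} (ha : a ∈ ps.C (i + 1)) t =>
    ps.mul_right_mem (by omega) (Nat.succ_le_succ h.2.1) ha t
  have hCl := fun {a : S} (ha : a ∈ ps.C i) t =>
    ps.mul_left_mem h.1 (h.2.1.trans (Nat.le_succ _)) ha t
  have hCr := fun {a : S} (ha : a ∈ ps.C i) t =>
    ps.mul_right_mem h.1 (h.2.1.trans (Nat.le_succ _)) ha t
  have left_of_right : ∀ a ∈ ps.C i \ ps.C (i + 1), ∀ b ∈ ps.C i \ ps.C (i + 1),
      s * a ∉ ps.C (i + 1) → b * s ∉ ps.C (i + 1) := by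
    intro a ha b hb hsa k
    have := (h.mul_mem hPN hb ⟨hCl ha.1 s, hsa⟩).2
    rw [← mul_assoc] at this
    exact this (hr k a)
  have right_of_left : ∀ a ∈ ps.C i \ ps.C (i + 1), ∀ b ∈ ps.C i \ ps.C (i + 1),
      a * s ∉ ps.C (i + 1) → s * b ∉ ps.C (i + 1) := by
    intro a ha b hb hsa k
    have := (h.mul_mem hPN ⟨hCr ha.1 s, hsa⟩ hb).2
    rw [mul_assoc] at this
    exact this (hl k a)
  rcases hs with ⟨-, a, ha, hsa | hsa⟩ | hs
  · have ha' : a ∈ ps.C i \ ps.C (i + 1) := ⟨ha, fun k => hsa (hl k s)⟩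
    have := left_of_right a ha' c hc hsa
    exact ⟨right_of_left c hc c hc this, this⟩
  · have ha' : a ∈ ps.C i \ ps.C (i + 1) := ⟨ha, fun k => hsa (hr k s)⟩
    have := right_of_left a ha' c hc hsa
    exact ⟨this, left_of_right c hc c hc this⟩
  · exact ⟨(h.mul_mem hPN hs hc).2, (h.mul_mem hPN hc hs).2⟩

theorem NonNilpotentFactor.of_mul_mem_stem [Finite S] (hPN : IsPN S)
    (h : NonNilpotentFactor ps i) {s t : S} (hst : s * t ∈ Stem ps i) :
    s ∈ Stem ps i ∧ t ∈ Stem ps i := by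
  have h' := h
  obtain ⟨h1, h2, -⟩ := h'
  obtain ⟨a, ha, ha'⟩ := Set.exists_of_ssubset (ps.ssub i h1 h2)
  obtain ⟨k1, k2⟩ := h.mul_notMem hPN hst ⟨ha, ha'⟩
  constructor
  · refine mem_stem_of_mul h1 h2 ha (Or.inr fun k => k2 ?_)
    rw [← mul_assoc]
    exact ps.mul_right_mem (by omega) (by omega) k t
  · refine mem_stem_of_mul h1 h2 ha (Or.inl fun k => k1 ?_)
    rw [mul_assoc]
    exact ps.mul_left_mem (by omega) (by omega) k s

theorem NonNilpotentFactor.mem_stem_of_mem [Finite S] (hPN : IsPN S)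
    (h : NonNilpotentFactor ps i) {j : ℕ} (h1 : 1 ≤ j) (h2 : j ≤ ps.m) {s s' : S}
    (hs : s ∈ ps.C j \ ps.C (j + 1)) (hs' : s' ∈ ps.C j \ ps.C (j + 1)) (hst : s ∈ Stem ps i) :
    s' ∈ Stem ps i := by
  obtain ⟨p, q, e⟩ := ps.exists_coe_eq h1 h2 hs' hs.1 hs.2
  cases p <;> cases q <;>
    simp only [one_mul, mul_one, ← WithOne.coe_mul, WithOne.coe_inj] at e <;> subst e
  · exact hst
  · exact (h.of_mul_mem_stem hPN hst).1
  · exact (h.of_mul_mem_stem hPN hst).2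
  · exact (h.of_mul_mem_stem hPN (h.of_mul_mem_stem hPN hst).1).2

theorem NonNilpotentFactor.nReach [Finite S] (hPN : IsPN S) (h : NonNilpotentFactor ps i)
    {s t : S} (hs : s ∈ Stem ps i) (ht : t ∈ Stem ps i) : NReach s t ∧ ∃ u, NEdge s u := by
  have := finite_withOne S
  obtain ⟨hJ, x, hx, y, hy, hxy⟩ := h.mul_mem_and_exists hPN
  have h' := h
  obtain ⟨h1, h2, -⟩ := h'
  have hI := ps.isIdealIn (i := i + 1) (by omega) (by omega)
  obtain ⟨j, hj, hj'⟩ := Set.exists_of_ssubset (ps.ssub i h1 h2)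
  have main : ∀ s ∈ Stem ps i, NReach s j ∧ ∃ u, NEdge s u := by
    intro s hs
    have hs' : ∀ c ∈ ((↑) '' (ps.C i \ ps.C (i + 1)) : Set (WithOne S)),
        (s : WithOne S) * c ∈ ((↑) '' (ps.C i \ ps.C (i + 1)) : Set (WithOne S)) ∧
        c * (s : WithOne S) ∈ ((↑) '' (ps.C i \ ps.C (i + 1)) : Set (WithOne S)) := by
      rintro _ ⟨c, hc, rfl⟩
      obtain ⟨l1, l2⟩ := h.mul_notMem hPN hs hc
      exact ⟨⟨_, ⟨ps.mul_left_mem h1 (by omega) hc.1 s, l1⟩, WithOne.coe_mul _ _⟩,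
        ⟨_, ⟨ps.mul_right_mem h1 (by omega) hc.1 s, l2⟩, WithOne.coe_mul _ _⟩⟩
    obtain ⟨_, ⟨u, -, rfl⟩, k1, k2⟩ := (ps.classOver h1 h2).reach hJ hx hy hxy (s := (s : WithOne S))
      (j := (j : WithOne S)) ⟨WithOne.coe_ne_one, hs'⟩ ⟨j, ⟨hj, hj'⟩, rfl⟩
    have e1 := nEdge_of_malcevPair hPN hI k1
    refine ⟨?_, u, e1⟩
    rcases k2 with k2 | k2
    · rw [← WithOne.coe_inj.1 k2]
      exact Relation.ReflTransGen.single e1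
    · exact (Relation.ReflTransGen.single e1).tail (nEdge_of_malcevPair hPN hI k2)
  exact ⟨(main s hs).1.trans (main t ht).1.symm, (main s hs).2⟩

theorem exists_stem_of_nEdge [Finite S] (hPN : IsPN S) (ps : PrincipalSeries S) {a b : S}
    (hab : NEdge a b) :
    ∃ i, NonNilpotentFactor ps i ∧ a ∈ Stem ps i ∧ b ∈ Stem ps i := by
  have hne : ¬ SetMNMod ∅ (Subsemigroup.closure ({a, b} : Set S) : Set S) := by
    rintro ⟨n, hn, k⟩
    refine hab.2 ⟨n, hn, fun x hx y hy w hw => ?_⟩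
    exact (k x hx y hy w hw).resolve_right fun l => l.1
  obtain ⟨D, ⟨x₀, y₀, hxy₀⟩, hD⟩ := exists_stable_of_not_setMNMod
    (I := ∅) ⟨Set.empty_subset _, fun a ha => absurd ha (Set.notMem_empty a)⟩ hne
  classical
  let P : ℕ → Prop := fun i => 1 ≤ i ∧ ∃ x y, D x y ∧ x ∈ ps.C i \ ps.C (i + 1)
  obtain ⟨i₀, hi₀, hi₀', hx₀⟩ := ps.exists_index x₀
  have hP₀ : P i₀ := ⟨hi₀, x₀, y₀, hxy₀, hx₀⟩
  set i := Nat.findGreatest P ps.m with hi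
  obtain ⟨h1, x, y, hxy, hx⟩ : P i := Nat.findGreatest_spec hi₀' hP₀
  have h2 : i ≤ ps.m := Nat.findGreatest_le _
  have hmax : ∀ x y, D x y → x ∉ ps.C (i + 1) := by
    intro x y hxy hx
    obtain ⟨j, hj, hj', hxj⟩ := ps.exists_index x
    have h3 : j ≤ i := Nat.le_findGreatest hj' ⟨hj, x, y, hxy, hxj⟩
    have := ps.le_index (by omega) hx hxj.2
    omega
  have hCi := ps.isIdealIn h1 (by omega)
  have hI := ps.isIdealIn (i := i + 1) (by omega) (by omega)
  obtain ⟨x, y, hxy, hx, hy⟩ : ∃ x y, D x y ∧ x ∈ ps.C i ∧ y ∈ ps.C i := by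
    obtain ⟨-, -, -, -, w, -, hw⟩ := hD x y hxy
    exact ⟨_, _, hw, mulW_mem_left hCi hx.1 _ _, mulW_mem_right hCi hx.1 _ _⟩
  have hpair : MalcevPair ((↑) '' ps.C (i + 1) : Set (WithOne S)) (x : WithOne S)
      (y : WithOne S) := by
    refine ⟨liftRel D, malcevStable_liftRel fun u v huv => ?_, x, y, rfl, rfl, hxy⟩
    obtain ⟨k1, -, -, k4, w, -, k5⟩ := hD u v huv
    exact ⟨k1, trivial, hmax u v huv, k4, w, fun _ _ => trivial, k5⟩
  have hN : NonNilpotentFactor ps i := by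
    refine ⟨h1, h2, fun ⟨n, hn, k⟩ => not_setMNMod_of_stable hPN hI hpair
      ⟨n, hn, fun u hu v hv w hw => ?_⟩⟩
    let A : Subsemigroup S :=
      { carrier := ps.C i
        mul_mem' := fun ha _ => ps.mul_right_mem h1 (by omega) ha _ }
    have hsub : Subsemigroup.closure ({x, y} : Set S) ≤ A := by
      rw [Subsemigroup.closure_le]
      rintro z (rfl | rfl)
      exacts [hx, hy]
    exact k u (hsub hu) v (hsub hv) w fun l c hc => hsub (hw l c hc)
  have key : ∀ a b : S, (∀ x y, D x y → x ∈ Subsemigroup.closure ({a, b} : Set S) ∧ ∃ w : Option S,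
        (∀ c, w = some c → c ∈ Subsemigroup.closure ({a, b} : Set S)) ∧
        D (mulW x w y) (mulW y w x)) → b ∈ Stem ps i := by
    intro a b hcl
    by_contra hb
    have hdich : ∀ z ∈ Subsemigroup.closure ({a, b} : Set S), z ∈ Stem ps i →
        z ∈ Subsemigroup.closure ({a} : Set S) := by
      intro z hz
      induction hz using Subsemigroup.closure_induction with
      | mem z hz =>
        rcases hz with rfl | rfl
        · exact fun _ => Subsemigroup.subset_closure rfl
        · exact fun k => absurd k hb
      | mul s t _ _ hs ht =>
        intro k
        obtain ⟨k1, k2⟩ := hN.of_mul_mem_stem hPN k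
        exact Subsemigroup.mul_mem _ (hs k1) (ht k2)
    have hcomm : ∀ u ∈ Subsemigroup.closure ({a} : Set S),
        ∀ v ∈ Subsemigroup.closure ({a} : Set S), u * v = v * u := by
      have : ∀ u ∈ Subsemigroup.closure ({a} : Set S), Commute a u := by
        intro u hu
        induction hu using Subsemigroup.closure_induction with
        | mem z hz => rw [Set.mem_singleton_iff.1 hz]
        | mul s t _ _ hs ht => exact hs.mul_right ht
      intro u hu v hv
      induction hu using Subsemigroup.closure_induction with
      | mem z hz => rw [Set.mem_singleton_iff.1 hz]; exact this v hv
      | mul s t _ _ hs ht => exact Commute.mul_left hs ht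
    obtain ⟨hxc, w, hwc, hw⟩ := hcl x y hxy
    have hyc := (hcl y x (hD x y hxy).1).1
    have hz : mulW x w y ∈ Stem ps i :=
      Or.inr ⟨mulW_mem_left hCi hx _ _, hmax _ _ hw⟩
    have hne := (hD _ _ hw).2.2.2.1
    cases w with
    | none =>
      have hz' := hN.of_mul_mem_stem hPN (s := x) (t := y) hz
      exact hne (hcomm _ (hdich x hxc hz'.1) _ (hdich y hyc hz'.2))
    | some c =>
      obtain ⟨hz', hyS⟩ := hN.of_mul_mem_stem hPN (s := x * c) (t := y) hz
      obtain ⟨hxS, hcS⟩ := hN.of_mul_mem_stem hPN hz'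
      have hx' := hdich x hxc hxS
      have hy' := hdich y hyc hyS
      have hc' := hdich c (hwc c rfl) hcS
      refine hne ?_
      change x * c * y = y * c * x
      rw [hcomm (x * c) (Subsemigroup.mul_mem _ hx' hc') y hy', hcomm x hx' c hc', mul_assoc]
  have hcl : ∀ x y, D x y → x ∈ Subsemigroup.closure ({a, b} : Set S) ∧ ∃ w : Option S,
      (∀ c, w = some c → c ∈ Subsemigroup.closure ({a, b} : Set S)) ∧
      D (mulW x w y) (mulW y w x) := fun x y hxy => ⟨(hD x y hxy).2.1, (hD x y hxy).2.2.2.2⟩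
  refine ⟨i, hN, key b a ?_, key a b hcl⟩
  rwa [Set.pair_comm]

theorem NonNilpotentFactor.exists_root [Finite S] (hPN : IsPN S) (h : NonNilpotentFactor ps i) :
    ∃ j, i ≤ j ∧ NonNilpotentFactor ps j ∧ Root ps j ∧ Stem ps i ⊆ Stem ps j := by
  induction hk : ps.m - i using Nat.strong_induction_on generalizing i with
  | _ k ih =>
    by_cases hr : Root ps i
    · exact ⟨i, le_rfl, h, hr, subset_rfl⟩
    have h' := h
    obtain ⟨h1, h2, h3⟩ := h'
    have : ∃ a ∈ ps.C i \ ps.C (i + 1), ∃ b ∈ ps.C (i + 1), NEdge a b := by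
      by_contra! hc
      exact hr ⟨h3, hc⟩
    obtain ⟨a, ha, b, hb, hab⟩ := this
    obtain ⟨j, hj, haj, hbj⟩ := exists_stem_of_nEdge hPN ps hab
    have hij : i + 1 ≤ j := by
      refine ps.le_index (by omega) hb fun k => ?_
      obtain ⟨c, hc, hc'⟩ := Set.exists_of_ssubset (ps.ssub j hj.1 hj.2.1)
      have := hj.2.1
      exact (hj.mul_notMem hPN hbj ⟨hc, hc'⟩).1
        (ps.mul_right_mem (by omega) (by omega) k c)
    have hsub : Stem ps i ⊆ Stem ps j := by
      intro s hs
      have hsa : s * a ∈ ps.C i \ ps.C (i + 1) :=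
        ⟨ps.mul_left_mem h1 (by omega) ha.1 s, (h.mul_notMem hPN hs ha).1⟩
      exact (hj.of_mul_mem_stem hPN (hj.mem_stem_of_mem hPN h1 h2 ha hsa haj)).1
    have := hj.2.1
    obtain ⟨l, hjl, hl, hrl, hsubl⟩ := ih (ps.m - j) (by omega) hj rfl
    exact ⟨l, by omega, hl, hrl, hsub.trans hsubl⟩

theorem mem_kset_iff [Finite S] (hPN : IsPN S) (ps : PrincipalSeries S) {c : S} :
    c ∈ Kset ps ↔ ∀ j, NonNilpotentFactor ps j → c ∉ Stem ps j := by
  constructor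
  · rintro ⟨i, h1, h2, ⟨hr, hiso⟩, hc⟩ j hj hcj
    have hFset : ∀ j, NonNilpotentFactor ps j → j ≠ i → c ∈ Stem ps j → False := by
      intro j hj hji hcj
      refine hj.2.2 (hiso j hj.1 hj.2.1 fun d hd => ?_)
      refine (hj.mem_stem_of_mem hPN h1 h2 hc hd hcj).resolve_right fun k => hji ?_
      have := hj.2.1
      exact le_antisymm (ps.le_index (by omega) k.1 hd.2)
        (ps.le_index (by omega) hd.1 k.2)
    obtain ⟨l, -, hl, hlr, hsub⟩ := hj.exists_root hPN
    exact hFset l hl (fun e => hr (e ▸ hlr)) (hsub hcj)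
  · intro h
    obtain ⟨i, h1, h2, hc⟩ := ps.exists_index c
    refine ⟨i, h1, h2, ⟨fun hr => h i ⟨h1, h2, hr.1⟩ (Or.inr hc), fun j hj hj' hsub => ?_⟩, hc⟩
    by_contra hn
    exact h j ⟨hj, hj', hn⟩ (Or.inl (hsub hc))

theorem exists_stem_of_notMem_kset [Finite S] (hPN : IsPN S) {c : S} (hc : c ∉ Kset ps) :
    ∃ j, NonNilpotentFactor ps j ∧ c ∈ Stem ps j := by
  rw [mem_kset_iff hPN] at hc
  push Not at hc
  exact hc

theorem nReach_of_mul_notMem_kset [Finite S] (hPN : IsPN S) {x y : S} (h : x * y ∉ Kset ps) :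
    x ∉ Kset ps ∧ y ∉ Kset ps ∧ NReach x y ∧ NReach x (x * y) := by
  obtain ⟨j, hj, hxy⟩ := exists_stem_of_notMem_kset hPN h
  obtain ⟨hx, hy⟩ := hj.of_mul_mem_stem hPN hxy
  exact ⟨fun k => (mem_kset_iff hPN ps).1 k j hj hx, fun k => (mem_kset_iff hPN ps).1 k j hj hy,
    (hj.nReach hPN hx hy).1, (hj.nReach hPN hx hxy).1⟩

end Stems

/-- Let `S` be a pseudo-nilpotent finite semigroup with largest nilpotent ideal
`K`.  Every connected component of `N_S` with more than one element is a union of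
stems; for each such component `C`, the set `C ∪ K` is a subsemigroup; and `S/K`
is a `0`-disjoint union of the components: every element lies in `K` or in a
component with more than one element, and distinct such components are disjoint
and multiply into `K` (i.e. to the zero of `S/K`). -/
theorem stmt18 {S : Type*} [Semigroup S] [Finite S] [Nonempty S]
    (hPN : IsPN S) (ps : PrincipalSeries S) :
    (∀ a : S, (∃ b, NEdge a b) → ∀ c, NReach a c →
      ∃ i, 1 ≤ i ∧ i ≤ ps.m ∧ Root ps i ∧ c ∈ Stem ps i ∧
        Stem ps i ⊆ {d | NReach a d}) ∧
    (∀ a : S, (∃ b, NEdge a b) →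
      ∀ x ∈ {d | NReach a d} ∪ Kset ps, ∀ y ∈ {d | NReach a d} ∪ Kset ps,
        x * y ∈ {d | NReach a d} ∪ Kset ps) ∧
    (∀ c : S, c ∈ Kset ps ∨ ∃ a, (∃ b, NEdge a b) ∧ NReach a c) ∧
    (∀ a a' : S, (∃ b, NEdge a b) → (∃ b, NEdge a' b) → ¬ NReach a a' →
      ∀ x, NReach a x → ∀ y, NReach a' y → x * y ∈ Kset ps ∧ x ≠ y) := by
  refine ⟨?_, ?_, ?_, ?_⟩
  · rintro a ⟨b, hab⟩ c hac
    obtain ⟨d, hcd⟩ := exists_nEdge_of_nReach hac hab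
    obtain ⟨i, hi, hc, -⟩ := exists_stem_of_nEdge hPN ps hcd
    obtain ⟨j, -, hj, hjr, hsub⟩ := hi.exists_root hPN
    exact ⟨j, hj.1, hj.2.1, hjr, hsub hc, fun e he =>
      hac.trans (hj.nReach hPN (hsub hc) he).1⟩
  · intro a _ x hx y hy
    by_contra hn
    obtain ⟨h1, h2⟩ := not_or.1 hn
    obtain ⟨hxK, -, -, hr⟩ := nReach_of_mul_notMem_kset hPN h2
    exact h1 ((hx.resolve_right hxK).trans hr)
  · intro c
    by_cases hc : c ∈ Kset ps
    · exact Or.inl hc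
    · obtain ⟨j, hj, hcj⟩ := exists_stem_of_notMem_kset hPN hc
      exact Or.inr ⟨c, (hj.nReach hPN hcj hcj).2, Relation.ReflTransGen.refl⟩
  · intro a a' _ _ haa' x hx y hy
    refine ⟨?_, ?_⟩
    · by_contra hn
      exact haa' ((hx.trans (nReach_of_mul_notMem_kset hPN hn).2.2.1).trans hy.symm)
    · rintro rfl
      exact haa' (hx.trans hy.symm)
end

section
/- Let S be a strong pseudo-nilpotent finite semigroup with largest nilpotent ideal K. Two elements x, y ∈ S \ K lie in the same connected component of the upper non-nilpotent graph N_S if and only if there exists z ∈ S such that xz ∉ K and zy ∉ K. -/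
variable {S : Type*} [Semigroup S]

/-- `a` and `b` lie in the same pseudo-nilpotent class determined by the root
`S_i \ S_{i+1}`: they have the same neighbours in `N_S` among `S_i \ S_{i+1}`. -/
def SameClass {S : Type*} [Semigroup S] (ps : PrincipalSeries S) (i : ℕ)
    (a b : S) : Prop :=
  ∀ x ∈ ps.C i \ ps.C (i + 1), (NEdge a x ↔ NEdge b x)

namespace PseudoNilpotent

section Monoid

variable {M : Type*} [Monoid M]

/-- The pair `(x, y)` starts an infinite Mal'cev sequence with parameters in `A` whose two
entries stay in `J` and remain distinct. -/
def Sep (J A : Set M) (x y : M) : Prop :=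
  ∃ P : Set (M × M), (x, y) ∈ P ∧ ∀ a b, (a, b) ∈ P →
    a ∈ J ∧ b ∈ J ∧ a ≠ b ∧ ∃ w ∈ A, (a * w * b, b * w * a) ∈ P

/-- The right multiples of `x`. -/
def rm (x : M) : Set M := Set.range (x * ·)

/-- The left multiples of `x`. -/
def lm (x : M) : Set M := Set.range (· * x)

lemma mem_rm_self (x : M) : x ∈ rm x := ⟨1, mul_one x⟩

lemma mem_lm_self (x : M) : x ∈ lm x := ⟨1, one_mul x⟩

lemma rm_eq_of {x y p q : M} (h₁ : x = y * p) (h₂ : y = x * q) : rm x = rm y := by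
  apply Set.Subset.antisymm
  · rintro _ ⟨r, rfl⟩
    exact ⟨p * r, by simp [h₁, mul_assoc]⟩
  · rintro _ ⟨r, rfl⟩
    refine ⟨q * r, ?_⟩
    change x * (q * r) = y * r
    rw [← mul_assoc, ← h₂]

lemma lm_eq_of {x y p q : M} (h₁ : x = p * y) (h₂ : y = q * x) : lm x = lm y := by
  apply Set.Subset.antisymm
  · rintro _ ⟨r, rfl⟩
    exact ⟨r * p, by simp [h₁, mul_assoc]⟩
  · rintro _ ⟨r, rfl⟩
    refine ⟨r * q, ?_⟩
    change r * q * x = r * y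
    rw [mul_assoc, ← h₂]

lemma exists_of_rm_eq {x y : M} (h : rm x = rm y) : ∃ p, x = y * p := by
  have := mem_rm_self x
  rw [h] at this
  obtain ⟨p, hp⟩ := this
  exact ⟨p, hp.symm⟩

lemma exists_of_lm_eq {x y : M} (h : lm x = lm y) : ∃ p, x = p * y := by
  have := mem_lm_self x
  rw [h] at this
  obtain ⟨p, hp⟩ := this
  exact ⟨p, hp.symm⟩

lemma rm_mul_left {x y : M} (c : M) (h : rm x = rm y) : rm (c * x) = rm (c * y) := by
  obtain ⟨p, hp⟩ := exists_of_rm_eq h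
  obtain ⟨q, hq⟩ := exists_of_rm_eq h.symm
  exact rm_eq_of (p := p) (q := q) (by rw [mul_assoc, ← hp]) (by rw [mul_assoc, ← hq])

lemma lm_mul_right {x y : M} (c : M) (h : lm x = lm y) : lm (x * c) = lm (y * c) := by
  obtain ⟨p, hp⟩ := exists_of_lm_eq h
  obtain ⟨q, hq⟩ := exists_of_lm_eq h.symm
  exact lm_eq_of (p := p) (q := q) (by rw [← mul_assoc, ← hp]) (by rw [← mul_assoc, ← hq])

lemma exists_pow_eq_pow_add [Finite M] (s : M) : ∃ i d : ℕ, 0 < d ∧ s ^ (i + d) = s ^ i := by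
  obtain ⟨m, n, hmn, h⟩ := Finite.exists_ne_map_eq_of_infinite (fun n : ℕ => s ^ n)
  rcases lt_or_gt_of_ne hmn with hlt | hlt
  · exact ⟨m, n - m, by omega, by rw [Nat.add_sub_cancel' hlt.le]; exact h.symm⟩
  · exact ⟨n, m - n, by omega, by rw [Nat.add_sub_cancel' hlt.le]; exact h⟩

lemma pow_mul_mul_pow {p q x : M} (h : p * x * q = x) (n : ℕ) : p ^ n * x * q ^ n = x := by
  induction n with
  | zero => simp
  | succ n ih =>
    calc p ^ (n + 1) * x * q ^ (n + 1) = p ^ n * (p * x * q) * q ^ n := by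
          rw [pow_succ, pow_succ']; simp only [mul_assoc]
      _ = x := by rw [h, ih]

lemma exists_eq_mul_right [Finite M] {p q x : M} (h : p * x * q = x) : ∃ r, x = x * q * r := by
  obtain ⟨i, d, hd, hp⟩ := exists_pow_eq_pow_add p
  obtain ⟨e, rfl⟩ : ∃ e, d = e + 1 := ⟨d - 1, by omega⟩
  refine ⟨q ^ e, ?_⟩
  have h₁ := pow_mul_mul_pow h i
  have h₂ := pow_mul_mul_pow h (i + (e + 1))
  calc x = p ^ i * x * q ^ (i + (e + 1)) := by rw [← hp, h₂]
    _ = p ^ i * x * q ^ i * (q * q ^ e) := by rw [pow_add, pow_succ']; simp only [mul_assoc]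
    _ = x * q * q ^ e := by rw [h₁, mul_assoc]

lemma exists_eq_mul_left [Finite M] {p q x : M} (h : p * x * q = x) : ∃ r, x = r * (p * x) := by
  obtain ⟨i, d, hd, hq⟩ := exists_pow_eq_pow_add q
  obtain ⟨e, rfl⟩ : ∃ e, d = e + 1 := ⟨d - 1, by omega⟩
  refine ⟨p ^ e, ?_⟩
  have h₁ := pow_mul_mul_pow h i
  have h₂ := pow_mul_mul_pow h (i + (e + 1))
  calc x = p ^ (i + (e + 1)) * x * q ^ i := by rw [← hq, h₂]
    _ = p ^ (e + 1) * (p ^ i * x * q ^ i) := by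
        rw [add_comm i, pow_add]; simp only [mul_assoc]
    _ = p ^ e * (p * x) := by rw [h₁, pow_succ, mul_assoc]

lemma closure_pair_cases {x y g : M} (hg : g ∈ Submonoid.closure {x, y}) :
    g = 1 ∨ ((∃ p, g = x * p) ∨ ∃ p, g = y * p) ∧ ((∃ p, g = p * x) ∨ ∃ p, g = p * y) := by
  induction hg using Submonoid.closure_induction with
  | mem z hz =>
    right
    rcases hz with rfl | hz
    · exact ⟨Or.inl ⟨1, by simp⟩, Or.inl ⟨1, by simp⟩⟩
    · rw [Set.mem_singleton_iff] at hz
      subst hz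
      exact ⟨Or.inr ⟨1, by simp⟩, Or.inr ⟨1, by simp⟩⟩
  | one => exact Or.inl rfl
  | mul a b _ _ ha hb =>
    rcases ha with rfl | ⟨ha, ha'⟩
    · simpa using hb
    · rcases hb with rfl | ⟨hb, hb'⟩
      · simpa using Or.inr ⟨ha, ha'⟩
      · refine Or.inr ⟨?_, ?_⟩
        · rcases ha with ⟨p, rfl⟩ | ⟨p, rfl⟩
          · exact Or.inl ⟨p * b, mul_assoc _ _ _⟩
          · exact Or.inr ⟨p * b, mul_assoc _ _ _⟩
        · rcases hb' with ⟨p, rfl⟩ | ⟨p, rfl⟩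
          · exact Or.inl ⟨a * p, (mul_assoc _ _ _).symm⟩
          · exact Or.inr ⟨a * p, (mul_assoc _ _ _).symm⟩

lemma Sep.not_comm {J A : Set M} {x y : M} (h : Sep J A x y)
    (hc : ∀ w ∈ A, x * w * y = y * w * x) : False := by
  obtain ⟨P, hP, hs⟩ := h
  obtain ⟨-, -, -, w, hw, hP'⟩ := hs _ _ hP
  exact (hs _ _ hP').2.2.1 (hc w hw)

lemma Sep.not_pairwise_comm {J A : Set M} {x y : M} (h : Sep J A x y)
    (hx : x ∈ A) (hy : y ∈ A) (hc : ∀ a ∈ A, ∀ b ∈ A, a * b = b * a) : False := by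
  refine h.not_comm fun w hw => ?_
  rw [mul_assoc, hc w hw y hy, ← mul_assoc, hc x hx y hy, mul_assoc, hc x hx w hw, ← mul_assoc]

lemma closure_pair_comm {x y : M} (h : x * y = y * x) :
    ∀ a ∈ Submonoid.closure {x, y}, ∀ b ∈ Submonoid.closure {x, y}, a * b = b * a := by
  intro a ha b hb
  have := Submonoid.closure_le_centralizer_centralizer ({x, y} : Set M)
  refine Set.centralizer_centralizer_comm_of_comm ?_ a (this ha) b (this hb)
  rintro c (rfl | rfl) d (rfl | rfl) <;> simp [h]

/-- A `𝒥`-class `J` inside `N`, together with the two forms of pseudo-nilpotency: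
an infinite nontrivial Mal'cev sequence forces such a sequence inside the submonoid generated
by its first two entries. -/
structure Ctx (N J : Set M) : Prop where
  sub : J ⊆ N
  one_notMem : (1 : M) ∉ N
  mul_mem : ∀ a ∈ N, ∀ b ∈ N, a * b ∈ N
  div : ∀ a ∈ J, ∀ b ∈ J, ∃ p q, b = p * a * q
  conv : ∀ a ∈ J, ∀ p q r s, r * (p * a * q) * s ∈ J → p * a * q ∈ J
  sepJ : ∀ x ∈ J, ∀ y ∈ J, Sep J Set.univ x y →
    ∃ x' ∈ Submonoid.closure {x, y}, ∃ y' ∈ Submonoid.closure {x, y},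
      Sep J (Submonoid.closure {x, y}) x' y'
  sep : ∀ x ∈ N, ∀ y ∈ N, Sep Set.univ Set.univ x y →
    ∃ x' ∈ Submonoid.closure {x, y}, ∃ y' ∈ Submonoid.closure {x, y},
      Sep Set.univ (Submonoid.closure {x, y}) x' y'

namespace Ctx

variable {N J : Set M} (h : Ctx N J)

include h

lemma mem_of_mul_right {a s t : M} (ha : a ∈ J) (hm : a * s * t ∈ J) : a * s ∈ J := by
  have := h.conv a ha 1 s 1 t (by simpa using hm)
  simpa using this

lemma mem_of_mul_left {a s t : M} (ha : a ∈ J) (hm : t * (s * a) ∈ J) : s * a ∈ J := by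
  have := h.conv a ha s 1 t 1 (by simpa using hm)
  simpa using this

lemma mem_of_mid {a b r s : M} (ha : a ∈ J) (hm : r * (a * b) * s ∈ J) : a * b ∈ J := by
  have := h.conv a ha 1 b r s (by simpa using hm)
  simpa using this

lemma mem_of_mid' {a b r s : M} (hb : b ∈ J) (hm : r * (a * b) * s ∈ J) : a * b ∈ J := by
  have := h.conv b hb a 1 r s (by simpa using hm)
  simpa using this

lemma rm_mul [Finite M] {x p : M} (hx : x ∈ J) (hxp : x * p ∈ J) : rm (x * p) = rm x := by
  obtain ⟨r, s, hrs⟩ := h.div _ hxp _ hx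
  obtain ⟨t, ht⟩ := exists_eq_mul_right (p := r) (q := p * s) (x := x)
    (by rw [← mul_assoc, mul_assoc r x p]; exact hrs.symm)
  exact rm_eq_of (p := p) (q := s * t) rfl (by simpa only [mul_assoc] using ht)

lemma lm_mul [Finite M] {x p : M} (hx : x ∈ J) (hxp : p * x ∈ J) : lm (p * x) = lm x := by
  obtain ⟨r, s, hrs⟩ := h.div _ hxp _ hx
  obtain ⟨t, ht⟩ := exists_eq_mul_left (p := r * p) (q := s) (x := x)
    (by rw [mul_assoc r p x]; exact hrs.symm)
  exact lm_eq_of (p := p) (q := t * r) rfl (by simpa only [mul_assoc] using ht)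

lemma mul_congr {a b a' b' : M} (hb' : b' ∈ J) (hab : a * b ∈ J) (hl : lm a = lm a')
    (hr : rm b = rm b') : a' * b' ∈ J := by
  obtain ⟨c, rfl⟩ := exists_of_lm_eq hl
  obtain ⟨d, rfl⟩ := exists_of_rm_eq hr
  exact h.mem_of_mid' (r := c) (s := d) hb' (by simpa only [mul_assoc] using hab)

lemma exists_rm_lm [Finite M] {a b : M} (ha : a ∈ J) (hb : b ∈ J) :
    ∃ c ∈ J, rm c = rm a ∧ lm c = lm b := by
  obtain ⟨p, q, rfl⟩ := h.div _ ha _ hb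
  have hc : a * q ∈ J := h.mem_of_mid (r := p) (s := 1) ha (by simpa [mul_assoc] using hb)
  refine ⟨a * q, hc, h.rm_mul ha hc, ?_⟩
  rw [mul_assoc] at hb ⊢
  exact (h.lm_mul hc hb).symm

lemma not_sep_of_eq [Finite M] {x y : M} (hr : rm x = rm y) (hl : lm x = lm y) :
    ¬ Sep J Set.univ x y := by
  rintro ⟨P, hP, hs⟩
  obtain ⟨hx, hy, hne, w, -, hw⟩ := hs _ _ hP
  have hxwy := (hs _ _ hw).1
  have hz : x * w ∈ J := h.mem_of_mul_right hx hxwy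
  have hrz := h.rm_mul hx hz
  set z := x * w with hz_def
  have hzz : z * z ∈ J := h.mul_congr hz hxwy rfl (hr.symm.trans hrz.symm)
  obtain ⟨r₁, hr₁⟩ := exists_of_rm_eq (h.rm_mul hz hzz).symm
  obtain ⟨r₂, hr₂⟩ := exists_of_lm_eq (h.lm_mul hz hzz).symm
  have he : z * r₁ = r₂ * z := by
    conv_lhs => rw [hr₂]
    rw [mul_assoc r₂, ← hr₁]
  set e := z * r₁ with he_def
  have hez : e * z = z := by rw [he, mul_assoc]; exact hr₂.symm
  have hee : e * e = e := by rw [he_def, ← mul_assoc, hez]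
  have hre : rm e = rm x := (rm_eq_of he_def hez.symm).trans hrz
  obtain ⟨t, ht⟩ := exists_of_rm_eq hre.symm
  obtain ⟨r, hr'⟩ := exists_of_rm_eq hre
  have hex : e * x = x := by rw [ht, ← mul_assoc, hee]
  have hfix : ∀ a, lm a = lm x → a * r * x = a := by
    intro a ha
    obtain ⟨c, rfl⟩ := exists_of_lm_eq ha
    rw [mul_assoc c x r, ← hr', mul_assoc, hex]
  have hmem : ∀ a ∈ J, lm a = lm x → a * r ∈ J := fun a ha hla =>
    h.mem_of_mul_right (t := x) ha (by rwa [hfix a hla])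
  have hsep : Sep J Set.univ e (y * r) := by
    refine ⟨{p | ∃ a b, (a, b) ∈ P ∧ lm a = lm x ∧ lm b = lm x ∧ p = (a * r, b * r)},
      ⟨x, y, hP, rfl, hl.symm, by rw [← hr']⟩, ?_⟩
    rintro _ _ ⟨a, b, hab, hla, hlb, heq⟩
    obtain ⟨rfl, rfl⟩ := Prod.mk.inj heq
    obtain ⟨ha, hb, hne, w, -, hw⟩ := hs _ _ hab
    obtain ⟨haw, hbw, -⟩ := hs _ _ hw
    refine ⟨hmem a ha hla, hmem b hb hlb, ?_, x * w, trivial,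
      a * w * b, b * w * a, hw, (h.lm_mul hb haw).trans hlb, (h.lm_mul ha hbw).trans hla, ?_⟩
    · intro h'
      apply hne
      rw [← hfix a hla, h', hfix b hlb]
    · have h₁ : a * r * (x * w) * (b * r) = a * w * b * r := by
        rw [← mul_assoc (a * r) x w, hfix a hla, ← mul_assoc]
      have h₂ : b * r * (x * w) * (a * r) = b * w * a * r := by
        rw [← mul_assoc (b * r) x w, hfix b hlb, ← mul_assoc]
      rw [h₁, h₂]
  have heJ : e ∈ J := by rw [hr']; exact hmem x hx rfl
  have hyr : y * r ∈ J := hmem y hy hl.symm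
  obtain ⟨x', hx', y', hy', hs'⟩ := h.sepJ e heJ (y * r) hyr hsep
  obtain ⟨c, hc⟩ := exists_of_rm_eq (hr.symm.trans hre.symm)
  obtain ⟨d, hd⟩ := exists_of_lm_eq hl.symm
  refine hs'.not_pairwise_comm hx' hy' (closure_pair_comm ?_)
  have h₁ : e * (y * r) = y * r := by rw [hc, ← mul_assoc, ← mul_assoc, hee]
  have h₂ : y * r * e = y * r := by rw [hd, mul_assoc d, ← hr', mul_assoc, hee]
  rw [h₁, h₂]

lemma exists_of_sep {A : Set M} {x y : M} (hs : Sep J A x y) (hxA : x ∈ A)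
    (hA : ∀ w ∈ A, ∀ a ∈ J, ∀ b ∈ J, a * w * b ∈ J → w = 1 ∨ w ∈ J) :
    (∃ c ∈ A, c ∈ J ∧ c * x ∈ J ∧ c * y ∈ J) ∧ ∃ c ∈ A, c ∈ J ∧ x * c ∈ J ∧ y * c ∈ J := by
  obtain ⟨P, hP, hs⟩ := hs
  obtain ⟨hx, hy, -, w, hwA, hw⟩ := hs _ _ hP
  obtain ⟨h₁, h₂, -, w', hwA', hw'⟩ := hs _ _ hw
  obtain ⟨h₃, h₄, -⟩ := hs _ _ hw'
  rcases hA w hwA x hx y hy h₁ with rfl | hwJ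
  · simp only [mul_one] at *
    rcases hA w' hwA' _ h₁ _ h₂ h₃ with rfl | hwJ
    · have hxx : x * x ∈ J := h.mem_of_mid (r := y) (s := y) hx (by simpa [mul_assoc] using h₄)
      exact ⟨⟨x, hxA, hx, hxx, h₁⟩, x, hxA, hx, hxx, h₂⟩
    · refine ⟨⟨w', hwA', hwJ, ?_, ?_⟩, w', hwA', hwJ, ?_, ?_⟩
      · exact h.mem_of_mid (r := y * x) (s := y) hwJ (by simpa [mul_assoc] using h₄)
      · exact h.mem_of_mid (r := x * y) (s := x) hwJ (by simpa [mul_assoc] using h₃)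
      · exact h.mem_of_mid (r := y) (s := x * y) hx (by simpa [mul_assoc] using h₄)
      · exact h.mem_of_mid (r := x) (s := y * x) hy (by simpa [mul_assoc] using h₃)
  · refine ⟨⟨w, hwA, hwJ, ?_, ?_⟩, w, hwA, hwJ, ?_, ?_⟩
    · exact h.mem_of_mid (r := y) (s := 1) hwJ (by simpa [mul_assoc] using h₂)
    · exact h.mem_of_mid (r := x) (s := 1) hwJ (by simpa [mul_assoc] using h₁)
    · exact h.mem_of_mul_right hx h₁
    · exact h.mem_of_mul_right hy h₂

lemma rm_of_mem_closure [Finite M] {x y g : M} (hx : x ∈ J) (hy : y ∈ J)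
    (hg : g ∈ Submonoid.closure {x, y}) (hgJ : g ∈ J) :
    (rm g = rm x ∨ rm g = rm y) ∧ (lm g = lm x ∨ lm g = lm y) := by
  rcases closure_pair_cases hg with rfl | ⟨h₁, h₂⟩
  · exact absurd (h.sub hgJ) h.one_notMem
  · refine ⟨?_, ?_⟩
    · rcases h₁ with ⟨p, rfl⟩ | ⟨p, rfl⟩
      · exact Or.inl (h.rm_mul hx hgJ)
      · exact Or.inr (h.rm_mul hy hgJ)
    · rcases h₂ with ⟨p, rfl⟩ | ⟨p, rfl⟩
      · exact Or.inl (h.lm_mul hx hgJ)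
      · exact Or.inr (h.lm_mul hy hgJ)

lemma eq_one_or_mem_of_mem_closure {x y w a b : M} (hx : x ∈ J) (hy : y ∈ J)
    (hw : w ∈ Submonoid.closure {x, y}) (hm : a * w * b ∈ J) : w = 1 ∨ w ∈ J := by
  rcases closure_pair_cases hw with rfl | ⟨⟨p, rfl⟩ | ⟨p, rfl⟩, -⟩
  · exact Or.inl rfl
  · exact Or.inr (h.mem_of_mid hx hm)
  · exact Or.inr (h.mem_of_mid hy hm)

lemma sep_of_mul_mem [Finite M] {x y w : M} (hx : x ∈ J) (hy : y ∈ J) (hw : w ∈ J)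
    (hxw : x * w ∈ J) (hyw : y * w ∈ J) (hwx : w * x ∈ J) (hwy : w * y ∈ J)
    (hne : ¬ (rm x = rm y ∧ lm x = lm y)) : Sep J Set.univ x y := by
  refine ⟨{p | p.1 ∈ J ∧ p.2 ∈ J ∧ rm p.1 = rm x ∧ rm p.2 = rm y ∧
    ((lm p.1 = lm x ∧ lm p.2 = lm y) ∨ (lm p.1 = lm y ∧ lm p.2 = lm x))},
    ⟨hx, hy, rfl, rfl, Or.inl ⟨rfl, rfl⟩⟩, ?_⟩
  rintro a b ⟨ha, hb, hra, hrb, hl⟩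
  dsimp only at *
  have haw : a * w ∈ J := by
    rcases hl with hl | hl
    · exact h.mul_congr hw hxw hl.1.symm rfl
    · exact h.mul_congr hw hyw hl.1.symm rfl
  have hbw : b * w ∈ J := by
    rcases hl with hl | hl
    · exact h.mul_congr hw hyw hl.2.symm rfl
    · exact h.mul_congr hw hxw hl.2.symm rfl
  have hawb : a * w * b ∈ J := h.mul_congr hb hwy (h.lm_mul hw haw).symm hrb.symm
  have hbwa : b * w * a ∈ J := h.mul_congr ha hwx (h.lm_mul hw hbw).symm hra.symm
  refine ⟨ha, hb, ?_, w, trivial, hawb, hbwa, ?_, ?_, ?_⟩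
  · rintro rfl
    apply hne
    refine ⟨hra.symm.trans hrb, ?_⟩
    rcases hl with hl | hl
    · exact hl.1.symm.trans hl.2
    · exact hl.2.symm.trans hl.1
  · dsimp only; rw [mul_assoc] at hawb ⊢; rw [h.rm_mul ha hawb, hra]
  · dsimp only; rw [mul_assoc] at hbwa ⊢; rw [h.rm_mul hb hbwa, hrb]
  · dsimp only
    rw [h.lm_mul hb hawb, h.lm_mul ha hbwa]
    tauto

lemma exists_mem_closure [Finite M] {x y w : M} (hx : x ∈ J) (hy : y ∈ J) (hw : w ∈ J)
    (hxw : x * w ∈ J) (hyw : y * w ∈ J) (hwx : w * x ∈ J) (hwy : w * y ∈ J)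
    (hne : ¬ (rm x = rm y ∧ lm x = lm y)) :
    ∃ x' ∈ J, ∃ y' ∈ J, x' ∈ Submonoid.closure {x, y} ∧ y' ∈ Submonoid.closure {x, y} ∧
      ¬ (rm x' = rm y' ∧ lm x' = lm y') ∧
      (∃ c ∈ Submonoid.closure {x, y}, c ∈ J ∧ c * x' ∈ J ∧ c * y' ∈ J) ∧
      ∃ c ∈ Submonoid.closure {x, y}, c ∈ J ∧ x' * c ∈ J ∧ y' * c ∈ J := by
  obtain ⟨x', hx', y', hy', hs⟩ :=
    h.sepJ x hx y hy (h.sep_of_mul_mem hx hy hw hxw hyw hwx hwy hne)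
  have hs₀ := hs
  obtain ⟨P, hP, hP'⟩ := hs₀
  refine ⟨x', (hP' _ _ hP).1, y', (hP' _ _ hP).2.1, hx', hy', ?_, h.exists_of_sep hs hx' ?_⟩
  · rintro ⟨hr, hl⟩
    refine h.not_sep_of_eq hr hl ⟨P, hP, fun a b hab => ?_⟩
    obtain ⟨h₁, h₂, h₃, w, -, h₄⟩ := hP' a b hab
    exact ⟨h₁, h₂, h₃, w, trivial, h₄⟩
  · intro w hw a _ b _ hm
    exact h.eq_one_or_mem_of_mem_closure hx hy hw hm

lemma mul_mem_of_rm_ne [Finite M] {u v c d : M} (hu : u ∈ J) (hv : v ∈ J) (hc : c ∈ J) (hd : d ∈ J)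
    (hcu : c * u ∈ J) (hcv : c * v ∈ J) (hne : rm u ≠ rm v) {k : M} (hk : k ∈ J)
    (hdk : d * k ∈ J) : d * u ∈ J ∧ d * v ∈ J := by
  obtain ⟨x, hx, hrx, hlx⟩ := h.exists_rm_lm hu hd
  obtain ⟨y, hy, hry, hly⟩ := h.exists_rm_lm hv hd
  obtain ⟨w, hw, hrw, hlw⟩ := h.exists_rm_lm hk hc
  obtain ⟨x', hx', y', hy', hx₁, hy₁, hne', ⟨e, he₁, he, hex, hey⟩, -⟩ :=
    h.exists_mem_closure hx hy hw
      (h.mul_congr hw hdk hlx.symm hrw.symm) (h.mul_congr hw hdk hly.symm hrw.symm)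
      (h.mul_congr hx hcu hlw.symm hrx.symm) (h.mul_congr hy hcv hlw.symm hry.symm)
      (fun h' => hne (hrx.symm.trans (h'.1.trans hry)))
  have hle : ∀ g ∈ Submonoid.closure {x, y}, g ∈ J → lm g = lm d := by
    intro g hg hgJ
    rcases (h.rm_of_mem_closure hx hy hg hgJ).2 with h' | h'
    · exact h'.trans hlx
    · exact h'.trans hly
  have hdx := h.mul_congr hx' hex (hle e he₁ he) rfl
  have hdy := h.mul_congr hy' hey (hle e he₁ he) rfl
  have hrr : rm x' ≠ rm y' := fun h' => hne' ⟨h', (hle _ hx₁ hx').trans (hle _ hy₁ hy').symm⟩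
  rcases (h.rm_of_mem_closure hx hy hx₁ hx').1 with h₁ | h₁ <;>
    rcases (h.rm_of_mem_closure hx hy hy₁ hy').1 with h₂ | h₂
  · exact absurd (h₁.trans h₂.symm) hrr
  · exact ⟨h.mul_congr hu hdx rfl (h₁.trans hrx), h.mul_congr hv hdy rfl (h₂.trans hry)⟩
  · exact ⟨h.mul_congr hu hdy rfl (h₂.trans hrx), h.mul_congr hv hdx rfl (h₁.trans hry)⟩
  · exact absurd (h₁.trans h₂.symm) hrr

lemma mul_mem_of_lm_ne [Finite M] {u v c d : M} (hu : u ∈ J) (hv : v ∈ J) (hc : c ∈ J) (hd : d ∈ J)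
    (hcu : u * c ∈ J) (hcv : v * c ∈ J) (hne : lm u ≠ lm v) {k : M} (hk : k ∈ J)
    (hdk : k * d ∈ J) : u * d ∈ J ∧ v * d ∈ J := by
  obtain ⟨x, hx, hrx, hlx⟩ := h.exists_rm_lm hd hu
  obtain ⟨y, hy, hry, hly⟩ := h.exists_rm_lm hd hv
  obtain ⟨w, hw, hrw, hlw⟩ := h.exists_rm_lm hc hk
  obtain ⟨x', hx', y', hy', hx₁, hy₁, hne', -, e, he₁, he, hex, hey⟩ :=
    h.exists_mem_closure hx hy hw
      (h.mul_congr hw hcu hlx.symm hrw.symm) (h.mul_congr hw hcv hly.symm hrw.symm)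
      (h.mul_congr hx hdk hlw.symm hrx.symm) (h.mul_congr hy hdk hlw.symm hry.symm)
      (fun h' => hne (hlx.symm.trans (h'.2.trans hly)))
  have hre : ∀ g ∈ Submonoid.closure {x, y}, g ∈ J → rm g = rm d := by
    intro g hg hgJ
    rcases (h.rm_of_mem_closure hx hy hg hgJ).1 with h' | h'
    · exact h'.trans hrx
    · exact h'.trans hry
  have hdx := h.mul_congr hd hex rfl (hre e he₁ he)
  have hdy := h.mul_congr hd hey rfl (hre e he₁ he)
  have hll : lm x' ≠ lm y' := fun h' => hne' ⟨(hre _ hx₁ hx').trans (hre _ hy₁ hy').symm, h'⟩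
  rcases (h.rm_of_mem_closure hx hy hx₁ hx').2 with h₁ | h₁ <;>
    rcases (h.rm_of_mem_closure hx hy hy₁ hy').2 with h₂ | h₂
  · exact absurd (h₁.trans h₂.symm) hll
  · exact ⟨h.mul_congr hd hdx (h₁.trans hlx) rfl, h.mul_congr hd hdy (h₂.trans hly) rfl⟩
  · exact ⟨h.mul_congr hd hdy (h₂.trans hlx) rfl, h.mul_congr hd hdx (h₁.trans hly) rfl⟩
  · exact absurd (h₁.trans h₂.symm) hll

lemma exists_mul_mem_left {c₀ u₀ b : M} (hc : c₀ ∈ J) (hu : u₀ ∈ J) (hcu : c₀ * u₀ ∈ J)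
    (hb : b ∈ J) : ∃ c ∈ J, c * b ∈ J := by
  obtain ⟨p, q, rfl⟩ := h.div _ hb _ hu
  have h₁ : c₀ * p * b ∈ J :=
    h.mem_of_mid' (r := 1) (s := q) hb (by simpa [mul_assoc] using hcu)
  exact ⟨c₀ * p, h.mem_of_mul_right hc h₁, h₁⟩

lemma exists_mul_mem_right {c₀ u₀ b : M} (hc : c₀ ∈ J) (hu : u₀ ∈ J) (hcu : c₀ * u₀ ∈ J)
    (hb : b ∈ J) : ∃ c ∈ J, b * c ∈ J := by
  obtain ⟨p, q, rfl⟩ := h.div _ hb _ hc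
  have h₁ : b * (q * u₀) ∈ J :=
    h.mem_of_mid (r := p) (s := 1) hb (by simpa [mul_assoc] using hcu)
  exact ⟨q * u₀, h.mem_of_mul_left hu h₁, h₁⟩

/-- A `𝒥`-class whose principal factor is not nilpotent is a subsemigroup with at least two
`ℋ`-classes. -/
lemma mul_mem_of_sep [Finite M] {A : Set M} {u v : M} (hs : Sep J A u v) (huA : u ∈ A)
    (hA : ∀ w ∈ A, ∀ a ∈ J, ∀ b ∈ J, a * w * b ∈ J → w = 1 ∨ w ∈ J) :
    ¬ (rm u = rm v ∧ lm u = lm v) ∧ ∀ a ∈ J, ∀ b ∈ J, a * b ∈ J := by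
  have hne : ¬ (rm u = rm v ∧ lm u = lm v) := by
    obtain ⟨P, hP, hP'⟩ := hs
    rintro ⟨hr, hl⟩
    refine h.not_sep_of_eq hr hl ⟨P, hP, fun a b hab => ?_⟩
    obtain ⟨h₁, h₂, h₃, w, -, h₄⟩ := hP' a b hab
    exact ⟨h₁, h₂, h₃, w, trivial, h₄⟩
  refine ⟨hne, ?_⟩
  obtain ⟨⟨c, -, hc, hcu, hcv⟩, c', -, hc', huc, hvc⟩ := h.exists_of_sep hs huA hA
  obtain ⟨P, hP, hP'⟩ := hs
  obtain ⟨hu, hv, -⟩ := hP' _ _ hP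
  intro a ha b hb
  obtain ⟨k, hk, hak⟩ := h.exists_mul_mem_right hc hu hcu ha
  obtain ⟨l, hl, hlb⟩ := h.exists_mul_mem_left hc hu hcu hb
  by_cases hr : rm u = rm v
  · have hl' : lm u ≠ lm v := fun h' => hne ⟨hr, h'⟩
    have key : ∀ d ∈ J, u * d ∈ J := fun d hd => by
      obtain ⟨k, hk, hkd⟩ := h.exists_mul_mem_left hc hu hcu hd
      exact (h.mul_mem_of_lm_ne hu hv hc' hd huc hvc hl' hk hkd).1
    by_cases hua : lm u = lm a
    · exact h.mul_congr hb (key b hb) hua rfl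
    · exact (h.mul_mem_of_lm_ne hu ha hk hb (key k hk) hak hua hl hlb).2
  · have key : ∀ d ∈ J, d * u ∈ J := fun d hd => by
      obtain ⟨k, hk, hkd⟩ := h.exists_mul_mem_right hc hu hcu hd
      exact (h.mul_mem_of_rm_ne hu hv hc hd hcu hcv hr hk hkd).1
    by_cases hub : rm u = rm b
    · exact h.mul_congr hb (key a ha) rfl hub
    · exact (h.mul_mem_of_rm_ne hu hb hl ha (key l hl) hlb hub hk hak).2

lemma mul_mem_of_stab (hc : ∀ a ∈ J, ∀ b ∈ J, a * b ∈ J) {s a b : M}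
    (hsa : s * a ∈ J) (hb : b ∈ J) : s * b ∈ J ∧ b * s ∈ J := by
  have hr : ∀ b ∈ J, b * s ∈ J := fun b hb =>
    h.mem_of_mul_right (t := a) hb (by rw [mul_assoc]; exact hc b hb _ hsa)
  refine ⟨?_, hr b hb⟩
  exact h.mem_of_mul_left (t := b) hb (by rw [← mul_assoc]; exact hc _ (hr b hb) b hb)

lemma rm_eq_of_fixed [Finite M] (hc : ∀ a ∈ J, ∀ b ∈ J, a * b ∈ J) {s a b : M} (hs : s ∈ N)
    (ha : a ∈ J) (hsa : s * a ∈ J) (hr : rm (s * a) = rm a) (hl : lm (a * s) = lm a)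
    (hb : b ∈ J) : rm (s * b) = rm a ∧ lm (b * s) = lm a := by
  by_contra hne
  have hst : ∀ b ∈ J, s * b ∈ J ∧ b * s ∈ J := fun b hb => h.mul_mem_of_stab hc hsa hb
  have hsep : Sep Set.univ Set.univ s a := by
    refine ⟨insert (s, a) {p | p.1 ∈ J ∧ p.2 ∈ J ∧ ¬ (rm p.1 = rm p.2 ∧ lm p.1 = lm p.2)},
      Set.mem_insert _ _, ?_⟩
    rintro p q (hpq | ⟨hp, hq, hpq⟩)
    · obtain ⟨rfl, rfl⟩ := Prod.mk.inj hpq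
      refine ⟨trivial, trivial, ?_, b, trivial, Or.inr ?_⟩
      · rintro rfl
        exact hne ⟨h.rm_mul ha (hc _ ha _ hb), h.lm_mul ha (hc _ hb _ ha)⟩
      · have h₁ : p * b * q ∈ J := hc _ (hst b hb).1 _ ha
        have h₂ : q * b * p ∈ J := (hst _ (hc q ha b hb)).2
        refine ⟨h₁, h₂, fun h' => hne ?_⟩
        dsimp only at h'
        have e₁ := h.rm_mul (hst b hb).1 h₁
        have e₂ := h.lm_mul ha h₁
        have h₃ : q * (b * p) ∈ J := by rwa [mul_assoc] at h₂
        have e₃ : rm (q * b * p) = rm q := by rw [mul_assoc]; exact h.rm_mul ha h₃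
        have e₄ : lm (q * b * p) = lm (b * p) := by
          rw [mul_assoc]; exact h.lm_mul (hst b hb).2 h₃
        exact ⟨e₁.symm.trans (h'.1.trans e₃), (e₂.symm.trans (h'.2.trans e₄)).symm⟩
    · refine ⟨trivial, trivial, ?_, 1, trivial, Or.inr ?_⟩
      · rintro rfl
        exact hpq ⟨rfl, rfl⟩
      · simp only [mul_one] at *
        have h₁ := hc p hp q hq
        have h₂ := hc q hq p hp
        refine ⟨h₁, h₂, fun h' => hpq ?_⟩
        dsimp only at h'
        rw [h.rm_mul hp h₁, h.rm_mul hq h₂, h.lm_mul hp h₂, h.lm_mul hq h₁] at h'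
        exact ⟨h'.1, h'.2.symm⟩
  obtain ⟨x', hx', y', hy', P, hP, hP'⟩ := h.sep s hs a (h.sub ha) hsep
  set H : Set M := {g | g ∈ J ∧ rm g = rm a ∧ lm g = lm a} with hH
  have hsH : ∀ g ∈ H, s * g ∈ H := fun g hg =>
    ⟨(hst g hg.1).1, (rm_mul_left s hg.2.1).trans hr, (h.lm_mul hg.1 (hst g hg.1).1).trans hg.2.2⟩
  have hHs : ∀ g ∈ H, g * s ∈ H := fun g hg =>
    ⟨(hst g hg.1).2, (h.rm_mul hg.1 (hst g hg.1).2).trans hg.2.1, (lm_mul_right s hg.2.2).trans hl⟩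
  have hpH : ∀ k : ℕ, ∀ g ∈ H, s ^ k * g ∈ H := by
    intro k
    induction k with
    | zero => simp
    | succ k ih => intro g hg; rw [pow_succ, mul_assoc]; exact ih _ (hsH g hg)
  have hHp : ∀ k : ℕ, ∀ g ∈ H, g * s ^ k ∈ H := by
    intro k
    induction k with
    | zero => simp
    | succ k ih => intro g hg; rw [pow_succ, ← mul_assoc]; exact hHs _ (ih g hg)
  have hHH : ∀ g ∈ H, ∀ g' ∈ H, g * g' ∈ H := fun g hg g' hg' =>
    have hm := hc g hg.1 g' hg'.1
    ⟨hm, (h.rm_mul hg.1 hm).trans hg.2.1, (h.lm_mul hg'.1 hm).trans hg'.2.2⟩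
  have hcl : ∀ g ∈ Submonoid.closure {s, a}, (∃ k : ℕ, g = s ^ k) ∨ g ∈ H := by
    intro g hg
    induction hg using Submonoid.closure_induction with
    | mem z hz =>
      rcases hz with rfl | hz
      · exact Or.inl ⟨1, (pow_one _).symm⟩
      · rw [Set.mem_singleton_iff] at hz
        subst hz
        exact Or.inr ⟨ha, rfl, rfl⟩
    | one => exact Or.inl ⟨0, (pow_zero _).symm⟩
    | mul g g' _ _ hg hg' =>
      rcases hg with ⟨k, rfl⟩ | hg <;> rcases hg' with ⟨k', rfl⟩ | hg'
      · exact Or.inl ⟨k + k', (pow_add _ _ _).symm⟩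
      · exact Or.inr (hpH k _ hg')
      · exact Or.inr (hHp k' _ hg)
      · exact Or.inr (hHH _ hg _ hg')
  have hnH : ∀ p q, (p, q) ∈ P → p ∈ H → q ∈ H → False := by
    intro p q hpq hp hq
    refine h.not_sep_of_eq (hp.2.1.trans hq.2.1.symm) (hp.2.2.trans hq.2.2.symm)
      ⟨P ∩ H ×ˢ H, ⟨hpq, hp, hq⟩, ?_⟩
    rintro p q ⟨hpq, hp, hq⟩
    obtain ⟨-, -, hne, w, hw, hnext⟩ := hP' _ _ hpq
    refine ⟨hp.1, hq.1, hne, w, trivial, hnext, ?_, ?_⟩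
    · rcases hcl w hw with ⟨k, rfl⟩ | hw
      · exact hHH _ (hHp k _ hp) _ hq
      · exact hHH _ (hHH _ hp _ hw) _ hq
    · rcases hcl w hw with ⟨k, rfl⟩ | hw
      · exact hHH _ (hHp k _ hq) _ hp
      · exact hHH _ (hHH _ hq _ hw) _ hp
  obtain ⟨-, -, -, w, hw, hnext⟩ := hP' _ _ hP
  have hne' := (hP' _ _ hnext).2.2.1
  rcases hcl x' hx' with ⟨i, rfl⟩ | hx <;> rcases hcl y' hy' with ⟨j, rfl⟩ | hy <;>
    rcases hcl w hw with ⟨k, rfl⟩ | hw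
  · apply hne'
    simp only [← pow_add]
    congr 1
    omega
  · exact hnH _ _ hnext (hHp _ _ (hpH _ _ hw)) (hHp _ _ (hpH _ _ hw))
  · exact hnH _ _ hnext (by rw [mul_assoc]; exact hpH _ _ (hpH _ _ hy)) (hHp _ _ (hHp _ _ hy))
  · exact hnH _ _ hnext (hHH _ (hpH _ _ hw) _ hy) (hHp _ _ (hHH _ hy _ hw))
  · exact hnH _ _ hnext (hHp _ _ (hHp _ _ hx)) (by rw [mul_assoc]; exact hpH _ _ (hpH _ _ hx))
  · exact hnH _ _ hnext (hHp _ _ (hHH _ hx _ hw)) (hHH _ (hpH _ _ hw) _ hx)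
  · exact hnH _ _ hnext (hHH _ (hHp _ _ hx) _ hy) (hHH _ (hHp _ _ hy) _ hx)
  · exact hnH _ _ hnext (hHH _ (hHH _ hx _ hw) _ hy) (hHH _ (hHH _ hy _ hw) _ hx)

/-- Elements stabilizing `J` act on the `ℛ`- and `ℒ`-classes of `J` by constant maps. -/
lemma rm_eq_rm_of_stab [Finite M] (hc : ∀ a ∈ J, ∀ b ∈ J, a * b ∈ J) {s a b b' : M} (hs : s ∈ N)
    (ha : a ∈ J) (hsa : s * a ∈ J) (hb : b ∈ J) (hb' : b' ∈ J) :
    rm (s * b) = rm (s * b') ∧ lm (b * s) = lm (b' * s) := by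
  have hst : ∀ b ∈ J, s * b ∈ J ∧ b * s ∈ J := fun b hb => h.mul_mem_of_stab hc hsa hb
  have hpow : ∀ k : ℕ, ∀ b ∈ J, s ^ k * b ∈ J ∧ b * s ^ k ∈ J := by
    intro k
    induction k with
    | zero => simp
    | succ k ih =>
      intro b hb
      exact ⟨by rw [pow_succ, mul_assoc]; exact (ih _ (hst b hb).1).1,
        by rw [pow_succ, ← mul_assoc]; exact (hst _ (ih b hb).2).2⟩
  have hN : ∀ k : ℕ, s ^ (k + 1) ∈ N := by
    intro k
    induction k with
    | zero => simpa using hs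
    | succ k ih => rw [pow_succ]; exact h.mul_mem _ ih _ hs
  obtain ⟨i, d, hd, hid⟩ := exists_pow_eq_pow_add s
  obtain ⟨e, rfl⟩ : ∃ e, d = e + 1 := ⟨d - 1, by omega⟩
  set f := s ^ i * a * s ^ i with hf
  have hfJ : f ∈ J := (hpow i _ (hpow i a ha).1).2
  have hdf : s ^ (e + 1) * f = f := by
    rw [hf, ← mul_assoc, ← mul_assoc, ← pow_add, add_comm (e + 1), hid]
  have hfd : f * s ^ (e + 1) = f := by
    rw [hf, mul_assoc (s ^ i * a), ← pow_add, hid]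
  have key : ∀ b ∈ J, rm (s ^ (e + 1) * b) = rm f ∧ lm (b * s ^ (e + 1)) = lm f := fun b hb =>
    h.rm_eq_of_fixed hc (hN e) hfJ (by rwa [hdf]) (by rw [hdf]) (by rw [hfd]) hb
  have h₁ : rm (s * f) = rm f := by
    have := (key _ (hst f hfJ).1).1
    rwa [← mul_assoc, ← pow_succ, pow_succ', mul_assoc, hdf] at this
  have h₂ : lm (f * s) = lm f := by
    have := (key _ (hst f hfJ).2).2
    rwa [mul_assoc, ← pow_succ', pow_succ, ← mul_assoc, hfd] at this
  have key' : ∀ b ∈ J, rm (s * b) = rm f ∧ lm (b * s) = lm f := fun b hb =>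
    h.rm_eq_of_fixed hc hs hfJ (hst f hfJ).1 h₁ h₂ hb
  exact ⟨(key' b hb).1.trans (key' b' hb').1.symm, (key' b hb).2.trans (key' b' hb').2.symm⟩

end Ctx

end Monoid

section Transport

variable {M : Type*} [Monoid M]

lemma Sep.mono {J A J' A' : Set M} {x y : M} (h : Sep J A x y) (hJ : J ⊆ J') (hA : A ⊆ A') :
    Sep J' A' x y := by
  obtain ⟨P, hP, hP'⟩ := h
  refine ⟨P, hP, fun a b hab => ?_⟩
  obtain ⟨h₁, h₂, h₃, w, hw, h₄⟩ := hP' a b hab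
  exact ⟨hJ h₁, hJ h₂, h₃, w, hA hw, h₄⟩

instance [Finite S] : Finite (WithOne S) := inferInstanceAs (Finite (Option S))

/-- An optional parameter read as an element of the monoid `S¹`. -/
def toOne (w : Option S) : WithOne S := w

/-- The image of a subset of `S` in `S¹`. -/
def up (A : Set S) : Set (WithOne S) := {a | ∃ b ∈ A, (b : WithOne S) = a}

/-- The subset `A¹` of `S¹`. -/
def upOne (A : Set S) : Set (WithOne S) := insert 1 (up A)

omit [Semigroup S] in
lemma coe_mem_up {A : Set S} {a : S} : (a : WithOne S) ∈ up A ↔ a ∈ A := by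
  constructor
  · rintro ⟨b, hb, h⟩
    rwa [← WithOne.coe_inj.1 h]
  · exact fun h => ⟨a, h, rfl⟩

omit [Semigroup S] in
lemma up_mono {A B : Set S} (h : A ⊆ B) : up A ⊆ up B := by
  rintro _ ⟨a, ha, rfl⟩
  exact ⟨a, h ha, rfl⟩

omit [Semigroup S] in
lemma upOne_univ : upOne (Set.univ : Set S) = Set.univ := by
  refine Set.eq_univ_of_forall fun a => ?_
  induction a using WithOne.recOneCoe with
  | one => exact Or.inl rfl
  | coe a => exact Or.inr ⟨a, trivial, rfl⟩

omit [Semigroup S] in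
lemma mem_upOne_iff {A : Set S} {w : Option S} : toOne w ∈ upOne A ↔ ∀ c, w = some c → c ∈ A := by
  cases w with
  | none => exact ⟨fun _ c hc => by simp at hc, fun _ => Or.inl rfl⟩
  | some d =>
    constructor
    · rintro (h | ⟨b, hb, h⟩) c hc
      · exact absurd h WithOne.coe_ne_one
      · obtain rfl : d = c := by simpa using hc
        obtain rfl : b = d := WithOne.coe_inj.1 h
        exact hb
    · exact fun h => Or.inr ⟨d, h d rfl, rfl⟩

lemma coe_mulW (a b : S) (w : Option S) :
    ((mulW a w b : S) : WithOne S) = (a : WithOne S) * toOne w * b := by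
  cases w with
  | none => exact (congrArg (· * (b : WithOne S)) (mul_one (a : WithOne S))).symm
  | some c => rfl

omit [Semigroup S] in
lemma toOne_surjective (w : WithOne S) : ∃ v : Option S, toOne v = w := ⟨w, rfl⟩

lemma exists_malcev_of_sep {J A : Set S} {x y : S} (h : Sep (up J) (upOne A) (x : WithOne S) y) :
    ∃ w : ℕ → Option S, (∀ k c, w k = some c → c ∈ A) ∧ ∀ n, (malcev x y w n).1 ∈ J ∧
      (malcev x y w n).2 ∈ J ∧ (malcev x y w n).1 ≠ (malcev x y w n).2 := by
  obtain ⟨P, hP, hP'⟩ := h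
  have step : ∀ p : S × S, ((p.1 : WithOne S), (p.2 : WithOne S)) ∈ P → ∃ w : Option S,
      (∀ c, w = some c → c ∈ A) ∧
      (((mulW p.1 w p.2 : S) : WithOne S), ((mulW p.2 w p.1 : S) : WithOne S)) ∈ P := by
    intro p hp
    obtain ⟨-, -, -, w, hw, hn⟩ := hP' _ _ hp
    obtain ⟨w, rfl⟩ := toOne_surjective w
    exact ⟨w, mem_upOne_iff.1 hw, by rw [coe_mulW, coe_mulW]; exact hn⟩
  choose! f hfA hf using step
  let s : ℕ → S × S := fun n => Nat.rec (x, y) (fun _ p => (mulW p.1 (f p) p.2, mulW p.2 (f p) p.1)) n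
  have hs : ∀ n, (((s n).1 : WithOne S), ((s n).2 : WithOne S)) ∈ P := by
    intro n
    induction n with
    | zero => exact hP
    | succ n ih => exact hf _ ih
  have hm : ∀ n, malcev x y (fun k => f (s k)) n = s n := by
    intro n
    induction n with
    | zero => rfl
    | succ n ih => rw [malcev, ih]
  refine ⟨fun k => f (s k), fun k c hc => hfA _ (hs k) c hc, fun n => ?_⟩
  rw [hm]
  obtain ⟨h₁, h₂, h₃, -⟩ := hP' _ _ (hs n)
  exact ⟨coe_mem_up.1 h₁, coe_mem_up.1 h₂, fun h => h₃ (congrArg _ h)⟩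

lemma mulW_mem {A : Set S} (hA : ∀ a ∈ A, ∀ b ∈ A, a * b ∈ A) {a b : S} {w : Option S}
    (ha : a ∈ A) (hb : b ∈ A) (hw : ∀ c, w = some c → c ∈ A) : mulW a w b ∈ A := by
  cases w with
  | none => exact hA _ ha _ hb
  | some c => exact hA _ (hA _ ha _ (hw c rfl)) _ hb

lemma malcev_mem {A : Set S} (hA : ∀ a ∈ A, ∀ b ∈ A, a * b ∈ A) {x y : S} {w : ℕ → Option S}
    (hx : x ∈ A) (hy : y ∈ A) (hw : ∀ k c, w k = some c → c ∈ A) (n : ℕ) :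
    (malcev x y w n).1 ∈ A ∧ (malcev x y w n).2 ∈ A := by
  induction n with
  | zero => exact ⟨hx, hy⟩
  | succ n ih => exact ⟨mulW_mem hA ih.1 ih.2 (hw n), mulW_mem hA ih.2 ih.1 (hw n)⟩

lemma mulW_mem_ideal {I : Set S} (hI : IsIdealIn Set.univ I) {a b : S} (w : Option S)
    (h : a ∈ I ∨ b ∈ I) : mulW a w b ∈ I := by
  have hI' : ∀ a b, a ∈ I ∨ b ∈ I → a * b ∈ I := by
    rintro a b (h | h)
    · exact (hI.2 a h b trivial).2
    · exact (hI.2 b h a trivial).1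
  cases w with
  | none => exact hI' a b h
  | some c => exact hI' (a * c) b (h.imp (fun h => hI' _ _ (Or.inl h)) id)

lemma closure_pair_subset {A : Set S} (hA : ∀ a ∈ A, ∀ b ∈ A, a * b ∈ A) {x y : S} (hx : x ∈ A)
    (hy : y ∈ A) : (Subsemigroup.closure ({x, y} : Set S) : Set S) ⊆ A := by
  have : Subsemigroup.closure ({x, y} : Set S) ≤ ⟨A, fun {a b} ha hb => hA a ha b hb⟩ :=
    Subsemigroup.closure_le.2 (by rintro z (rfl | rfl) <;> assumption)
  exact this

lemma closure_mul_mem (B : Set S) : ∀ a ∈ (Subsemigroup.closure B : Set S),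
    ∀ b ∈ (Subsemigroup.closure B : Set S), a * b ∈ (Subsemigroup.closure B : Set S) :=
  fun _ ha _ hb => mul_mem ha hb

lemma ideal_mul_mem {I : Set S} (hI : IsIdealIn Set.univ I) : ∀ a ∈ I, ∀ b ∈ I, a * b ∈ I :=
  fun a ha b _ => (hI.2 a ha b trivial).2

lemma not_setMNMod_of_sep [Finite S] (hPN : IsPN S) {I : Set S} (hI : IsIdealIn Set.univ I) {x y : S}
    (h : Sep (up Iᶜ) Set.univ (x : WithOne S) y) :
    ¬ SetMNMod I (Subsemigroup.closure ({x, y} : Set S) : Set S) := by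
  rw [← upOne_univ] at h
  obtain ⟨w, -, hw⟩ := exists_malcev_of_sep h
  obtain ⟨t, m, htm, heq⟩ : ∃ t m, t < m ∧ malcev x y w t = malcev x y w m := by
    obtain ⟨t, m, hne, h⟩ := Finite.exists_ne_map_eq_of_infinite (malcev x y w)
    rcases lt_or_gt_of_ne hne with hlt | hlt
    · exact ⟨t, m, hlt, h⟩
    · exact ⟨m, t, hlt, h.symm⟩
  set T := Subsemigroup.closure (genSet x y w m) with hT
  have key := hPN x y w m (I ∩ T) ⟨Set.inter_subset_right, fun a ha t ht =>
    ⟨⟨(hI.2 a ha.1 t trivial).1, mul_mem ht ha.2⟩, ⟨(hI.2 a ha.1 t trivial).2, mul_mem ha.2 ht⟩⟩⟩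
    (fun h => (hw m).1 h.1) (fun h => (hw m).2.1 h.1) ⟨t, htm, (hw t).2.2, heq⟩ 0 (Nat.zero_le _)
  rintro ⟨n, hn, hmn⟩
  refine key ⟨n, hn, fun a ha b hb v hv => ?_⟩
  have hsub : (Subsemigroup.closure ({x, y} : Set S) : Set S) ⊆ T :=
    Subsemigroup.closure_mono Set.subset_union_left
  have hmem := malcev_mem (closure_mul_mem _) ha hb hv n
  rcases hmn a ha b hb v hv with h' | ⟨h₁, h₂⟩
  · exact Or.inl h'
  · exact Or.inr ⟨⟨h₁, hsub hmem.1⟩, h₂, hsub hmem.2⟩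

lemma exists_sep_of_not_setMNMod [Finite S] {I A : Set S} (hI : IsIdealIn Set.univ I)
    (hA : ∀ a ∈ A, ∀ b ∈ A, a * b ∈ A) (h : ¬ SetMNMod I A) :
    ∃ x ∈ A, ∃ y ∈ A, Sep (up (A \ I)) (upOne A) (x : WithOne S) y := by
  obtain ⟨x, hx, y, hy, w, hw, hne⟩ : ∃ x ∈ A, ∃ y ∈ A, ∃ w : ℕ → Option S,
      (∀ k c, w k = some c → c ∈ A) ∧
      ¬ ReesEq I (malcev x y w (Nat.card (S × S) + 1)).1 (malcev x y w (Nat.card (S × S) + 1)).2 := by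
    by_contra hcon
    push Not at hcon
    exact h ⟨_, Nat.succ_pos _, hcon⟩
  set n := Nat.card (S × S) + 1 with hn
  have hback : ∀ k, ¬ ReesEq I (malcev x y w (k + 1)).1 (malcev x y w (k + 1)).2 →
      ¬ ReesEq I (malcev x y w k).1 (malcev x y w k).2 := by
    intro k hk h'
    apply hk
    simp only [malcev]
    rcases h' with h' | ⟨h₁, h₂⟩
    · rw [h']; exact Or.inl rfl
    · exact Or.inr ⟨mulW_mem_ideal hI _ (Or.inl h₁), mulW_mem_ideal hI _ (Or.inl h₂)⟩
  have hall : ∀ k ≤ n, ¬ ReesEq I (malcev x y w k).1 (malcev x y w k).2 := by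
    intro k hk
    induction hk using Nat.decreasingInduction with
    | of_succ k _ ih => exact hback k ih
    | self => exact hne
  obtain ⟨t, t', htt, ht', heq⟩ : ∃ t t', t < t' ∧ t' ≤ n ∧ malcev x y w t = malcev x y w t' := by
    by_contra hcon
    push Not at hcon
    have hinj : Function.Injective (fun k : Fin (n + 1) => malcev x y w k) := by
      intro i j hij
      by_contra hne
      rcases lt_or_gt_of_ne hne with hlt | hlt
      · exact hcon i j hlt (by omega) hij
      · exact hcon j i hlt (by omega) hij.symm
    have := Nat.card_le_card_of_injective _ hinj
    rw [Nat.card_fin] at this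
    omega
  have hout : ∀ k < t', (malcev x y w k).1 ∉ I ∧ (malcev x y w k).2 ∉ I := by
    intro k hk
    have := hall (k + 1) (by omega)
    constructor <;> intro hin <;> apply this <;> right
    · exact ⟨mulW_mem_ideal hI _ (Or.inl hin), mulW_mem_ideal hI _ (Or.inr hin)⟩
    · exact ⟨mulW_mem_ideal hI _ (Or.inr hin), mulW_mem_ideal hI _ (Or.inl hin)⟩
  have hmem := malcev_mem hA hx hy hw
  refine ⟨_, (hmem t).1, _, (hmem t).2, {p | ∃ k, t ≤ k ∧ k < t' ∧
    p = (((malcev x y w k).1 : WithOne S), ((malcev x y w k).2 : WithOne S))},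
    ⟨t, le_rfl, htt, rfl⟩, ?_⟩
  rintro _ _ ⟨k, htk, hkt, hp⟩
  obtain ⟨rfl, rfl⟩ := Prod.mk.inj hp
  refine ⟨coe_mem_up.2 ⟨(hmem k).1, (hout k hkt).1⟩, coe_mem_up.2 ⟨(hmem k).2, (hout k hkt).2⟩,
    fun h' => hall k (by omega) (Or.inl (WithOne.coe_inj.1 h')), toOne (w k),
    mem_upOne_iff.2 (hw k), ?_⟩
  rw [← coe_mulW, ← coe_mulW]
  rcases Nat.lt_or_ge (k + 1) t' with hlt | hge
  · exact ⟨k + 1, by omega, hlt, rfl⟩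
  · obtain rfl : k + 1 = t' := by omega
    refine ⟨t, le_rfl, htt, ?_⟩
    rw [heq]
    rfl

lemma upOne_closure_subset (x y : S) : upOne (Subsemigroup.closure ({x, y} : Set S) : Set S) ⊆
    Submonoid.closure {(x : WithOne S), (y : WithOne S)} := by
  rintro _ (rfl | ⟨a, ha, rfl⟩)
  · exact one_mem _
  · change a ∈ Subsemigroup.closure ({x, y} : Set S) at ha
    induction ha using Subsemigroup.closure_induction with
    | mem z hz =>
      apply Submonoid.subset_closure
      rcases hz with rfl | hz
      · exact Or.inl rfl
      · rw [Set.mem_singleton_iff] at hz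
        subst hz
        exact Or.inr rfl
    | mul a b _ _ ha hb => exact mul_mem ha hb

lemma coe_mem_closure {x y a : S} (ha : a ∈ (Subsemigroup.closure ({x, y} : Set S) : Set S)) :
    (a : WithOne S) ∈ Submonoid.closure {(x : WithOne S), (y : WithOne S)} :=
  upOne_closure_subset x y (Or.inr ⟨a, ha, rfl⟩)

lemma setMNMod_mono {I A B : Set S} (h : SetMNMod I A) (hB : B ⊆ A) : SetMNMod I B := by
  obtain ⟨n, hn, h⟩ := h
  exact ⟨n, hn, fun x hx y hy w hw => h x (hB hx) y (hB hy) w fun k c hc => hB (hw k c hc)⟩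

lemma setMNMod_empty {A : Set S} : SetMNMod ∅ A ↔ SetMN A := by
  simp [SetMNMod, SetMN, ReesEq]

lemma isIdealIn_empty : IsIdealIn Set.univ (∅ : Set S) := ⟨Set.empty_subset _, by simp⟩

lemma Sep.up_univ {A : Set (WithOne S)} {x y : S} (h : Sep Set.univ A (x : WithOne S) y) :
    Sep (up (∅ : Set S)ᶜ) A (x : WithOne S) y := by
  obtain ⟨P, hP, hP'⟩ := h
  refine ⟨{p | p ∈ P ∧ ∃ a b : S, p = ((a : WithOne S), (b : WithOne S))}, ⟨hP, x, y, rfl⟩, ?_⟩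
  rintro _ _ ⟨hp, a, b, hab⟩
  obtain ⟨rfl, rfl⟩ := Prod.mk.inj hab
  obtain ⟨-, -, h₃, w, hw, h₄⟩ := hP' _ _ hp
  refine ⟨coe_mem_up.2 (by simp), coe_mem_up.2 (by simp), h₃, w, hw, h₄, ?_⟩
  obtain ⟨v, rfl⟩ := toOne_surjective w
  exact ⟨_, _, by rw [← coe_mulW, ← coe_mulW]⟩

lemma nedge_of_sep [Finite S] (hPN : IsPN S) {x y : S} (h : Sep Set.univ Set.univ (x : WithOne S) y) :
    NEdge x y := by
  have hne : (x : WithOne S) ≠ y := by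
    obtain ⟨P, hP, hP'⟩ := h
    exact (hP' _ _ hP).2.2.1
  refine ⟨fun h' => hne (congrArg _ h'), ?_⟩
  rw [← setMNMod_empty]
  exact not_setMNMod_of_sep hPN isIdealIn_empty h.up_univ

lemma exists_mul_mul_mem {I : Set S} (hI : IsIdealIn Set.univ I) {a : S} (ha : a ∈ I)
    (p q : WithOne S) : ∃ b ∈ I, (b : WithOne S) = p * a * q := by
  have h₁ : ∃ b ∈ I, (b : WithOne S) = p * a := by
    induction p using WithOne.recOneCoe with
    | one => exact ⟨a, ha, (one_mul _).symm⟩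
    | coe p => exact ⟨p * a, (hI.2 a ha p trivial).1, rfl⟩
  obtain ⟨b, hb, hb'⟩ := h₁
  rw [← hb']
  induction q using WithOne.recOneCoe with
  | one => exact ⟨b, hb, (mul_one _).symm⟩
  | coe q => exact ⟨b * q, (hI.2 b hb q trivial).2, rfl⟩

lemma ctx_of_maximal [Finite S] (hPN : IsPN S) {I C : Set S} (hI : IsIdealIn Set.univ I)
    (hC : IsIdealIn Set.univ C) (hIC : I ⊆ C)
    (hmax : ∀ D : Set S, IsIdealIn Set.univ D → I ⊆ D → D ⊆ C → D = I ∨ D = C) :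
    Ctx (up Set.univ) (up (C \ I)) where
  sub := up_mono (Set.subset_univ _)
  one_notMem := by
    rintro ⟨a, -, ha⟩
    exact WithOne.coe_ne_one ha
  mul_mem := by
    rintro _ ⟨a, -, rfl⟩ _ ⟨b, -, rfl⟩
    exact ⟨a * b, trivial, rfl⟩
  div := by
    rintro _ ⟨a, ha, rfl⟩ _ ⟨b, hb, rfl⟩
    set D : Set S := {c | ∃ p q : WithOne S, (c : WithOne S) = p * a * q} ∪ I with hD
    have haD : a ∈ D := Or.inl ⟨1, 1, by simp⟩
    have hDC : D = C := by
      refine (hmax D ⟨Set.subset_univ _, ?_⟩ Set.subset_union_right ?_).resolve_left ?_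
      · rintro c (⟨p, q, hc⟩ | hc) t -
        · refine ⟨Or.inl ⟨t * p, q, ?_⟩, Or.inl ⟨p, q * t, ?_⟩⟩
          · rw [WithOne.coe_mul, hc]; simp only [mul_assoc]
          · rw [WithOne.coe_mul, hc]; simp only [mul_assoc]
        · exact ⟨Or.inr (hI.2 c hc t trivial).1, Or.inr (hI.2 c hc t trivial).2⟩
      · rintro c (⟨p, q, hc⟩ | hc)
        · obtain ⟨d, hd, hd'⟩ := exists_mul_mul_mem hC ha.1 p q
          rwa [WithOne.coe_inj.1 (hc.trans hd'.symm)]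
        · exact hIC hc
      · intro h
        rw [h] at haD
        exact ha.2 haD
    have hb' : b ∈ D := hDC ▸ hb.1
    exact hb'.resolve_right hb.2
  conv := by
    rintro _ ⟨a, ha, rfl⟩ p q r s ⟨e, he, he'⟩
    obtain ⟨d, hd, hd'⟩ := exists_mul_mul_mem hC ha.1 p q
    rw [← hd'] at he' ⊢
    refine coe_mem_up.2 ⟨hd, fun hdI => he.2 ?_⟩
    obtain ⟨f, hf, hf'⟩ := exists_mul_mul_mem hI hdI r s
    rwa [WithOne.coe_inj.1 (he'.trans hf'.symm)]
  sepJ := by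
    rintro _ ⟨x, hx, rfl⟩ _ ⟨y, hy, rfl⟩ hs
    have hn := not_setMNMod_of_sep hPN hI (hs.mono (up_mono fun a ha => ha.2) subset_rfl)
    obtain ⟨x', hx', y', hy', hs'⟩ := exists_sep_of_not_setMNMod hI (closure_mul_mem _) hn
    exact ⟨x', coe_mem_closure hx', y', coe_mem_closure hy', hs'.mono
      (up_mono fun a ha => ⟨closure_pair_subset (ideal_mul_mem hC) hx.1 hy.1 ha.1, ha.2⟩)
      (upOne_closure_subset x y)⟩
  sep := by
    rintro _ ⟨x, hx, rfl⟩ _ ⟨y, hy, rfl⟩ hs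
    have hn := not_setMNMod_of_sep hPN isIdealIn_empty hs.up_univ
    obtain ⟨x', hx', y', hy', hs'⟩ :=
      exists_sep_of_not_setMNMod isIdealIn_empty (closure_mul_mem _) hn
    exact ⟨x', coe_mem_closure hx', y', coe_mem_closure hy',
      hs'.mono (Set.subset_univ _) (upOne_closure_subset x y)⟩

end Transport

section Levels

/-- The successive differences of a principal series. -/
def lev (ps : PrincipalSeries S) (l : ℕ) : Set S := ps.C l \ ps.C (l + 1)

/-- The levels whose principal factor is not Mal'cev nilpotent. -/
def NonNil (ps : PrincipalSeries S) (l : ℕ) : Prop :=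
  1 ≤ l ∧ l ≤ ps.m ∧ ¬ SetMNMod (ps.C (l + 1)) (ps.C l)

/-- The elements acting on `lev ps l` without annihilating it. -/
def stab (ps : PrincipalSeries S) (l : ℕ) : Set S := {s | ∃ a ∈ lev ps l, s * a ∈ lev ps l}

/-- The images of `lev ps l` under the left and right actions of `s`, up to `ℛ` and `ℒ`. -/
def act (ps : PrincipalSeries S) (l : ℕ) (s : S) : Set (WithOne S) × Set (WithOne S) :=
  (⋃ b ∈ lev ps l, rm ((s * b : S) : WithOne S), ⋃ b ∈ lev ps l, lm ((b * s : S) : WithOne S))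

variable {ps : PrincipalSeries S} {l : ℕ}

lemma ideal_C {i : ℕ} (h₁ : 1 ≤ i) (h₂ : i ≤ ps.m + 1) : IsIdealIn Set.univ (ps.C i) := by
  rcases Nat.lt_or_ge i (ps.m + 1) with h | h
  · exact ps.ideal i h₁ (by omega)
  · obtain rfl : i = ps.m + 1 := by omega
    rw [ps.last]
    exact isIdealIn_empty

lemma C_anti {i j : ℕ} (h₁ : 1 ≤ i) (hij : i ≤ j) (h₂ : j ≤ ps.m + 1) : ps.C j ⊆ ps.C i := by
  induction hij with
  | refl => exact subset_rfl
  | step h ih => exact (ps.ssub _ (h₁.trans h) (by omega)).subset.trans (ih (by omega))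

lemma lev_nonempty (h₁ : 1 ≤ l) (h₂ : l ≤ ps.m) : (lev ps l).Nonempty :=
  Set.nonempty_of_ssubset (ps.ssub l h₁ h₂)

lemma exists_mem_lev (ps : PrincipalSeries S) (a : S) : ∃ l, 1 ≤ l ∧ l ≤ ps.m ∧ a ∈ lev ps l := by
  by_contra hcon
  push Not at hcon
  have : ∀ l, l ≤ ps.m → a ∈ ps.C (l + 1) := by
    intro l
    induction l with
    | zero => intro _; rw [ps.first]; trivial
    | succ l ih =>
      intro hl
      by_contra h
      exact hcon (l + 1) (by omega) hl ⟨ih (by omega), h⟩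
  have := this ps.m le_rfl
  rw [ps.last] at this
  exact this

lemma lev_unique {i j : ℕ} {a : S} (hi : 1 ≤ i) (hi' : i ≤ ps.m) (hj : 1 ≤ j) (hj' : j ≤ ps.m)
    (hai : a ∈ lev ps i) (haj : a ∈ lev ps j) : i = j := by
  rcases lt_trichotomy i j with h | h | h
  · exact absurd (C_anti (by omega) h (by omega) haj.1) hai.2
  · exact h
  · exact absurd (C_anti (by omega) h (by omega) hai.1) haj.2

variable [Finite S] (hPN : IsPN S)

include hPN

lemma ctx_lev (h₁ : 1 ≤ l) (h₂ : l ≤ ps.m) : Ctx (up Set.univ) (up (lev ps l)) :=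
  ctx_of_maximal hPN (ideal_C (by omega) (by omega)) (ps.ideal l h₁ h₂) (ps.ssub l h₁ h₂).subset
    (ps.maximal l h₁ h₂)

lemma lev_of_nonNil (hN : NonNil ps l) : (∀ a ∈ lev ps l, ∀ b ∈ lev ps l, a * b ∈ lev ps l) ∧
    ∃ u ∈ lev ps l, ∃ v ∈ lev ps l,
      ¬ (rm (u : WithOne S) = rm (v : WithOne S) ∧ lm (u : WithOne S) = lm (v : WithOne S)) := by
  obtain ⟨h₁, h₂, hN⟩ := hN
  have hI : IsIdealIn Set.univ (ps.C (l + 1)) := ideal_C (by omega) (by omega)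
  obtain ⟨u, hu, v, hv, hs⟩ :=
    exists_sep_of_not_setMNMod hI (ideal_mul_mem (ps.ideal l h₁ h₂)) hN
  have key := (ctx_lev hPN h₁ h₂).mul_mem_of_sep hs (Or.inr (coe_mem_up.2 hu)) (by
    rintro _ (rfl | ⟨w, hw, rfl⟩) _ ⟨a, ha, rfl⟩ _ ⟨b, hb, rfl⟩ hm
    · exact Or.inl rfl
    · refine Or.inr (coe_mem_up.2 ⟨hw, fun hw' => ?_⟩)
      exact (coe_mem_up.1 (show ((a * w * b : S) : WithOne S) ∈ _ from hm)).2
        (hI.2 _ (hI.2 w hw' a trivial).1 b trivial).2)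
  refine ⟨fun a ha b hb => coe_mem_up.1 (key.2 _ (coe_mem_up.2 ha) _ (coe_mem_up.2 hb)), ?_⟩
  obtain ⟨P, hP, hP'⟩ := hs
  obtain ⟨h₃, h₄, -⟩ := hP' _ _ hP
  exact ⟨u, coe_mem_up.1 h₃, v, coe_mem_up.1 h₄, key.1⟩

lemma up_lev_mul_mem (hN : NonNil ps l) :
    ∀ a ∈ up (lev ps l), ∀ b ∈ up (lev ps l), a * b ∈ up (lev ps l) := by
  rintro _ ⟨a, ha, rfl⟩ _ ⟨b, hb, rfl⟩
  exact ⟨a * b, (lev_of_nonNil hPN hN).1 a ha b hb, rfl⟩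

lemma stab_mul_mem (hN : NonNil ps l) {s b : S} (hs : s ∈ stab ps l) (hb : b ∈ lev ps l) :
    s * b ∈ lev ps l ∧ b * s ∈ lev ps l := by
  obtain ⟨a, ha, hsa⟩ := hs
  have := (ctx_lev hPN hN.1 hN.2.1).mul_mem_of_stab (s := (s : WithOne S)) (a := (a : WithOne S))
    (up_lev_mul_mem hPN hN) (coe_mem_up.2 hsa) (coe_mem_up.2 hb)
  exact ⟨coe_mem_up.1 this.1, coe_mem_up.1 this.2⟩

lemma lev_subset_stab (hN : NonNil ps l) : lev ps l ⊆ stab ps l :=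
  fun a ha => ⟨a, ha, (lev_of_nonNil hPN hN).1 a ha a ha⟩

lemma mul_mem_stab_iff (hN : NonNil ps l) {s t : S} :
    s * t ∈ stab ps l ↔ s ∈ stab ps l ∧ t ∈ stab ps l := by
  constructor
  · rintro ⟨a, ha, hm⟩
    have hm' : (s : WithOne S) * ((t : WithOne S) * (a : WithOne S)) ∈ up (lev ps l) := by
      rw [← mul_assoc]
      exact coe_mem_up.2 hm
    have := (ctx_lev hPN hN.1 hN.2.1).mem_of_mul_left (coe_mem_up.2 ha) hm'
    exact ⟨⟨t * a, coe_mem_up.1 this, by rwa [← mul_assoc]⟩, a, ha, coe_mem_up.1 this⟩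
  · rintro ⟨hs, ht⟩
    obtain ⟨b, hb⟩ := lev_nonempty hN.1 hN.2.1
    exact ⟨b, hb, by
      rw [mul_assoc]; exact (stab_mul_mem hPN hN hs (stab_mul_mem hPN hN ht hb).1).1⟩

omit hPN [Finite S] in
lemma notMem_of_mem_stab (hN : NonNil ps l) {s : S} (hs : s ∈ stab ps l) : s ∉ ps.C (l + 1) := by
  obtain ⟨a, ha, hm⟩ := hs
  have := hN.1
  have := hN.2.1
  exact fun hs => hm.2 ((ideal_C (by omega) (by omega)).2 s hs a trivial).2

lemma mem_FsetQ_iff (hN : NonNil ps l) {s : S} : s ∈ FsetQ ps l ↔ s ∈ stab ps l ∧ s ∉ ps.C l := by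
  have h₁ := hN.1
  have h₂ := hN.2.1
  have hC := ps.ideal l h₁ h₂
  have hI : IsIdealIn Set.univ (ps.C (l + 1)) := ideal_C (by omega) (by omega)
  constructor
  · rintro ⟨hs, a, ha, h⟩
    refine ⟨?_, hs⟩
    rcases h with h | h
    · exact ⟨a, ⟨ha, fun ha' => h (hI.2 a ha' s trivial).1⟩, (hC.2 a ha s trivial).1, h⟩
    · have ha' : a ∈ lev ps l := ⟨ha, fun ha' => h (hI.2 a ha' s trivial).2⟩
      refine ⟨a, ha', ?_⟩
      have hm : a * s * a ∈ lev ps l :=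
        (lev_of_nonNil hPN hN).1 _ ⟨(hC.2 a ha s trivial).2, h⟩ _ ha'
      refine coe_mem_up.1 ((ctx_lev hPN h₁ h₂).mem_of_mul_left (a := (a : WithOne S))
        (s := (s : WithOne S)) (t := (a : WithOne S)) (coe_mem_up.2 ha') ?_)
      rw [← mul_assoc]
      exact coe_mem_up.2 hm
  · rintro ⟨⟨a, ha, hm⟩, hs⟩
    exact ⟨hs, a, ha.1, Or.inl hm.2⟩

lemma Stem_eq_stab (hN : NonNil ps l) : Stem ps l = stab ps l := by
  ext s
  constructor
  · rintro (h | h)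
    · exact ((mem_FsetQ_iff hPN hN).1 h).1
    · exact lev_subset_stab hPN hN h
  · intro h
    by_cases hs : s ∈ ps.C l
    · exact Or.inr ⟨hs, notMem_of_mem_stab hN h⟩
    · exact Or.inl ((mem_FsetQ_iff hPN hN).2 ⟨h, hs⟩)

lemma act_eq (hN : NonNil ps l) {s b : S} (hs : s ∈ stab ps l) (hb : b ∈ lev ps l) :
    act ps l s = (rm ((s * b : S) : WithOne S), lm ((b * s : S) : WithOne S)) := by
  have key : ∀ b' ∈ lev ps l, rm ((s * b' : S) : WithOne S) = rm ((s * b : S) : WithOne S) ∧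
      lm ((b' * s : S) : WithOne S) = lm ((b * s : S) : WithOne S) := by
    intro b' hb'
    obtain ⟨a, ha, hsa⟩ := hs
    exact (ctx_lev hPN hN.1 hN.2.1).rm_eq_rm_of_stab (s := (s : WithOne S)) (a := (a : WithOne S))
      (up_lev_mul_mem hPN hN) (coe_mem_up.2 trivial) (coe_mem_up.2 ha) (coe_mem_up.2 hsa)
      (coe_mem_up.2 hb') (coe_mem_up.2 hb)
  refine Prod.ext ?_ ?_
  · refine Set.Subset.antisymm (Set.iUnion₂_subset fun b' hb' => ?_) ?_
    · rw [(key b' hb').1]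
    · exact Set.subset_biUnion_of_mem (u := fun b => rm ((s * b : S) : WithOne S)) hb
  · refine Set.Subset.antisymm (Set.iUnion₂_subset fun b' hb' => ?_) ?_
    · rw [(key b' hb').2]
    · exact Set.subset_biUnion_of_mem (u := fun b => lm ((b * s : S) : WithOne S)) hb

lemma act_mul (hN : NonNil ps l) {s t : S} (hs : s ∈ stab ps l) (ht : t ∈ stab ps l) :
    act ps l (s * t) = ((act ps l s).1, (act ps l t).2) := by
  obtain ⟨b, hb⟩ := lev_nonempty hN.1 hN.2.1
  rw [act_eq hPN hN ((mul_mem_stab_iff hPN hN).2 ⟨hs, ht⟩) hb,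
    act_eq hPN hN hs (stab_mul_mem hPN hN ht hb).1, act_eq hPN hN ht (stab_mul_mem hPN hN hs hb).2]
  simp only [mul_assoc]

lemma act_of_mem_lev (hN : NonNil ps l) {b : S} (hb : b ∈ lev ps l) :
    act ps l b = (rm (b : WithOne S), lm (b : WithOne S)) := by
  have hc := ctx_lev hPN hN.1 hN.2.1 (ps := ps)
  have hbb : (b : WithOne S) * b ∈ up (lev ps l) :=
    up_lev_mul_mem hPN hN _ (coe_mem_up.2 hb) _ (coe_mem_up.2 hb)
  rw [act_eq hPN hN (lev_subset_stab hPN hN hb) hb]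
  exact Prod.ext (hc.rm_mul (coe_mem_up.2 hb) hbb) (hc.lm_mul (coe_mem_up.2 hb) hbb)

lemma nedge_of_act_ne (hN : NonNil ps l) {s t : S} (hs : s ∈ stab ps l) (ht : t ∈ stab ps l)
    (hne : act ps l s ≠ act ps l t) : NEdge s t := by
  refine nedge_of_sep hPN ⟨{p | ∃ a b : S, a ∈ stab ps l ∧ b ∈ stab ps l ∧
    act ps l a ≠ act ps l b ∧ p = ((a : WithOne S), (b : WithOne S))},
    ⟨s, t, hs, ht, hne, rfl⟩, ?_⟩
  rintro _ _ ⟨a, b, ha, hb, hab, hp⟩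
  obtain ⟨rfl, rfl⟩ := Prod.mk.inj hp
  refine ⟨trivial, trivial, fun h => hab (by rw [WithOne.coe_inj.1 h]), 1, trivial,
    a * b, b * a, (mul_mem_stab_iff hPN hN).2 ⟨ha, hb⟩, (mul_mem_stab_iff hPN hN).2 ⟨hb, ha⟩,
    ?_, by simp⟩
  rw [act_mul hPN hN ha hb, act_mul hPN hN hb ha]
  intro h
  exact hab (Prod.ext (Prod.mk.inj h).1 (Prod.mk.inj h).2.symm)

lemma exists_act_ne (hN : NonNil ps l) (p : Set (WithOne S) × Set (WithOne S)) :
    ∃ b ∈ lev ps l, act ps l b ≠ p := by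
  obtain ⟨u, hu, v, hv, hne⟩ := (lev_of_nonNil hPN hN).2
  by_contra hcon
  push Not at hcon
  have := (hcon u hu).trans (hcon v hv).symm
  rw [act_of_mem_lev hPN hN hu, act_of_mem_lev hPN hN hv] at this
  exact hne (Prod.mk.inj this)

lemma mem_stab_of_sep (hN : NonNil ps l) {s t x y : S} {A : Set S}
    (hA : A = (Subsemigroup.closure ({s, t} : Set S) : Set S)) (hx : x ∈ A) (hy : y ∈ A)
    (hs : Sep (up (lev ps l)) (upOne A) (x : WithOne S) y) : s ∈ stab ps l := by
  by_contra hst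
  have hpow : ∀ g ∈ Subsemigroup.closure ({s, t} : Set S), g ∈ stab ps l →
      (g : WithOne S) ∈ Submonoid.powers (t : WithOne S) := by
    intro g hg
    induction hg using Subsemigroup.closure_induction with
    | mem z hz =>
      rcases hz with rfl | hz
      · exact fun h => absurd h hst
      · rw [Set.mem_singleton_iff] at hz
        subst hz
        exact fun _ => Submonoid.mem_powers _
    | mul a b _ _ ha hb =>
      intro h
      obtain ⟨h₁, h₂⟩ := (mul_mem_stab_iff hPN hN).1 h
      exact mul_mem (ha h₁) (hb h₂)
  subst hA
  obtain ⟨P, hP, hP'⟩ := hs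
  obtain ⟨h₁, h₂, -, w, hw, hn⟩ := hP' _ _ hP
  obtain ⟨h₃, -, hne, -⟩ := hP' _ _ hn
  have hw' : w ∈ Submonoid.powers (t : WithOne S) := by
    rcases hw with rfl | ⟨c, hc, rfl⟩
    · exact one_mem _
    · have : x * c * y ∈ stab ps l := lev_subset_stab hPN hN (coe_mem_up.1 h₃)
      exact hpow c hc ((mul_mem_stab_iff hPN hN).1 ((mul_mem_stab_iff hPN hN).1 this).1).2
  obtain ⟨i, hi⟩ := hpow x hx (lev_subset_stab hPN hN (coe_mem_up.1 h₁))
  obtain ⟨j, hj⟩ := hpow y hy (lev_subset_stab hPN hN (coe_mem_up.1 h₂))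
  obtain ⟨k, rfl⟩ := hw'
  apply hne
  rw [← hi, ← hj]
  simp only [← pow_add]
  congr 1
  omega

lemma exists_lev_of_sep {A : Set S} {x y : S}
    (hs : Sep (up A) (upOne A) (x : WithOne S) y) : ∃ l, NonNil ps l ∧ ∃ x' ∈ A, ∃ y' ∈ A,
      Sep (up (lev ps l)) (upOne A) (x' : WithOne S) y' := by
  classical
  obtain ⟨P, hP, hP'⟩ := hs
  let Q : ℕ → Prop := fun l => 1 ≤ l ∧ ∃ a b : S, ((a : WithOne S), (b : WithOne S)) ∈ P ∧ a ∈ ps.C l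
  have hm : 1 ≤ ps.m := by
    obtain ⟨i, h₁, h₂, -⟩ := exists_mem_lev ps x
    omega
  set l := Nat.findGreatest Q ps.m with hl
  have hQ : Q l := Nat.findGreatest_spec hm ⟨le_rfl, x, y, hP, by rw [ps.first]; trivial⟩
  have hlm : l ≤ ps.m := Nat.findGreatest_le _
  obtain ⟨h₁, a, b, hab, ha⟩ := hQ
  have hC := ps.ideal l h₁ hlm
  have hI : IsIdealIn Set.univ (ps.C (l + 1)) := ideal_C (by omega) (by omega)
  have hfst : ∀ a b : S, ((a : WithOne S), (b : WithOne S)) ∈ P → a ∉ ps.C (l + 1) := by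
    intro a b hab hal
    rcases Nat.lt_or_ge l ps.m with hlt | hge
    · exact Nat.findGreatest_is_greatest (P := Q) (n := ps.m) (k := l + 1) (by omega) hlt
        ⟨by omega, a, b, hab, hal⟩
    · rw [show l + 1 = ps.m + 1 by omega, ps.last] at hal
      exact hal
  have hnext : ∀ a b : S, ((a : WithOne S), (b : WithOne S)) ∈ P → ∃ w : Option S,
      toOne w ∈ upOne A ∧ ((mulW a w b : S), (mulW b w a : S)) ∈
        {p : S × S | ((p.1 : WithOne S), (p.2 : WithOne S)) ∈ P} := by
    intro a b hab
    obtain ⟨-, -, -, w, hw, hn⟩ := hP' _ _ hab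
    obtain ⟨w, rfl⟩ := toOne_surjective w
    refine ⟨w, hw, ?_⟩
    change (((mulW a w b : S) : WithOne S), ((mulW b w a : S) : WithOne S)) ∈ P
    rw [coe_mulW, coe_mulW]
    exact hn
  have hsnd : ∀ a b : S, ((a : WithOne S), (b : WithOne S)) ∈ P → b ∉ ps.C (l + 1) := by
    intro a b hab hbl
    obtain ⟨w, -, hn⟩ := hnext a b hab
    exact hfst _ _ hn (mulW_mem_ideal hI w (Or.inr hbl))
  obtain ⟨w, hw, hn⟩ := hnext a b hab
  have hs : Sep (up (lev ps l)) (upOne A) ((mulW a w b : S) : WithOne S) (mulW b w a : S) := by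
    refine ⟨{p | p ∈ P ∧ ∃ a b : S, a ∈ ps.C l ∧ b ∈ ps.C l ∧
      p = ((a : WithOne S), (b : WithOne S))}, ⟨hn, _, _, mulW_mem_ideal hC w (Or.inl ha),
      mulW_mem_ideal hC w (Or.inr ha), rfl⟩, ?_⟩
    rintro _ _ ⟨hp, a, b, ha, hb, hab⟩
    obtain ⟨rfl, rfl⟩ := Prod.mk.inj hab
    obtain ⟨w, hw, hn⟩ := hnext a b hp
    refine ⟨coe_mem_up.2 ⟨ha, hfst _ _ hp⟩, coe_mem_up.2 ⟨hb, hsnd _ _ hp⟩, (hP' _ _ hp).2.2.1,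
      toOne w, hw, ?_⟩
    rw [← coe_mulW, ← coe_mulW]
    exact ⟨hn, _, _, mulW_mem_ideal hC w (Or.inl ha), mulW_mem_ideal hC w (Or.inr ha), rfl⟩
  obtain ⟨h₂, h₃, -⟩ := hP' _ _ hn
  refine ⟨l, ⟨h₁, hlm, fun h => ?_⟩, _, coe_mem_up.1 h₂, _, coe_mem_up.1 h₃, hs⟩
  refine not_setMNMod_of_sep hPN hI (hs.mono (up_mono fun a ha => ha.2) (Set.subset_univ _))
    (setMNMod_mono h (closure_pair_subset (ideal_mul_mem hC) ?_ ?_))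
  · exact mulW_mem_ideal hC w (Or.inl ha)
  · exact mulW_mem_ideal hC w (Or.inr ha)

lemma exists_act_ne_of_nedge {s t : S} (h : NEdge s t) : ∃ l, NonNil ps l ∧ s ∈ stab ps l ∧
    t ∈ stab ps l ∧ act ps l s ≠ act ps l t := by
  have hA := closure_mul_mem ({s, t} : Set S)
  obtain ⟨x, -, y, -, hs⟩ := exists_sep_of_not_setMNMod isIdealIn_empty hA
    (fun h' => h.2 (setMNMod_empty.1 h'))
  rw [Set.sdiff_empty] at hs
  obtain ⟨l, hN, x, hx, y, hy, hs⟩ := exists_lev_of_sep hPN (ps := ps) hs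
  have h₁ := mem_stab_of_sep hPN hN rfl hx hy hs
  have h₂ := mem_stab_of_sep hPN hN (s := t) (t := s) (by rw [Set.pair_comm]) hx hy hs
  refine ⟨l, hN, h₁, h₂, fun hst => ?_⟩
  have hconst : ∀ g ∈ Subsemigroup.closure ({s, t} : Set S),
      g ∈ stab ps l ∧ act ps l g = act ps l s := by
    intro g hg
    induction hg using Subsemigroup.closure_induction with
    | mem z hz =>
      rcases hz with rfl | hz
      · exact ⟨h₁, rfl⟩
      · rw [Set.mem_singleton_iff] at hz
        subst hz
        exact ⟨h₂, hst.symm⟩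
    | mul a b _ _ ha hb =>
      exact ⟨(mul_mem_stab_iff hPN hN).2 ⟨ha.1, hb.1⟩, by rw [act_mul hPN hN ha.1 hb.1, ha.2, hb.2]⟩
  have hxy := (hconst x hx).2.trans (hconst y hy).2.symm
  obtain ⟨P, hP, hP'⟩ := id hs
  obtain ⟨h₃, h₄, -⟩ := hP' _ _ hP
  rw [act_of_mem_lev hPN hN (coe_mem_up.1 h₃), act_of_mem_lev hPN hN (coe_mem_up.1 h₄)] at hxy
  obtain ⟨hr, hl⟩ := Prod.mk.inj hxy
  exact (ctx_lev hPN hN.1 hN.2.1).not_sep_of_eq hr hl (hs.mono subset_rfl (Set.subset_univ _))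

end Levels

section Stems

/-- Every connection between two distinct stems meets two different classes of both roots. -/
def ConnectionCond (ps : PrincipalSeries S) : Prop :=
  ∀ i₁ i₂ k, 1 ≤ i₁ → i₁ ≤ ps.m → 1 ≤ i₂ → i₂ ≤ ps.m →
    1 ≤ k → k ≤ ps.m → Root ps i₁ → Root ps i₂ → i₁ ≠ i₂ →
    ps.C k \ ps.C (k + 1) ⊆ Stem ps i₁ →
    ps.C k \ ps.C (k + 1) ⊆ Stem ps i₂ →
    (∃ u ∈ ps.C k \ ps.C (k + 1), ∃ v ∈ ps.C k \ ps.C (k + 1),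
      ¬ SameClass ps i₁ u v) ∧
    (∃ u ∈ ps.C k \ ps.C (k + 1), ∃ v ∈ ps.C k \ ps.C (k + 1),
      ¬ SameClass ps i₂ u v)

/-- Edges between different levels force one level to act on the other. -/
def EdgeCond (ps : PrincipalSeries S) : Prop :=
  ∀ i j, 1 ≤ i → i ≤ ps.m → 1 ≤ j → j ≤ ps.m → i < j →
    (∃ a ∈ ps.C i \ ps.C (i + 1), ∃ b ∈ ps.C j \ ps.C (j + 1), NEdge a b) →
    ps.C i \ ps.C (i + 1) ⊆ FsetQ ps j

lemma nedge_symm {a b : S} (h : NEdge a b) : NEdge b a :=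
  ⟨h.1.symm, by rw [Set.pair_comm]; exact h.2⟩

variable {ps : PrincipalSeries S}

lemma lt_of_mem_C {i l : ℕ} {x : S} (hx : x ∈ ps.C (i + 1)) (hi : i ≤ ps.m)
    (hx' : x ∉ ps.C (l + 1)) : i < l := by
  by_contra h
  exact hx' (C_anti (by omega) (by omega) (by omega) hx)

variable [Finite S] (hPN : IsPN S)

include hPN

lemma lev_subset_stab_of_mem {k l : ℕ} (hN : NonNil ps l) (h₁ : 1 ≤ k) (h₂ : k ≤ ps.m) {a : S}
    (ha : a ∈ lev ps k) (hal : a ∈ stab ps l) : lev ps k ⊆ stab ps l := by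
  intro b hb
  obtain ⟨p, q, hpq⟩ := (ctx_lev hPN h₁ h₂).div _ (coe_mem_up.2 hb) _ (coe_mem_up.2 ha)
  induction p using WithOne.recOneCoe with
  | one =>
    induction q using WithOne.recOneCoe with
    | one =>
      rw [one_mul, mul_one] at hpq
      rwa [← WithOne.coe_inj.1 hpq]
    | coe q =>
      rw [one_mul] at hpq
      rw [WithOne.coe_inj.1 (hpq : (a : WithOne S) = ((b * q : S) : WithOne S))] at hal
      exact ((mul_mem_stab_iff hPN hN).1 hal).1
  | coe p =>
    induction q using WithOne.recOneCoe with
    | one =>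
      rw [mul_one] at hpq
      rw [WithOne.coe_inj.1 (hpq : (a : WithOne S) = ((p * b : S) : WithOne S))] at hal
      exact ((mul_mem_stab_iff hPN hN).1 hal).2
    | coe q =>
      rw [WithOne.coe_inj.1 (hpq : (a : WithOne S) = ((p * b * q : S) : WithOne S))] at hal
      exact ((mul_mem_stab_iff hPN hN).1 ((mul_mem_stab_iff hPN hN).1 hal).1).2

lemma lev_subset_FsetQ {i l : ℕ} (hN : NonNil ps l) (h₁ : 1 ≤ i) (h₂ : i ≤ ps.m) {x : S}
    (hx : x ∈ lev ps i) (hxl : x ∈ stab ps l) (hxC : x ∉ ps.C l) : lev ps i ⊆ FsetQ ps l := by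
  intro b hb
  refine (mem_FsetQ_iff hPN hN).2 ⟨lev_subset_stab_of_mem hPN hN h₁ h₂ hx hxl hb, fun hbl => ?_⟩
  have := hN.1
  have := hN.2.1
  rcases Nat.lt_or_ge i l with h | h
  · exact hb.2 (C_anti (by omega) h (by omega) hbl)
  · exact hxC (C_anti (by omega) h (by omega) hx.1)

lemma exists_lt_of_not_root {l : ℕ} (hN : NonNil ps l) (hr : ¬ Root ps l) :
    ∃ l', l < l' ∧ NonNil ps l' ∧ ∃ a ∈ lev ps l, a ∈ stab ps l' ∧ a ∉ ps.C l' := by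
  have h₁ := hN.1
  have h₂ := hN.2.1
  have : ∃ a ∈ lev ps l, ∃ b ∈ ps.C (l + 1), NEdge a b := by
    by_contra hcon
    push Not at hcon
    exact hr ⟨hN.2.2, hcon⟩
  obtain ⟨a, ha, b, hb, hab⟩ := this
  obtain ⟨l', hN', ha', hb', -⟩ := exists_act_ne_of_nedge hPN (ps := ps) hab
  have h₃ := hN'.2.1
  have hlt := lt_of_mem_C hb h₂ (notMem_of_mem_stab hN' hb')
  exact ⟨l', hlt, hN', a, ha, ha', fun h => ha.2 (C_anti (by omega) hlt (by omega) h)⟩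

lemma notMem_Kset_iff {x : S} : x ∉ Kset ps ↔ ∃ l, NonNil ps l ∧ x ∈ stab ps l := by
  constructor
  · intro hx
    obtain ⟨i, h₁, h₂, hi⟩ := exists_mem_lev ps x
    by_cases hr : Root ps i
    · have hN : NonNil ps i := ⟨h₁, h₂, hr.1⟩
      exact ⟨i, hN, lev_subset_stab hPN hN hi⟩
    · have hIs : ¬ Isolated ps i := fun h => hx ⟨i, h₁, h₂, h, hi⟩
      by_contra hcon
      refine hIs ⟨hr, fun j hj₁ hj₂ hsub => ?_⟩
      by_contra hn
      have hN : NonNil ps j := ⟨hj₁, hj₂, hn⟩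
      exact hcon ⟨j, hN, ((mem_FsetQ_iff hPN hN).1 (hsub hi)).1⟩
  · rintro ⟨l, hN, hx⟩ ⟨i, h₁, h₂, ⟨hr, hi⟩, hxi⟩
    by_cases hxl : x ∈ ps.C l
    · obtain rfl := lev_unique h₁ h₂ hN.1 hN.2.1 hxi ⟨hxl, notMem_of_mem_stab hN hx⟩
      obtain ⟨l', -, hN', a, ha, ha', haC⟩ := exists_lt_of_not_root hPN hN hr
      exact hN'.2.2 (hi l' hN'.1 hN'.2.1 (lev_subset_FsetQ hPN hN' h₁ h₂ ha ha' haC))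
    · exact hN.2.2 (hi l hN.1 hN.2.1 (lev_subset_FsetQ hPN hN h₁ h₂ hxi hx hxl))

lemma nreach_of_mem_stab {l : ℕ} (hN : NonNil ps l) {s t : S} (hs : s ∈ stab ps l)
    (ht : t ∈ stab ps l) : NReach s t := by
  by_cases h : act ps l s = act ps l t
  · obtain ⟨b, hb, hne⟩ := exists_act_ne hPN hN (act ps l s)
    have hb' := lev_subset_stab hPN hN hb
    exact (Relation.ReflTransGen.single (nedge_of_act_ne hPN hN hs hb' hne.symm)).tail
      (nedge_of_act_ne hPN hN hb' ht (h ▸ hne))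
  · exact Relation.ReflTransGen.single (nedge_of_act_ne hPN hN hs ht h)

lemma exists_root {l : ℕ} (hN : NonNil ps l) :
    ∃ r, NonNil ps r ∧ Root ps r ∧ stab ps l ⊆ stab ps r := by
  obtain ⟨n, hn⟩ : ∃ n, n = ps.m - l := ⟨_, rfl⟩
  induction n using Nat.strong_induction_on generalizing l with
  | _ n ih =>
    by_cases hr : Root ps l
    · exact ⟨l, hN, hr, subset_rfl⟩
    · obtain ⟨l', hlt, hN', a, ha, ha', -⟩ := exists_lt_of_not_root hPN hN hr
      have h₃ := hN'.2.1
      obtain ⟨r, hNr, hr, hsub⟩ := ih (ps.m - l') (by omega) hN' rfl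
      refine ⟨r, hNr, hr, fun s hs => hsub ?_⟩
      have hm := lev_subset_stab_of_mem hPN hN' hN.1 hN.2.1 ha ha' (stab_mul_mem hPN hN hs ha).1
      exact ((mul_mem_stab_iff hPN hN').1 hm).1

lemma nedge_of_act_eq {r : ℕ} (hN : NonNil ps r) (hr : Root ps r) {u v x : S}
    (hv : v ∈ stab ps r) (huv : act ps r u = act ps r v) (hx : x ∈ lev ps r) (h : NEdge u x) :
    NEdge v x := by
  obtain ⟨l, hN', -, hx', hne⟩ := exists_act_ne_of_nedge hPN (ps := ps) h
  have h₁ := hN.1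
  have h₂ := hN.2.1
  have h₃ := hN'.2.1
  rcases lt_trichotomy l r with hlt | rfl | hlt
  · exact absurd (C_anti (by omega) hlt (by omega) hx.1) (notMem_of_mem_stab hN' hx')
  · exact nedge_of_act_ne hPN hN hv hx' (huv ▸ hne)
  · obtain ⟨b, hb, hbx⟩ := exists_act_ne hPN hN' (act ps l x)
    exact absurd (nedge_of_act_ne hPN hN' hx' (lev_subset_stab hPN hN' hb) hbx.symm)
      (hr.2 x hx b (C_anti (by omega) hlt (by omega) hb.1))

lemma sameClass_of_act_eq {r : ℕ} (hN : NonNil ps r) (hr : Root ps r) {u v : S}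
    (hu : u ∈ stab ps r) (hv : v ∈ stab ps r) (huv : act ps r u = act ps r v) :
    SameClass ps r u v :=
  fun _ hx => ⟨nedge_of_act_eq hPN hN hr hv huv hx, nedge_of_act_eq hPN hN hr hu huv.symm hx⟩

lemma exists_act_ne_act {r : ℕ} (hN : NonNil ps r) : ∃ u ∈ lev ps r, ∃ v ∈ lev ps r,
    act ps r u ≠ act ps r v := by
  obtain ⟨u, hu⟩ := lev_nonempty hN.1 hN.2.1
  obtain ⟨v, hv, hne⟩ := exists_act_ne hPN hN (act ps r u)
  exact ⟨u, hu, v, hv, hne.symm⟩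

lemma exists_connection (H1 : ConnectionCond ps) {r s : ℕ} (hN : NonNil ps r) (hr : Root ps r)
    (hN' : NonNil ps s) (hs : Root ps s) (hD : (stab ps r ∩ stab ps s).Nonempty) :
    ∃ k, NonNil ps k ∧ stab ps k = stab ps r ∩ stab ps s ∧
      (∃ u ∈ lev ps k, ∃ v ∈ lev ps k, act ps r u ≠ act ps r v) ∧
      ∃ u ∈ lev ps k, ∃ v ∈ lev ps k, act ps s u ≠ act ps s v := by
  classical
  rcases eq_or_ne r s with rfl | hrs
  · exact ⟨r, hN, (Set.inter_self _).symm, exists_act_ne_act hPN hN, exists_act_ne_act hPN hN⟩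
  set D := stab ps r ∩ stab ps s with hDdef
  obtain ⟨d, hd⟩ := hD
  obtain ⟨i, hi₁, hi₂, hi⟩ := exists_mem_lev ps d
  let Q : ℕ → Prop := fun k => 1 ≤ k ∧ ∃ a ∈ D, a ∈ lev ps k
  set k := Nat.findGreatest Q ps.m with hk
  have hQ : Q k := Nat.findGreatest_spec hi₂ ⟨hi₁, d, hd, hi⟩
  have h₂ : k ≤ ps.m := Nat.findGreatest_le _
  obtain ⟨h₁, a, haD, ha⟩ := hQ
  have hsubr := lev_subset_stab_of_mem hPN hN h₁ h₂ ha haD.1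
  have hsubs := lev_subset_stab_of_mem hPN hN' h₁ h₂ ha haD.2
  have hDmul : ∀ g ∈ D, ∀ b ∈ lev ps k, g * b ∈ lev ps k := by
    intro g hg b hb
    have hC : g * b ∈ ps.C k := ((ps.ideal k h₁ h₂).2 b hb.1 g trivial).1
    have hgb : g * b ∈ D := ⟨(mul_mem_stab_iff hPN hN).2 ⟨hg.1, hsubr hb⟩,
      (mul_mem_stab_iff hPN hN').2 ⟨hg.2, hsubs hb⟩⟩
    obtain ⟨j, hj₁, hj₂, hj⟩ := exists_mem_lev ps (g * b)
    have hjk : j ≤ k := Nat.le_findGreatest hj₂ ⟨hj₁, _, hgb, hj⟩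
    rcases hjk.lt_or_eq with hlt | rfl
    · exact absurd (C_anti (by omega) hlt (by omega) hC) hj.2
    · exact hj
  obtain ⟨⟨u, hu, v, hv, huv⟩, u', hu', v', hv', huv'⟩ :=
    H1 r s k hN.1 hN.2.1 hN'.1 hN'.2.1 h₁ h₂ hr hs hrs
      (by rw [Stem_eq_stab hPN hN]; exact hsubr) (by rw [Stem_eq_stab hPN hN']; exact hsubs)
  have hne : act ps r u ≠ act ps r v := fun h =>
    huv (sameClass_of_act_eq hPN hN hr (hsubr hu) (hsubr hv) h)
  have hne' : act ps s u' ≠ act ps s v' := fun h =>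
    huv' (sameClass_of_act_eq hPN hN' hs (hsubs hu') (hsubs hv') h)
  have hNk : NonNil ps k := by
    refine ⟨h₁, h₂, ?_⟩
    rintro ⟨n, -, hn⟩
    have hseq : ∀ n, (malcev u v (fun _ => none) n).1 ∈ lev ps k ∧
        (malcev u v (fun _ => none) n).2 ∈ lev ps k ∧
        act ps r (malcev u v (fun _ => none) n).1 ≠ act ps r (malcev u v (fun _ => none) n).2 := by
      intro n
      induction n with
      | zero => exact ⟨hu, hv, hne⟩
      | succ n ih =>
        obtain ⟨ih₁, ih₂, ih₃⟩ := ih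
        simp only [malcev, mulW]
        refine ⟨hDmul _ ⟨hsubr ih₁, hsubs ih₁⟩ _ ih₂, hDmul _ ⟨hsubr ih₂, hsubs ih₂⟩ _ ih₁, ?_⟩
        rw [act_mul hPN hN (hsubr ih₁) (hsubr ih₂), act_mul hPN hN (hsubr ih₂) (hsubr ih₁)]
        intro h
        exact ih₃ (Prod.ext (Prod.mk.inj h).1 (Prod.mk.inj h).2.symm)
    obtain ⟨h₃, h₄, h₅⟩ := hseq n
    rcases hn u hu.1 v hv.1 (fun _ => none) (fun _ _ h => by simp at h) with h | h
    · exact h₅ (by rw [h])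
    · exact h₃.2 h.1
  refine ⟨k, hNk, Set.Subset.antisymm ?_ fun g hg => ⟨a, ha, hDmul g hg a ha⟩,
    ⟨u, hu, v, hv, hne⟩, u', hu', v', hv', hne'⟩
  rintro g ⟨b, hb, hgb⟩
  exact ⟨((mul_mem_stab_iff hPN hN).1 (hsubr hgb)).1, ((mul_mem_stab_iff hPN hN').1 (hsubs hgb)).1⟩

lemma stab_inter_trans (H1 : ConnectionCond ps) (H2 : EdgeCond ps) {r s t : ℕ}
    (hNr : NonNil ps r) (hr : Root ps r) (hNs : NonNil ps s) (hs : Root ps s)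
    (hNt : NonNil ps t) (ht : Root ps t) (hrs : (stab ps r ∩ stab ps s).Nonempty)
    (hst : (stab ps s ∩ stab ps t).Nonempty) : (stab ps r ∩ stab ps t).Nonempty := by
  obtain ⟨p, hp, hDp, -, u, hu, -⟩ := exists_connection hPN H1 hNr hr hNs hs hrs
  obtain ⟨q, hq, hDq, ⟨v₁, hv₁, v₂, hv₂, hne⟩, -⟩ := exists_connection hPN H1 hNs hs hNt ht hst
  have hpsub := lev_subset_stab hPN hp
  have hqsub := lev_subset_stab hPN hq
  have hpr : stab ps p ⊆ stab ps r ∩ stab ps s := hDp.subset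
  have hqt : stab ps q ⊆ stab ps s ∩ stab ps t := hDq.subset
  obtain ⟨v, hv, huv⟩ : ∃ v ∈ lev ps q, act ps s u ≠ act ps s v := by
    by_cases h : act ps s u = act ps s v₁
    · exact ⟨v₂, hv₂, h ▸ hne⟩
    · exact ⟨v₁, hv₁, h⟩
  have hedge := nedge_of_act_ne hPN hNs (hpr (hpsub hu)).2 (hqt (hqsub hv)).1 huv
  rcases lt_trichotomy p q with hlt | rfl | hlt
  · have hF := H2 p q hp.1 hp.2.1 hq.1 hq.2.1 hlt ⟨u, hu, v, hv, hedge⟩ hu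
    exact ⟨u, (hpr (hpsub hu)).1, (hqt ((mem_FsetQ_iff hPN hq).1 hF).1).2⟩
  · exact ⟨u, (hpr (hpsub hu)).1, (hqt (hpsub hu)).2⟩
  · have hF := H2 q p hq.1 hq.2.1 hp.1 hp.2.1 hlt ⟨v, hv, u, hu, nedge_symm hedge⟩ hv
    exact ⟨v, (hpr ((mem_FsetQ_iff hPN hp).1 hF).1).1, (hqt (hqsub hv)).2⟩

lemma exists_roots_of_nreach (H1 : ConnectionCond ps) (H2 : EdgeCond ps) {x y : S}
    (hx : x ∉ Kset ps) (h : NReach x y) : ∃ r s, NonNil ps r ∧ Root ps r ∧ NonNil ps s ∧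
      Root ps s ∧ x ∈ stab ps r ∧ y ∈ stab ps s ∧ (stab ps r ∩ stab ps s).Nonempty := by
  induction h with
  | refl =>
    obtain ⟨l, hN, hxl⟩ := (notMem_Kset_iff hPN).1 hx
    obtain ⟨r, hNr, hr, hsub⟩ := exists_root hPN hN
    exact ⟨r, r, hNr, hr, hNr, hr, hsub hxl, hsub hxl, x, hsub hxl, hsub hxl⟩
  | tail _ hyz ih =>
    obtain ⟨r, s, hNr, hr, hNs, hs, hxr, hys, hrs⟩ := ih
    obtain ⟨l, hN, hyl, hzl, -⟩ := exists_act_ne_of_nedge hPN (ps := ps) hyz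
    obtain ⟨t, hNt, ht, hsub⟩ := exists_root hPN hN
    exact ⟨r, t, hNr, hr, hNt, ht, hxr, hsub hzl,
      stab_inter_trans hPN H1 H2 hNr hr hNs hs hNt ht hrs ⟨_, hys, hsub hyl⟩⟩

lemma nreach_iff (H1 : ConnectionCond ps) (H2 : EdgeCond ps) {x y : S} (hx : x ∉ Kset ps) :
    NReach x y ↔ ∃ z : S, x * z ∉ Kset ps ∧ z * y ∉ Kset ps := by
  constructor
  · intro h
    obtain ⟨r, s, hNr, -, hNs, -, hxr, hys, z, hzr, hzs⟩ := exists_roots_of_nreach hPN H1 H2 hx h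
    exact ⟨z, (notMem_Kset_iff hPN).2 ⟨r, hNr, (mul_mem_stab_iff hPN hNr).2 ⟨hxr, hzr⟩⟩,
      (notMem_Kset_iff hPN).2 ⟨s, hNs, (mul_mem_stab_iff hPN hNs).2 ⟨hzs, hys⟩⟩⟩
  · rintro ⟨z, h₁, h₂⟩
    obtain ⟨i, hNi, hi⟩ := (notMem_Kset_iff hPN).1 h₁
    obtain ⟨j, hNj, hj⟩ := (notMem_Kset_iff hPN).1 h₂
    obtain ⟨hxi, hzi⟩ := (mul_mem_stab_iff hPN hNi).1 hi
    obtain ⟨hzj, hyj⟩ := (mul_mem_stab_iff hPN hNj).1 hj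
    exact (nreach_of_mem_stab hPN hNi hxi hzi).trans (nreach_of_mem_stab hPN hNj hzj hyj)

end Stems

end PseudoNilpotent

/-- Let `S` be a strong pseudo-nilpotent finite semigroup, i.e. pseudo-nilpotent
and satisfying:
(H1) every connection `S_k \ S_{k+1}` between two distinct stems meets two
different pseudo-nilpotent classes of each of the two associated pseudo-nilpotent
homomorphisms; and
(H2) if `i < j` and some element of `S_i \ S_{i+1}` is joined by an `N_S`-edge to
some element of `S_j \ S_{j+1}`, then `S_i \ S_{i+1} ⊆ F_{S_j/S_{j+1}}(S/S_{j+1})`.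
Then two elements `x, y ∈ S \ K` lie in the same connected component of `N_S`
iff there is `z ∈ S` with `xz ∉ K` and `zy ∉ K`. -/
theorem stmt19 {S : Type*} [Semigroup S] [Finite S] [Nonempty S]
    (hPN : IsPN S) (ps : PrincipalSeries S)
    (H1 : ∀ i₁ i₂ k, 1 ≤ i₁ → i₁ ≤ ps.m → 1 ≤ i₂ → i₂ ≤ ps.m →
      1 ≤ k → k ≤ ps.m → Root ps i₁ → Root ps i₂ → i₁ ≠ i₂ →
      ps.C k \ ps.C (k + 1) ⊆ Stem ps i₁ →
      ps.C k \ ps.C (k + 1) ⊆ Stem ps i₂ →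
      (∃ u ∈ ps.C k \ ps.C (k + 1), ∃ v ∈ ps.C k \ ps.C (k + 1),
        ¬ SameClass ps i₁ u v) ∧
      (∃ u ∈ ps.C k \ ps.C (k + 1), ∃ v ∈ ps.C k \ ps.C (k + 1),
        ¬ SameClass ps i₂ u v))
    (H2 : ∀ i j, 1 ≤ i → i ≤ ps.m → 1 ≤ j → j ≤ ps.m → i < j →
      (∃ a ∈ ps.C i \ ps.C (i + 1), ∃ b ∈ ps.C j \ ps.C (j + 1), NEdge a b) →
      ps.C i \ ps.C (i + 1) ⊆ FsetQ ps j)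
    (x y : S) (hx : x ∉ Kset ps) (hy : y ∉ Kset ps) :
    NReach x y ↔ ∃ z : S, x * z ∉ Kset ps ∧ z * y ∉ Kset ps := by
  exact PseudoNilpotent.nreach_iff hPN H1 H2 hx
end
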